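/- arXiv:1501.00869 — 2 statements merged into one kernel-verified Lean document; each statement's English description precedes it below -/
import Mathlib

section
/- For every integer m ≥ 4, the graph T_m is 5-critical. Here T_m is obtained as follows: take cycles C_1 = [c_{1,1} c_{1,2} c_{1,3} c_{1,4}] and C_m = [c_{m,1} c_{m,2} c_{m,3} c_{m,4}] of length 4, and cycles C_i = [c_{i,1} c_{i,2} ⋯ c_{i,8}] of length 8 for 2 ≤ i ≤ m−1; add edges c_{1,j} c_{2,2j−1}, c_{1,j} c_{2,2j}, c_{1,j} c_{2,2j+1} for 1 ≤ j ≤ 4 (second indices on C_2 taken modulo 8), edges c_{i,j} c_{i+1,j} for 2 ≤ i ≤ m−2 and 1 ≤ j ≤ 8, edges c_{i,j} c_{i+1,j+1} for 2 ≤ i ≤ m−2 and j ∈ {2,4,6,8} (second indices modulo 8), and edges c_{m−1,2j−2} c_{m,j}, c_{m−1,2j−1} c_{m,j}, c_{m−1,2j} c_{m,j} for 1 ≤ j ≤ 4 (first indices modulo 8); this yields a 5-regular graph T, and T_m is obtained from T by subdividing the edge c_{m,1} c_{m,2}. -/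
open SimpleGraph

variable {V : Type*}

/-- `c` is a proper edge coloring of `G` using colors `0, …, n-1`:
every edge gets a color `< n`, and distinct edges sharing an endpoint
receive distinct colors. -/
def IsProperEdgeColoring (G : SimpleGraph V) (n : ℕ) (c : Sym2 V → ℕ) : Prop :=
  (∀ e ∈ G.edgeSet, c e < n) ∧
    ∀ e₁ ∈ G.edgeSet, ∀ e₂ ∈ G.edgeSet, e₁ ≠ e₂ → (∃ v, v ∈ e₁ ∧ v ∈ e₂) →
      c e₁ ≠ c e₂

/-- The edge chromatic number `χ'(G)`: the least number of colors in a proper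
edge coloring of `G`. -/
noncomputable def edgeChromaticNumber (G : SimpleGraph V) : ℕ :=
  sInf {n | ∃ c, IsProperEdgeColoring G n c}

/-- The degree `d_G(v)` of a vertex. -/
noncomputable def deg (G : SimpleGraph V) (v : V) : ℕ := (G.neighborSet v).ncard

/-- The maximum vertex degree `Δ(G)`. -/
noncomputable def maxDeg (G : SimpleGraph V) : ℕ := sSup {d | ∃ v, deg G v = d}

/-- `G` is critical: it is class 2 (i.e. `χ'(G) ≠ Δ(G)`) and every proper
subgraph `H` of `G` satisfies `χ'(H) < χ'(G)`. -/
def IsCritical (G : SimpleGraph V) : Prop :=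
  edgeChromaticNumber G ≠ maxDeg G ∧
    ∀ H : G.Subgraph, H ≠ ⊤ → edgeChromaticNumber H.coe < edgeChromaticNumber G

/-- `G` is `k`-critical: critical with maximum degree `k`. -/
def IsKCritical (G : SimpleGraph V) (k : ℕ) : Prop :=
  IsCritical G ∧ maxDeg G = k

/-- The generating relation of the graph `T_m` of the paper, with all indices
shifted to be 0-based.  Vertices: `.inl a` is `c_{1,a+1}` (the inner 4-cycle
`C_1`), `.inr (.inl (i, b))` is `c_{i+2,b+1}` (the 8-cycles `C_2, …, C_{m-1}`;
the row index `i : Fin (m-2)` stands for the row `i+2`),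
`.inr (.inr (.inl a))` is `c_{m,a+1}` (the outer 4-cycle `C_m`), and
`.inr (.inr (.inr ()))` is the vertex `u` subdividing the edge
`c_{m,1} c_{m,2}`.  Second indices on 4-cycles live in `ZMod 4` and on
8-cycles in `ZMod 8`, realizing the "indices modulo" conventions.  Edges:
the cycles `C_1, …, C_m` (with the edge `c_{m,1} c_{m,2}`, i.e. 0-based
`(m,0)(m,1)`, removed), the edges `c_{1,j} c_{2,2j-1}`, `c_{1,j} c_{2,2j}`,
`c_{1,j} c_{2,2j+1}` (0-based: `x_a ~ (0, 2a)`, `(0, 2a+1)`, `(0, 2a+2)`),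
the vertical edges `c_{i,j} c_{i+1,j}` and diagonal edges
`c_{i,j} c_{i+1,j+1}` for even `j` (0-based: odd `b`) between consecutive
8-cycles, the edges `c_{m-1,2j-2} c_{m,j}`, `c_{m-1,2j-1} c_{m,j}`,
`c_{m-1,2j} c_{m,j}` (0-based: `(last, 2a-1)`, `(last, 2a)`, `(last, 2a+1)`
`~ z_a`), and the two edges `c_{m,1} u`, `c_{m,2} u` (0-based: `z_0 u`,
`z_1 u`). -/
def TmRel (m : ℕ) :
    (ZMod 4 ⊕ Fin (m - 2) × ZMod 8 ⊕ ZMod 4 ⊕ Unit) →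
      (ZMod 4 ⊕ Fin (m - 2) × ZMod 8 ⊕ ZMod 4 ⊕ Unit) → Prop
  | .inl a, .inl a' => a' = a + 1
  | .inl a, .inr (.inl (i, b)) =>
      i.val = 0 ∧ (b = 2 * (a.val : ZMod 8) ∨ b = 2 * (a.val : ZMod 8) + 1 ∨
        b = 2 * (a.val : ZMod 8) + 2)
  | .inr (.inl (i, b)), .inr (.inl (i', b')) =>
      (i = i' ∧ b' = b + 1) ∨
        (i'.val = i.val + 1 ∧ (b' = b ∨ (b.val % 2 = 1 ∧ b' = b + 1)))
  | .inr (.inl (i, b)), .inr (.inr (.inl a)) =>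
      i.val + 3 = m ∧ (b = 2 * (a.val : ZMod 8) - 1 ∨ b = 2 * (a.val : ZMod 8) ∨
        b = 2 * (a.val : ZMod 8) + 1)
  | .inr (.inr (.inl a)), .inr (.inr (.inl a')) => a' = a + 1 ∧ ¬(a = 0 ∧ a' = 1)
  | .inr (.inr (.inl a)), .inr (.inr (.inr _)) => a = 0 ∨ a = 1
  | _, _ => False

/-- `T_m`: the graph of the paper, obtained from the 5-regular planar graph `T`
by subdividing the edge `c_{m,1} c_{m,2}`. -/
def Tm (m : ℕ) : SimpleGraph (ZMod 4 ⊕ Fin (m - 2) × ZMod 8 ⊕ ZMod 4 ⊕ Unit) :=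
  SimpleGraph.fromRel (TmRel m)

/-- The vertices of `Tm m`. -/
abbrev TmVertex (m : ℕ) := ZMod 4 ⊕ Fin (m - 2) × ZMod 8 ⊕ ZMod 4 ⊕ Unit

/-- Labels for the edges of `Tm m`. `inner a` and `outer a` join the vertices `a`, `a + 1` of the
first and the last cycle, and `ring i b` joins `b`, `b + 1` on the `i`-th 8-cycle, counted from `0`.
The cut `i` consists of the edges between the `i`-th 8-cycle (or the last 4-cycle, if `i = m - 2`)
and the layer above it: `straight i b` lies in column `b`, and `diag i a` runs from column `2a + 1`
to column `2a + 2`. Finally, `spoke a` joins the subdividing vertex to `a`. -/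
inductive TmEdge
  | inner (a : ZMod 4)
  | straight (i : ℕ) (b : ZMod 8)
  | diag (i : ℕ) (a : ZMod 4)
  | ring (i : ℕ) (b : ZMod 8)
  | outer (a : ZMod 4)
  | spoke (a : ZMod 4)

namespace TmEdge

variable {m : ℕ}

/-- The vertex of a 4-cycle that takes the place of the vertices `2a`, `2a + 1` of an 8-cycle. -/
def half (b : ZMod 8) : ZMod 4 := ((b.val / 2 : ℕ) : ZMod 4)

/-- The label of an ordered pair related by `TmRel m`. -/
def label (m : ℕ) : TmVertex m → TmVertex m → TmEdge
  | .inl a, .inl _ => inner a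
  | .inl a, .inr (.inl (_, b)) => if b = 2 * (a.val : ZMod 8) + 2 then diag 0 a else straight 0 b
  | .inr (.inl (i, b)), .inr (.inl (i', b')) =>
      if i = i' then ring i b else if b' = b then straight (i + 1) b else diag (i + 1) (half b)
  | .inr (.inl (_, b)), .inr (.inr (.inl a)) =>
      if b = 2 * (a.val : ZMod 8) - 1 then diag (m - 2) (half b) else straight (m - 2) b
  | .inr (.inr (.inl a)), .inr (.inr (.inl _)) => outer a
  | .inr (.inr (.inl a)), .inr (.inr (.inr _)) => spoke a
  | _, _ => inner 0

/-- `e` is the label of the edge between `v` and `w`. -/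
def Joins (m : ℕ) (v w : TmVertex m) (e : TmEdge) : Prop :=
  (TmRel m v w ∧ label m v w = e) ∨ (TmRel m w v ∧ label m w v = e)

theorem Joins.symm {v w : TmVertex m} {e : TmEdge} (h : Joins m v w e) : Joins m w v e :=
  Or.symm h

theorem _root_.TmRel.irrefl (v : TmVertex m) : ¬ TmRel m v v := by
  have h4 : ∀ a : ZMod 4, a ≠ a + 1 := by decide
  have h8 : ∀ a : ZMod 8, a ≠ a + 1 := by decide
  rcases v with a | ⟨i, b⟩ | a | _ <;> simp only [TmRel, not_false_eq_true, not_and, not_or]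
  · exact h4 a
  · exact ⟨fun _ => h8 b, by omega⟩
  · exact fun h => absurd h (h4 a)

theorem _root_.TmRel.asymm {v w : TmVertex m} (h : TmRel m v w) : ¬ TmRel m w v := by
  have h4 : ∀ a : ZMod 4, a ≠ a + 1 + 1 := by decide
  have h8 : ∀ a : ZMod 8, a ≠ a + 1 + 1 := by decide
  rcases v with a | ⟨i, b⟩ | a | _ <;> rcases w with a' | ⟨i', b'⟩ | a' | _ <;>
    simp only [TmRel, not_false_eq_true, not_and, not_or] at h ⊢
  · subst h; exact h4 _
  · rcases h with ⟨rfl, rfl⟩ | ⟨h, -⟩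
    · exact ⟨fun _ => h8 _, by simp⟩
    · refine ⟨?_, by omega⟩
      rintro rfl; omega
  · obtain ⟨rfl, -⟩ := h
    exact fun h => absurd h (h4 _)

theorem adj_iff {v w : TmVertex m} : (Tm m).Adj v w ↔ ∃ e, Joins m v w e := by
  simp only [Tm, SimpleGraph.fromRel_adj, Joins]
  constructor
  · rintro ⟨-, h | h⟩
    · exact ⟨_, .inl ⟨h, rfl⟩⟩
    · exact ⟨_, .inr ⟨h, rfl⟩⟩
  · rintro ⟨e, ⟨h, -⟩ | ⟨h, -⟩⟩
    · exact ⟨by rintro rfl; exact TmRel.irrefl _ h, .inl h⟩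
    · exact ⟨by rintro rfl; exact TmRel.irrefl _ h, .inr h⟩

theorem Joins.unique {v w : TmVertex m} {e e' : TmEdge} (h : Joins m v w e)
    (h' : Joins m v w e') : e = e' := by
  rcases h with ⟨h, rfl⟩ | ⟨h, rfl⟩ <;> rcases h' with ⟨h', rfl⟩ | ⟨h', rfl⟩
  · rfl
  · exact absurd h' h.asymm
  · exact absurd h' h.asymm
  · rfl

theorem label_inj {v w v' w' : TmVertex m} (h : TmRel m v w) (h' : TmRel m v' w')
    (he : label m v w = label m v' w') : v = v' ∧ w = w' := by
  have h4 : ∀ (a : ZMod 4) (b : ZMod 8), (b = 2 * (a.val : ZMod 8) ∨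
      b = 2 * (a.val : ZMod 8) + 1 ∨ b = 2 * (a.val : ZMod 8) + 2) →
      ¬ b = 2 * (a.val : ZMod 8) + 2 → half b = a := by decide
  have h8 : ∀ (b b' : ZMod 8), b.val % 2 = 1 → b'.val % 2 = 1 → half b = half b' → b = b' := by
    decide
  have h5 : ∀ (a : ZMod 4) (b : ZMod 8), (b = 2 * (a.val : ZMod 8) - 1 ∨
      b = 2 * (a.val : ZMod 8) ∨ b = 2 * (a.val : ZMod 8) + 1) →
      ¬ b = 2 * (a.val : ZMod 8) - 1 → half b = a := by decide
  have h6 : ∀ (a a' : ZMod 4), half (2 * (a.val : ZMod 8) - 1) = half (2 * (a'.val : ZMod 8) - 1) →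
      a = a' := by decide
  rcases v with a | ⟨⟨i, hi⟩, b⟩ | a | _ <;> rcases w with c | ⟨⟨j, hj⟩, c⟩ | c | _ <;>
    simp only [TmRel] at h <;>
    rcases v' with a' | ⟨⟨i', hi'⟩, b'⟩ | a' | _ <;>
    rcases w' with c' | ⟨⟨j', hj'⟩, c'⟩ | c' | _ <;>
    simp only [TmRel] at h' <;> simp only [label] at he
  all_goals try split_ifs at he
  all_goals first
    | (exfalso; exact TmEdge.noConfusion he)
    | grind
    | (have := h4 _ _ h.2 ‹_›; have := h4 _ _ h'.2 ‹_›; grind)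
    | (have := h5 _ _ h.2 ‹_›; have := h5 _ _ h'.2 ‹_›; grind)

theorem Joins.edge_unique {v w v' w' : TmVertex m} {e : TmEdge} (h : Joins m v w e)
    (h' : Joins m v' w' e) : s(v, w) = s(v', w') := by
  rcases h with ⟨h, rfl⟩ | ⟨h, rfl⟩ <;> rcases h' with ⟨h', he⟩ | ⟨h', he⟩ <;>
    obtain ⟨rfl, rfl⟩ := label_inj h h' he.symm
  · rfl
  · exact Sym2.eq_swap
  · exact Sym2.eq_swap
  · rfl

/-- The neighbor above the `i`-th 8-cycle in column `b`. -/
def up (m : ℕ) (i : Fin (m - 2)) (b : ZMod 8) : TmVertex m :=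
  if i.val = 0 then .inl (half b) else .inr (.inl (⟨i - 1, by omega⟩, b))

/-- The neighbor below the `i`-th 8-cycle in column `b`. -/
def down (m : ℕ) (i : Fin (m - 2)) (b : ZMod 8) : TmVertex m :=
  if h : i.val + 1 < m - 2 then .inr (.inl (⟨i + 1, h⟩, b)) else .inr (.inr (.inl (half b)))

/-- The neighbors of a vertex together with the labels of the connecting edges. -/
def star (m : ℕ) (hm : 4 ≤ m) : TmVertex m → List (TmVertex m × TmEdge)
  | .inl a =>
      let b : ZMod 8 := 2 * (a.val : ZMod 8)
      let r (x : ZMod 8) : TmVertex m := .inr (.inl (⟨0, by omega⟩, x))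
      [(.inl (a + 1), inner a), (.inl (a - 1), inner (a - 1)),
        (r b, straight 0 b), (r (b + 1), straight 0 (b + 1)), (r (b + 2), diag 0 a)]
  | .inr (.inl (i, b)) =>
      [(.inr (.inl (i, b + 1)), ring i b), (.inr (.inl (i, b - 1)), ring i (b - 1)),
        (up m i b, straight i b), (down m i b, straight (i + 1) b),
        if b.val % 2 = 1 then (down m i (b + 1), diag (i + 1) (half b))
          else (up m i (b - 1), diag i (half (b - 1)))]
  | .inr (.inr (.inl a)) =>
      let b : ZMod 8 := 2 * (a.val : ZMod 8)
      let r (x : ZMod 8) : TmVertex m := .inr (.inl (⟨m - 3, by omega⟩, x))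
      [(r b, straight (m - 2) b), (r (b + 1), straight (m - 2) (b + 1)),
        (r (b - 1), diag (m - 2) (a - 1)),
        if a = 0 then (.inr (.inr (.inr ())), spoke a)
          else (.inr (.inr (.inl (a + 1))), outer a),
        if a = 1 then (.inr (.inr (.inr ())), spoke a)
          else (.inr (.inr (.inl (a - 1))), outer (a - 1))]
  | .inr (.inr (.inr _)) => [(.inr (.inr (.inl 0)), spoke 0), (.inr (.inr (.inl 1)), spoke 1)]

theorem mem_star_left (hm : 4 ≤ m) {v w : TmVertex m} (h : TmRel m v w) :
    (w, label m v w) ∈ star m hm v := by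
  have h8 : ∀ b : ZMod 8, b + 1 ≠ b := by decide
  have hs : ∀ a : ZMod 4, 2 * (a.val : ZMod 8) ≠ 2 * (a.val : ZMod 8) + 2 ∧
      2 * (a.val : ZMod 8) + 1 ≠ 2 * (a.val : ZMod 8) + 2 := by decide
  have ho : ∀ (b : ZMod 8) (a : ZMod 4), (b = 2 * (a.val : ZMod 8) - 1 ∨ b = 2 * (a.val : ZMod 8) ∨
      b = 2 * (a.val : ZMod 8) + 1) → if b = 2 * (a.val : ZMod 8) - 1
        then b.val % 2 = 1 ∧ half (b + 1) = a else half b = a := by decide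
  rcases v with a | ⟨⟨i, hi⟩, b⟩ | a | _ <;> rcases w with c | ⟨⟨j, hj⟩, c⟩ | c | _ <;>
    simp only [TmRel] at h
  · subst h; simp [-ZMod.natCast_val, star, label]
  · obtain ⟨rfl, rfl | rfl | rfl⟩ := h <;> simp [-ZMod.natCast_val, star, label, hs]
  · rcases h with ⟨h, rfl⟩ | ⟨rfl, rfl | ⟨hb, rfl⟩⟩
    · cases h; simp [-ZMod.natCast_val, star, label]
    · simp [-ZMod.natCast_val, star, label, down, hj]
    · simp [-ZMod.natCast_val, star, label, down, hj, hb, h8]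
  · have hi' : m - 2 = i + 1 := by omega
    have := ho _ _ h.2
    split_ifs at this with hb
    · simp [-ZMod.natCast_val, star, label, down, hi', this, ← hb]
    · simp [-ZMod.natCast_val, star, label, down, hi', this, hb]
  · obtain ⟨rfl, h⟩ := h
    have : a ≠ 0 := by rintro rfl; exact h ⟨rfl, by decide⟩
    simp [-ZMod.natCast_val, star, label, this]
  · rcases h with rfl | rfl <;> simp [-ZMod.natCast_val, star, label]

theorem mem_star_right (hm : 4 ≤ m) {v w : TmVertex m} (h : TmRel m v w) :
    (v, label m v w) ∈ star m hm w := by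
  have h8 : ∀ b : ZMod 8, b + 1 ≠ b := by decide
  have hs : ∀ a : ZMod 4, 2 * (a.val : ZMod 8) - 1 ≠ 2 * (a.val : ZMod 8) ∧
      2 * (a.val : ZMod 8) - 1 ≠ 2 * (a.val : ZMod 8) + 1 ∧
      half (2 * (a.val : ZMod 8) - 1) = a - 1 := by decide
  have hp : ∀ b : ZMod 8, b.val % 2 = 1 → (b + 1).val % 2 ≠ 1 := by decide
  have ho : ∀ (b : ZMod 8) (a : ZMod 4), (b = 2 * (a.val : ZMod 8) ∨ b = 2 * (a.val : ZMod 8) + 1 ∨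
      b = 2 * (a.val : ZMod 8) + 2) → if b = 2 * (a.val : ZMod 8) + 2
        then b.val % 2 ≠ 1 ∧ half (b - 1) = a else half b = a := by decide
  rcases v with a | ⟨⟨i, hi⟩, b⟩ | a | _ <;> rcases w with c | ⟨⟨j, hj⟩, c⟩ | c | _ <;>
    simp only [TmRel] at h
  · subst h; simp [-ZMod.natCast_val, star, label]
  · obtain ⟨rfl, h⟩ := h
    have := ho _ _ h
    split_ifs at this with hb
    · simp [-ZMod.natCast_val, star, label, up, this, ← hb]
    · simp [-ZMod.natCast_val, star, label, up, this, hb]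
  · rcases h with ⟨h, rfl⟩ | ⟨rfl, rfl | ⟨hb, rfl⟩⟩
    · cases h; simp [-ZMod.natCast_val, star, label]
    · simp [-ZMod.natCast_val, star, label, up]
    · simp [-ZMod.natCast_val, star, label, up, hp b hb, h8]
  · obtain rfl : i = m - 3 := by omega
    obtain ⟨-, rfl | rfl | rfl⟩ := h <;>
      simp [-ZMod.natCast_val, star, label, hs, (hs _).1.symm, (hs _).2.1.symm]
  · obtain ⟨rfl, h⟩ := h
    have : a + 1 ≠ 1 := by
      intro h'; exact h ⟨by simpa using h', h'⟩
    simp [-ZMod.natCast_val, star, label, this]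
  · rcases h with rfl | rfl <;> simp [-ZMod.natCast_val, star, label]

theorem joins_of_mem_star (hm : 4 ≤ m) {v w : TmVertex m} {e : TmEdge}
    (h : (w, e) ∈ star m hm v) : Joins m v w e := by
  have h8 : ∀ b : ZMod 8, b + 1 ≠ b ∧ b ≠ b - 1 := by decide
  have hs : ∀ a : ZMod 4, 2 * (a.val : ZMod 8) ≠ 2 * (a.val : ZMod 8) + 2 ∧
      2 * (a.val : ZMod 8) + 1 ≠ 2 * (a.val : ZMod 8) + 2 := by decide
  have ht : ∀ a : ZMod 4, 2 * (a.val : ZMod 8) ≠ 2 * (a.val : ZMod 8) - 1 ∧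
      2 * (a.val : ZMod 8) + 1 ≠ 2 * (a.val : ZMod 8) - 1 ∧
      half (2 * (a.val : ZMod 8) - 1) = a - 1 := by decide
  have hu : ∀ b : ZMod 8, b ≠ 2 * ((half b).val : ZMod 8) + 2 ∧
      (b = 2 * ((half b).val : ZMod 8) ∨ b = 2 * ((half b).val : ZMod 8) + 1) := by decide
  have hu' : ∀ b : ZMod 8, ¬ b.val % 2 = 1 → (b - 1).val % 2 = 1 ∧
      b = 2 * ((half (b - 1)).val : ZMod 8) + 2 := by decide
  have hd : ∀ b : ZMod 8, b ≠ 2 * ((half b).val : ZMod 8) - 1 ∧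
      (b = 2 * ((half b).val : ZMod 8) ∨ b = 2 * ((half b).val : ZMod 8) + 1) := by decide
  have hd' : ∀ b : ZMod 8, b.val % 2 = 1 →
      b = 2 * ((half (b + 1)).val : ZMod 8) - 1 := by decide
  rcases v with a | ⟨⟨i, hi⟩, b⟩ | a | _ <;>
    simp only [star, List.mem_cons, List.not_mem_nil, or_false, Prod.mk.injEq] at h
  · rcases h with h | h | h | h | h <;> obtain ⟨rfl, rfl⟩ := h <;>
      simp [-ZMod.natCast_val, Joins, TmRel, label, hs]
  · rcases h with h | h | h | h | h
    · obtain ⟨rfl, rfl⟩ := h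
      simp [-ZMod.natCast_val, Joins, TmRel, label]
    · obtain ⟨rfl, rfl⟩ := h
      simp [-ZMod.natCast_val, Joins, TmRel, label]
    · obtain ⟨rfl, rfl⟩ := h
      rcases i with _ | i
      · have := hu b
        grind [Joins, TmRel, label, up]
      · simp [Joins, TmRel, label, up]
    · obtain ⟨rfl, rfl⟩ := h
      by_cases hi' : i + 1 < m - 2
      · simp [Joins, TmRel, label, down, hi']
      · have := hd b
        grind [Joins, TmRel, label, down]
    · split_ifs at h with hb <;> obtain ⟨rfl, rfl⟩ := Prod.mk.inj h
      · by_cases hi' : i + 1 < m - 2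
        · simp [Joins, TmRel, label, down, hi', hb, h8]
        · have := hd' b hb
          grind [Joins, TmRel, label, down]
      · have := hu' b hb
        rcases i with _ | i
        · grind [Joins, TmRel, label, up]
        · simp [Joins, TmRel, label, up, this.1, h8]
  · have hm' : m - 3 + 3 = m := by omega
    rcases h with h | h | h | h | h
    · obtain ⟨rfl, rfl⟩ := h; simp [-ZMod.natCast_val, Joins, TmRel, label, ht, hm']
    · obtain ⟨rfl, rfl⟩ := h; simp [-ZMod.natCast_val, Joins, TmRel, label, ht, hm']
    · obtain ⟨rfl, rfl⟩ := h; simp [-ZMod.natCast_val, Joins, TmRel, label, ht, hm']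
    · split_ifs at h with ha <;> obtain ⟨rfl, rfl⟩ := Prod.mk.inj h <;>
        simp [Joins, TmRel, label, ha]
    · split_ifs at h with ha <;> obtain ⟨rfl, rfl⟩ := Prod.mk.inj h <;>
        simp [Joins, TmRel, label, ha]
  · rcases h with h | h <;> obtain ⟨rfl, rfl⟩ := h <;> simp [Joins, TmRel, label]

theorem joins_iff_mem_star (hm : 4 ≤ m) {v w : TmVertex m} {e : TmEdge} :
    Joins m v w e ↔ (w, e) ∈ star m hm v := by
  refine ⟨?_, joins_of_mem_star hm⟩
  rintro (⟨h, rfl⟩ | ⟨h, rfl⟩)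
  · exact mem_star_left hm h
  · exact mem_star_right hm h

/-- The edge coloring of `Tm m` induced by a coloring of the labels. -/
noncomputable def toColoring (m : ℕ) (κ : TmEdge → ℕ) (f : Sym2 (TmVertex m)) : ℕ :=
  open Classical in if h : ∃ e v w, f = s(v, w) ∧ Joins m v w e then κ h.choose else 0

theorem toColoring_eq (κ : TmEdge → ℕ) {v w : TmVertex m} {e : TmEdge} (h : Joins m v w e) :
    toColoring m κ s(v, w) = κ e := by
  have hex : ∃ e v' w', s(v, w) = s(v', w') ∧ Joins m v' w' e := ⟨e, v, w, rfl, h⟩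
  rw [toColoring, dif_pos hex]
  obtain ⟨v', w', hvw, h'⟩ := hex.choose_spec
  congr 1
  rcases Sym2.eq_iff.1 hvw with ⟨rfl, rfl⟩ | ⟨rfl, rfl⟩
  · exact h'.unique h
  · exact h'.symm.unique h

/-- A coloring of the labels in which edges at a common vertex get different colors. -/
def IsProper (m : ℕ) (hm : 4 ≤ m) (κ : TmEdge → ℕ) : Prop :=
  ∀ v, ((star m hm v).map fun p => κ p.2).Nodup

theorem exists_joins_of_mem {f : Sym2 (TmVertex m)} (hf : f ∈ (Tm m).edgeSet) {v : TmVertex m}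
    (hv : v ∈ f) : ∃ w e, f = s(v, w) ∧ Joins m v w e := by
  obtain ⟨w, rfl⟩ := Sym2.mem_iff_exists.1 hv
  obtain ⟨e, he⟩ := adj_iff.1 hf
  exact ⟨w, e, rfl, he⟩

theorem IsProper.toColoring_ne {hm : 4 ≤ m} {κ : TmEdge → ℕ} (hκ : IsProper m hm κ)
    {f g : Sym2 (TmVertex m)} (hf : f ∈ (Tm m).edgeSet) (hg : g ∈ (Tm m).edgeSet) (hfg : f ≠ g)
    (h : ∃ v, v ∈ f ∧ v ∈ g) : toColoring m κ f ≠ toColoring m κ g := by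
  obtain ⟨v, hvf, hvg⟩ := h
  obtain ⟨w, e, rfl, he⟩ := exists_joins_of_mem hf hvf
  obtain ⟨w', e', rfl, he'⟩ := exists_joins_of_mem hg hvg
  rw [toColoring_eq κ he, toColoring_eq κ he']
  intro h
  have := List.inj_on_of_nodup_map (hκ v) ((joins_iff_mem_star hm).1 he)
    ((joins_iff_mem_star hm).1 he') h
  exact hfg (by rw [(Prod.mk.inj this).1])

theorem IsProper.nodup_neighbors {hm : 4 ≤ m} {κ : TmEdge → ℕ} (hκ : IsProper m hm κ)
    (v : TmVertex m) : ((star m hm v).map Prod.fst).Nodup := by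
  refine (hκ v).of_map.map_on fun p hp q hq hpq => ?_
  obtain ⟨w, e⟩ := p
  obtain ⟨w', e'⟩ := q
  obtain rfl : w = w' := hpq
  rw [((joins_iff_mem_star hm).2 hp).unique ((joins_iff_mem_star hm).2 hq)]

theorem adj_iff_mem_neighbors (hm : 4 ≤ m) {v w : TmVertex m} :
    (Tm m).Adj v w ↔ w ∈ (star m hm v).map Prod.fst := by
  simp [adj_iff, joins_iff_mem_star hm]

theorem IsProper.deg_eq {hm : 4 ≤ m} {κ : TmEdge → ℕ} (hκ : IsProper m hm κ)
    (v : TmVertex m) : deg (Tm m) v = (star m hm v).length := by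
  classical
  have : (Tm m).neighborSet v = ((star m hm v).map Prod.fst).toFinset := by
    ext w
    simp only [SimpleGraph.mem_neighborSet, adj_iff_mem_neighbors hm, List.coe_toFinset,
      Set.mem_ofPred_eq]
  rw [deg, this, Set.ncard_coe_finset, List.toFinset_card_of_nodup (hκ.nodup_neighbors v),
    List.length_map]

theorem IsProper.maxDeg_eq {hm : 4 ≤ m} {κ : TmEdge → ℕ} (hκ : IsProper m hm κ) :
    maxDeg (Tm m) = 5 := by
  refine IsGreatest.csSup_eq ⟨⟨.inl 0, hκ.deg_eq _⟩, ?_⟩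
  rintro _ ⟨v, rfl⟩
  rw [hκ.deg_eq]
  rcases v with a | ⟨i, b⟩ | a | _ <;> simp [star]

/-- In a coloring with at most five colors, every color appears at a vertex of degree five. -/
theorem IsProper.exists_color {hm : 4 ≤ m} {κ : TmEdge → ℕ} (hκ : IsProper m hm κ)
    {c : Sym2 (TmVertex m) → ℕ} {n : ℕ} (hc : IsProperEdgeColoring (Tm m) n c) (hn : n ≤ 5)
    {v : TmVertex m} (hv : (star m hm v).length = 5) {k : ℕ} (hk : k < 5) :
    ∃ w, (Tm m).Adj v w ∧ c s(v, w) = k := by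
  have hnd : (((star m hm v).map Prod.fst).map fun w => c s(v, w)).Nodup := by
    refine (hκ.nodup_neighbors v).map_on fun w hw w' hw' h => ?_
    by_contra hne
    refine hc.2 s(v, w) ((adj_iff_mem_neighbors hm).2 hw) s(v, w')
      ((adj_iff_mem_neighbors hm).2 hw') (fun h' => hne ?_) ⟨v, by simp, by simp⟩ h
    exact Sym2.congr_right.1 h'
  have hsub : (((star m hm v).map Prod.fst).map fun w => c s(v, w)).toFinset ⊆
      Finset.range 5 := by
    intro x hx
    rw [List.mem_toFinset, List.mem_map] at hx
    obtain ⟨w, hw, rfl⟩ := hx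
    exact Finset.mem_range.2 ((hc.1 _ ((adj_iff_mem_neighbors hm).2 hw)).trans_le hn)
  have heq := Finset.eq_of_subset_of_card_le hsub
    (by rw [List.toFinset_card_of_nodup hnd]; simp [hv])
  have hmem := heq ▸ Finset.mem_range.2 hk
  rw [List.mem_toFinset, List.mem_map] at hmem
  obtain ⟨w, hw, h⟩ := hmem
  exact ⟨w, (adj_iff_mem_neighbors hm).2 hw, h⟩

theorem IsProper.not_colorable {hm : 4 ≤ m} {κ : TmEdge → ℕ} (hκ : IsProper m hm κ)
    {c : Sym2 (TmVertex m) → ℕ} {n : ℕ} (hc : IsProperEdgeColoring (Tm m) n c) : 5 < n := by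
  by_contra! hn
  have hu : (Tm m).Adj (.inr (.inr (.inr ()))) (.inr (.inr (.inl 0))) := by
    simp [adj_iff_mem_neighbors hm, star]
  have hex : ∀ v, ∃ w, (Tm m).Adj v w ∧
      c s(v, w) = c s(.inr (.inr (.inr ())), .inr (.inr (.inl 0))) := by
    intro v
    have hk := (hc.1 _ ((SimpleGraph.mem_edgeSet _).2 hu)).trans_le hn
    rcases v with a | ⟨i, b⟩ | a | _
    · exact hκ.exists_color hc hn rfl hk
    · exact hκ.exists_color hc hn rfl hk
    · exact hκ.exists_color hc hn rfl hk
    · exact ⟨_, hu, rfl⟩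
  choose f hadj hcol using hex
  have hinv : Function.Involutive f := by
    intro v
    by_contra hne
    refine hc.2 s(f v, f (f v)) (hadj _) s(f v, v) (hadj v).symm (fun h => hne ?_)
      ⟨f v, by simp, by simp⟩ ?_
    · exact Sym2.congr_right.1 h
    · exact (hcol (f v)).trans ((hcol v).symm.trans (by rw [Sym2.eq_swap]))
  have hsupp : (hinv.toPerm f).support = Finset.univ := by
    ext v
    simpa using (hadj v).ne'
  have h2 := Equiv.Perm.two_dvd_card_support (σ := hinv.toPerm f) (by ext v; simp [sq, hinv v])
  rw [hsupp, Finset.card_univ] at h2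
  simp [ZMod.card] at h2
  omega

/-- The coloring given by the colors of the first cycle, of the cuts between consecutive layers,
of the 8-cycles, and of the last layer. The first eight entries of a cut color the straight edges,
the next four the diagonal ones; in the last layer the spokes have indices `4` and `5`. -/
def layered (s : List ℕ) (cut ring : ℕ → List ℕ) (o : List ℕ) : TmEdge → ℕ
  | inner a => s.getD a.val 0
  | straight i b => (cut i).getD b.val 0
  | diag i a => (cut i).getD (8 + a.val) 0
  | .ring i b => (ring i).getD b.val 0
  | outer a => o.getD a.val 0
  | spoke a => o.getD (4 + a.val) 0

/-- The coloring is proper at the first 4-cycle. -/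
def FirstProper (s c : List ℕ) : Prop :=
  ∀ a : ZMod 4, [s.getD a.val 0, s.getD (a - 1).val 0, c.getD (2 * (a.val : ZMod 8)).val 0,
    c.getD (2 * (a.val : ZMod 8) + 1).val 0, c.getD (8 + a.val) 0].Nodup

instance (s c : List ℕ) : Decidable (FirstProper s c) := by
  unfold FirstProper
  infer_instance

/-- The coloring is proper at an 8-cycle. -/
def RingProper (c r c' : List ℕ) : Prop :=
  ∀ b : ZMod 8, [r.getD b.val 0, r.getD (b - 1).val 0, c.getD b.val 0, c'.getD b.val 0,
    if b.val % 2 = 1 then c'.getD (8 + (half b).val) 0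
      else c.getD (8 + (half (b - 1)).val) 0].Nodup

instance (c r c' : List ℕ) : Decidable (RingProper c r c') := by
  unfold RingProper
  infer_instance

/-- The coloring is proper at the last 4-cycle and at the subdividing vertex. -/
def LastProper (c o : List ℕ) : Prop :=
  (∀ a : ZMod 4, [c.getD (2 * (a.val : ZMod 8)).val 0, c.getD (2 * (a.val : ZMod 8) + 1).val 0,
    c.getD (8 + (a - 1).val) 0, if a = 0 then o.getD (4 + a.val) 0 else o.getD a.val 0,
    if a = 1 then o.getD (4 + a.val) 0 else o.getD (a - 1).val 0].Nodup) ∧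
  o.getD 4 0 ≠ o.getD 5 0

instance (c o : List ℕ) : Decidable (LastProper c o) := by
  unfold LastProper
  infer_instance

theorem isProper_layered (hm : 4 ≤ m) {s o : List ℕ} {cut ring : ℕ → List ℕ}
    (hs : FirstProper s (cut 0))
    (hr : ∀ i < m - 2, RingProper (cut i) (ring i) (cut (i + 1)))
    (ho : LastProper (cut (m - 2)) o) : IsProper m hm (layered s cut ring o) := by
  rintro (a | ⟨⟨i, hi⟩, b⟩ | a | _)
  · exact hs a
  · have := hr i hi b
    simp only [star, List.map_cons, List.map_nil, apply_ite Prod.snd, apply_ite (layered _ _ _ _)]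
    exact this
  · have := ho.1 a
    simp only [star, List.map_cons, List.map_nil, apply_ite Prod.snd, apply_ite (layered _ _ _ _)]
    exact this
  · have h : (1 : ZMod 4).val = 1 := rfl
    simpa [star, layered, h] using ho.2

/-- Colors of the first 4-cycle, the cuts and 8-cycles above and below a fixed cut, and the last
layer, where the layers alternate between two possibilities moving away from that cut. -/
structure Frame where
  /-- The first 4-cycle. -/
  first : List ℕ × List ℕ
  /-- The cuts above. -/
  cutAbove : List ℕ × List ℕ
  /-- The 8-cycles above. -/
  ringAbove : List ℕ × List ℕ
  /-- The cuts below. -/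
  cutBelow : List ℕ × List ℕ
  /-- The 8-cycles below. -/
  ringBelow : List ℕ × List ℕ
  /-- The last layer. -/
  last : List ℕ × List ℕ

/-- Colors of a cut and of the layers next to it. -/
structure Patch where
  /-- The first 4-cycle, if it is the layer above. -/
  first : List ℕ
  /-- The cut. -/
  cut : List ℕ
  /-- The 8-cycle above. -/
  above : List ℕ
  /-- The 8-cycle below. -/
  below : List ℕ
  /-- The last layer, if it is the layer below. -/
  last : List ℕ

/-- The two entries of a pair, in alternation. -/
def alt (l : List ℕ × List ℕ) (n : ℕ) : List ℕ := if n % 2 = 0 then l.1 else l.2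

theorem alt_forall {l l' : List ℕ × List ℕ} {R : List ℕ → List ℕ → Prop} (h₁ : R l.1 l'.1)
    (h₂ : R l.2 l'.2) (n : ℕ) : R (alt l n) (alt l' n) := by
  unfold alt; split_ifs <;> assumption

/-- The entries of a list are at most five, with equality at most at index `j`. -/
abbrev FiveOnlyAt (j : ℕ) (l : List ℕ) : Prop :=
  ∀ k < 12, l.getD k 0 ≤ 5 ∧ (l.getD k 0 = 5 → k = j)

/-- The layers of a frame fit together and use five colors only. -/
def Frame.Valid (F : Frame) : Prop :=
  (FirstProper F.first.1 F.cutAbove.1 ∧ FirstProper F.first.2 F.cutAbove.2) ∧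
  (RingProper F.cutAbove.2 F.ringAbove.2 F.cutAbove.1 ∧
    RingProper F.cutAbove.1 F.ringAbove.1 F.cutAbove.2) ∧
  (RingProper F.cutBelow.1 F.ringBelow.1 F.cutBelow.2 ∧
    RingProper F.cutBelow.2 F.ringBelow.2 F.cutBelow.1) ∧
  (LastProper F.cutBelow.1 F.last.1 ∧ LastProper F.cutBelow.2 F.last.2) ∧
  ∀ l ∈ [F.first, F.cutAbove, F.ringAbove, F.cutBelow, F.ringBelow, F.last],
    FiveOnlyAt 12 l.1 ∧ FiveOnlyAt 12 l.2

instance (F : Frame) : Decidable F.Valid := by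
  unfold Frame.Valid
  infer_instance

/-- The coloring obtained by inserting a patch into a frame, at cut `p` of the cuts `0, …, n`. -/
def glue (n : ℕ) (F : Frame) (P : Patch) (p : ℕ) : TmEdge → ℕ :=
  layered (if p = 0 then P.first else alt F.first (p - 1))
    (fun i => if i < p then alt F.cutAbove (p - 1 - i) else if i = p then P.cut
      else alt F.cutBelow (i - p - 1))
    (fun i => if i + 1 < p then alt F.ringAbove (p - 1 - i) else if i + 1 = p then P.above
      else if i = p then P.below else alt F.ringBelow (i - p - 1))
    (if p = n then P.last else alt F.last (n - p - 1))

theorem isProper_glue (hm : 4 ≤ m) {F : Frame} {P : Patch} {p : ℕ} (hp : p ≤ m - 2)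
    (hF : F.Valid) (hfirst : p = 0 → FirstProper P.first P.cut)
    (habove : 0 < p → RingProper F.cutAbove.1 P.above P.cut)
    (hbelow : p < m - 2 → RingProper P.cut P.below F.cutBelow.1)
    (hlast : p = m - 2 → LastProper P.cut P.last) : IsProper m hm (glue (m - 2) F P p) := by
  obtain ⟨hF₁, hF₂, hF₃, hF₄, -⟩ := hF
  refine isProper_layered hm ?_ (fun i hi => ?_) ?_
  · rcases Nat.eq_zero_or_pos p with rfl | h
    · simpa using hfirst rfl
    · simpa only [h, h.ne', if_true, if_false, Nat.sub_zero] using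
        alt_forall hF₁.1 hF₁.2 (p - 1)
  · rcases lt_trichotomy (i + 1) p with h | h | h
    · obtain ⟨k, rfl⟩ := Nat.exists_eq_add_of_lt h
      have h₁ : i + 1 + k + 1 - 1 - i = k + 1 := by omega
      have h₂ : i + 1 + k + 1 - 1 - (i + 1) = k := by omega
      simp only [h, h₁, h₂, if_true, show i < i + 1 + k + 1 by omega, alt]
      grind
    · subst h
      simpa [alt] using habove (by omega)
    · rcases (Nat.lt_succ_iff.1 h).eq_or_lt with rfl | h'
      · simpa [alt] using hbelow hi
      · obtain ⟨k, rfl⟩ := Nat.exists_eq_add_of_lt h'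
        have h₁ : p + k + 1 - p - 1 = k := by omega
        have h₂ : p + k + 1 + 1 - p - 1 = k + 1 := by omega
        simp only [h₁, h₂, show ¬ p + k + 1 + 1 < p by omega, show ¬ p + k + 1 < p by omega,
          show p + k + 1 + 1 ≠ p by omega, show p + k + 1 ≠ p by omega, if_false, alt]
        grind
  · rcases hp.eq_or_lt with rfl | h
    · simpa using hlast rfl
    · simpa only [h.ne, h.ne', not_lt_of_gt h, if_false] using
        alt_forall hF₄.1 hF₄.2 (m - 2 - p - 1)

/-- The color `x` of the edge `e'` is at most five, with equality only if `e' = e`. -/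
def IsFiveOnly (e e' : TmEdge) (x : ℕ) : Prop := x ≤ 5 ∧ (x = 5 → e' = e)

theorem FiveOnlyAt.isFiveOnly {j k : ℕ} {l : List ℕ} (hl : FiveOnlyAt j l) {e e' : TmEdge}
    (hk : k < 12) (h : k = j → e' = e) : IsFiveOnly e e' (l.getD k 0) :=
  ⟨(hl k hk).1, fun h' => h ((hl k hk).2 h')⟩

/-- In a patch, color five can appear only at the given indices. -/
def Patch.FiveOnlyAt (P : Patch) (first cut above last : ℕ) : Prop :=
  TmEdge.FiveOnlyAt first P.first ∧ TmEdge.FiveOnlyAt cut P.cut ∧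
    TmEdge.FiveOnlyAt above P.above ∧ TmEdge.FiveOnlyAt 12 P.below ∧
    TmEdge.FiveOnlyAt last P.last

instance (P : Patch) (first cut above last : ℕ) :
    Decidable (P.FiveOnlyAt first cut above last) := by
  unfold Patch.FiveOnlyAt
  infer_instance

theorem val_lt_four (a : ZMod 4) : a.val < 4 := ZMod.val_lt a

theorem val_lt_eight (b : ZMod 8) : b.val < 8 := ZMod.val_lt b

theorem glue_isFiveOnly {n : ℕ} {F : Frame} {P : Patch} {p jf jc ja jl : ℕ} {e : TmEdge}
    (hF : F.Valid) (hP : P.FiveOnlyAt jf jc ja jl)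
    (hfirst : p = 0 → ∀ a, a.val = jf → inner a = e)
    (hstraight : ∀ b, b.val = jc → straight p b = e)
    (hdiag : ∀ a, 8 + a.val = jc → diag p a = e)
    (hring : ∀ i, i + 1 = p → ∀ b, b.val = ja → ring i b = e)
    (houter : p = n → ∀ a, a.val = jl → outer a = e)
    (hspoke : p = n → ∀ a, 4 + a.val = jl → spoke a = e) (e' : TmEdge) :
    IsFiveOnly e e' (glue n F P p e') := by
  obtain ⟨hP₁, hP₂, hP₃, hP₄, hP₅⟩ := hP
  have hF' : ∀ l ∈ [F.first, F.cutAbove, F.ringAbove, F.cutBelow, F.ringBelow, F.last],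
      ∀ n, ∀ k < 12, IsFiveOnly e e' ((alt l n).getD k 0) := fun l hl n k hk => by
    have := hF.2.2.2.2 l hl
    have := alt_forall (l := l) (l' := l) (R := fun l _ => FiveOnlyAt 12 l) this.1 this.2 n
    exact this.isFiveOnly hk (by omega)
  rcases e' with a | ⟨i, b⟩ | ⟨i, a⟩ | ⟨i, b⟩ | a | a
  · have := val_lt_four a
    simp only [glue, layered]
    split_ifs with h
    · exact hP₁.isFiveOnly (by omega) (hfirst h a)
    · exact hF' _ (by simp) _ _ (by omega)
  · have := val_lt_eight b
    simp only [glue, layered]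
    split_ifs with h h
    · exact hF' _ (by simp) _ _ (by omega)
    · exact hP₂.isFiveOnly (by omega) (h ▸ hstraight b)
    · exact hF' _ (by simp) _ _ (by omega)
  · have := val_lt_four a
    simp only [glue, layered]
    split_ifs with h h
    · exact hF' _ (by simp) _ _ (by omega)
    · exact hP₂.isFiveOnly (by omega) (h ▸ hdiag a)
    · exact hF' _ (by simp) _ _ (by omega)
  · have := val_lt_eight b
    simp only [glue, layered]
    split_ifs with h h h
    · exact hF' _ (by simp) _ _ (by omega)
    · exact hP₃.isFiveOnly (by omega) (hring i h b)
    · exact hP₄.isFiveOnly (by omega) (by omega)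
    · exact hF' _ (by simp) _ _ (by omega)
  · have := val_lt_four a
    simp only [glue, layered]
    split_ifs with h
    · exact hP₅.isFiveOnly (by omega) (houter h a)
    · exact hF' _ (by simp) _ _ (by omega)
  · have := val_lt_four a
    simp only [glue, layered]
    split_ifs with h
    · exact hP₅.isFiveOnly (by omega) (hspoke h a)
    · exact hF' _ (by simp) _ _ (by omega)

/-- The frame used for most edges. -/
def mainFrame : Frame where
  first := ([0, 1, 0, 1], [0, 1, 0, 1])
  cutAbove := ([3, 2, 2, 3, 3, 2, 2, 3, 4, 4, 4, 4], [2, 3, 3, 2, 2, 3, 3, 2, 4, 4, 4, 4])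
  ringAbove := ([0, 1, 0, 1, 0, 1, 0, 1], [0, 1, 0, 1, 0, 1, 0, 1])
  cutBelow := ([3, 2, 2, 3, 3, 1, 0, 3, 4, 4, 4, 4], [2, 3, 3, 0, 1, 3, 3, 2, 4, 4, 4, 4])
  ringBelow := ([1, 0, 1, 2, 0, 2, 1, 0], [1, 0, 1, 2, 0, 2, 1, 0])
  last := ([0, 0, 2, 1, 0, 1], [0, 2, 0, 1, 0, 1])

/-- A frame for some of the edges in cuts. -/
def rungFrame : Frame where
  first := ([2, 0, 4, 0], [2, 0, 4, 0])
  cutAbove := ([1, 3, 1, 3, 1, 3, 3, 1, 4, 4, 2, 2], [3, 1, 3, 1, 3, 1, 1, 3, 4, 4, 2, 2])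
  ringAbove := ([0, 2, 0, 2, 0, 4, 0, 4], [0, 2, 0, 2, 0, 4, 0, 4])
  cutBelow := ([1, 3, 1, 3, 1, 3, 3, 1, 4, 4, 4, 2], [3, 1, 3, 1, 3, 1, 1, 3, 4, 4, 4, 2])
  ringBelow := ([0, 2, 0, 2, 0, 2, 0, 4], [0, 2, 0, 2, 0, 2, 0, 4])
  last := ([0, 0, 2, 0, 4, 2], [0, 0, 2, 0, 4, 2])

/-- A frame for the remaining edges in cuts. -/
def lastRungFrame : Frame where
  first := ([3, 2, 1, 4], [3, 2, 1, 4])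
  cutAbove := ([0, 2, 0, 4, 4, 0, 2, 0, 1, 1, 3, 3], [2, 0, 4, 0, 0, 4, 0, 2, 1, 1, 3, 3])
  ringAbove := ([4, 3, 2, 3, 2, 1, 4, 1], [4, 3, 2, 3, 2, 1, 4, 1])
  cutBelow := ([4, 3, 1, 2, 1, 2, 2, 3, 4, 0, 0, 0], [3, 1, 2, 1, 2, 4, 3, 2, 4, 0, 0, 0])
  ringBelow := ([2, 0, 3, 4, 3, 1, 4, 1], [2, 0, 3, 4, 3, 1, 4, 1])
  last := ([0, 3, 4, 1, 2, 0], [0, 3, 1, 4, 2, 0])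

/-- Patches whose edge of color five lies in the cut, by position. -/
def rungPatches : List (Frame × Patch) := [
  (mainFrame, ⟨[1, 0, 1, 2], [5, 3, 3, 2, 2, 3, 3, 0, 4, 4, 4, 4], [1, 0, 1, 0, 1, 0, 1, 2],
    [0, 1, 0, 1, 0, 2, 1, 2], [0, 0, 1, 2, 0, 1]⟩),
  (mainFrame, ⟨[3, 0, 1, 0], [2, 5, 1, 2, 2, 3, 3, 2, 4, 4, 4, 4], [0, 3, 0, 1, 0, 1, 0, 1],
    [1, 3, 0, 1, 0, 2, 1, 0], [0, 0, 1, 0, 1, 3]⟩),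
  (mainFrame, ⟨[3, 1, 0, 1], [2, 0, 5, 2, 2, 3, 3, 2, 4, 4, 4, 4], [1, 3, 1, 0, 1, 0, 1, 0],
    [1, 3, 0, 1, 0, 2, 1, 0], [0, 1, 0, 1, 3, 0]⟩),
  (mainFrame, ⟨[0, 2, 0, 1], [2, 3, 3, 5, 1, 3, 3, 2, 4, 4, 4, 4], [0, 1, 0, 2, 0, 1, 0, 1],
    [1, 0, 1, 2, 0, 2, 1, 0], [0, 2, 0, 1, 0, 1]⟩),
  (mainFrame, ⟨[1, 2, 1, 0], [2, 3, 3, 0, 5, 3, 3, 2, 4, 4, 4, 4], [1, 0, 1, 2, 1, 0, 1, 0],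
    [1, 0, 1, 2, 0, 2, 1, 0], [0, 1, 0, 1, 0, 2]⟩),
  (rungFrame, ⟨[2, 0, 1, 0], [3, 1, 3, 1, 3, 5, 4, 3, 4, 4, 2, 2], [0, 2, 0, 2, 0, 1, 0, 4],
    [0, 2, 0, 2, 0, 1, 0, 4], [0, 2, 1, 0, 4, 0]⟩),
  (rungFrame, ⟨[2, 0, 1, 0], [3, 1, 3, 1, 3, 2, 5, 3, 4, 4, 4, 2], [0, 2, 0, 2, 0, 1, 0, 4],
    [0, 2, 0, 2, 0, 1, 0, 4], [0, 0, 1, 0, 4, 2]⟩),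
  (mainFrame, ⟨[0, 1, 0, 2], [1, 3, 3, 2, 2, 3, 3, 5, 4, 4, 4, 4], [0, 1, 0, 1, 0, 1, 0, 2],
    [0, 1, 0, 1, 0, 2, 1, 2], [0, 0, 1, 2, 0, 1]⟩),
  (rungFrame, ⟨[0, 2, 0, 4], [3, 1, 3, 1, 3, 1, 1, 3, 5, 4, 4, 2], [4, 0, 2, 0, 2, 0, 4, 0],
    [0, 2, 0, 2, 0, 2, 0, 4], [0, 0, 2, 0, 4, 2]⟩),
  (lastRungFrame, ⟨[3, 2, 1, 4], [2, 1, 4, 1, 0, 4, 0, 2, 0, 5, 3, 3], [4, 3, 2, 3, 2, 1, 4, 1],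
    [0, 2, 3, 4, 3, 1, 4, 1], [0, 3, 1, 4, 0, 2]⟩),
  (rungFrame, ⟨[2, 0, 1, 0], [3, 1, 3, 1, 3, 2, 4, 3, 4, 4, 5, 2], [0, 2, 0, 2, 0, 1, 0, 4],
    [0, 2, 0, 2, 0, 1, 0, 4], [0, 0, 1, 0, 4, 2]⟩),
  (rungFrame, ⟨[2, 0, 4, 0], [3, 1, 3, 1, 3, 1, 1, 3, 4, 4, 2, 5], [0, 2, 0, 2, 0, 4, 0, 4],
    [2, 0, 2, 0, 2, 0, 4, 0], [0, 2, 0, 4, 2, 0]⟩)]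

/-- Patches whose edge of color five lies in the upper 8-cycle, by position. -/
def ringPatches : List (Frame × Patch) := [
  (mainFrame, ⟨[], [1, 3, 3, 2, 2, 3, 3, 0, 4, 4, 4, 4], [5, 0, 1, 0, 1, 0, 1, 2],
    [0, 1, 0, 1, 0, 2, 1, 2], [0, 0, 1, 2, 0, 1]⟩),
  (mainFrame, ⟨[], [1, 3, 3, 2, 2, 3, 3, 0, 4, 4, 4, 4], [0, 5, 1, 0, 1, 0, 1, 2],
    [0, 1, 0, 1, 0, 2, 1, 2], [0, 0, 1, 2, 0, 1]⟩),
  (mainFrame, ⟨[], [2, 3, 3, 0, 1, 3, 3, 2, 4, 4, 4, 4], [0, 1, 5, 2, 0, 1, 0, 1],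
    [1, 0, 1, 2, 0, 2, 1, 0], [0, 2, 0, 1, 0, 1]⟩),
  (mainFrame, ⟨[], [1, 3, 3, 2, 2, 3, 3, 0, 4, 4, 4, 4], [0, 1, 0, 5, 1, 0, 1, 2],
    [0, 1, 0, 1, 0, 2, 1, 2], [0, 0, 1, 2, 0, 1]⟩),
  (mainFrame, ⟨[], [2, 3, 3, 0, 1, 3, 3, 2, 4, 4, 4, 4], [1, 0, 1, 2, 5, 0, 1, 0],
    [1, 0, 1, 2, 0, 2, 1, 0], [0, 2, 0, 1, 0, 1]⟩),
  (mainFrame, ⟨[], [1, 3, 3, 2, 2, 3, 3, 0, 4, 4, 4, 4], [0, 1, 0, 1, 0, 5, 1, 2],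
    [0, 1, 0, 1, 0, 2, 1, 2], [0, 0, 1, 2, 0, 1]⟩),
  (mainFrame, ⟨[], [1, 3, 3, 2, 2, 3, 3, 0, 4, 4, 4, 4], [0, 1, 0, 1, 0, 1, 5, 2],
    [0, 1, 0, 1, 0, 2, 1, 2], [0, 0, 1, 2, 0, 1]⟩),
  (mainFrame, ⟨[], [2, 3, 3, 0, 1, 3, 3, 2, 4, 4, 4, 4], [1, 0, 1, 2, 0, 1, 0, 5],
    [1, 0, 1, 2, 0, 2, 1, 0], [0, 2, 0, 1, 0, 1]⟩)]

/-- Patches whose edge of color five lies in the first 4-cycle, by position. -/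
def innerPatches : List (Frame × Patch) := [
  (mainFrame, ⟨[5, 2, 0, 1], [2, 3, 3, 0, 1, 3, 3, 2, 4, 4, 4, 4], [],
    [1, 0, 1, 2, 0, 2, 1, 0], []⟩),
  (mainFrame, ⟨[3, 5, 3, 2], [4, 1, 4, 2, 4, 0, 4, 0, 0, 1, 2, 1], [],
    [0, 3, 1, 0, 2, 3, 1, 2], []⟩),
  (mainFrame, ⟨[2, 3, 5, 3], [4, 1, 4, 0, 4, 2, 4, 0, 0, 1, 1, 2], [],
    [0, 3, 1, 2, 0, 3, 2, 1], []⟩),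
  (mainFrame, ⟨[3, 0, 1, 5], [2, 0, 1, 2, 2, 3, 3, 2, 4, 4, 4, 4], [],
    [1, 3, 0, 1, 0, 2, 1, 0], []⟩)]

/-- Patches whose edge of color five lies in the last 4-cycle, by position. -/
def outerPatches : List (Frame × Patch) := [
  (mainFrame, ⟨[], [0, 4, 1, 4, 0, 4, 1, 4, 0, 1, 0, 1], [1, 3, 0, 2, 1, 3, 0, 2],
    [], [0, 5, 2, 3, 2, 3]⟩),
  (mainFrame, ⟨[], [0, 4, 1, 4, 0, 4, 1, 4, 0, 1, 0, 1], [1, 3, 0, 2, 1, 3, 0, 2],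
    [], [0, 2, 5, 3, 2, 3]⟩),
  (mainFrame, ⟨[], [0, 4, 1, 4, 0, 4, 1, 4, 0, 1, 0, 1], [1, 3, 0, 2, 1, 3, 0, 2],
    [], [0, 2, 3, 5, 2, 3]⟩),
  (mainFrame, ⟨[], [0, 4, 1, 4, 0, 4, 1, 4, 0, 1, 0, 1], [1, 3, 0, 2, 1, 3, 0, 2],
    [], [0, 2, 3, 2, 5, 3]⟩),
  (mainFrame, ⟨[], [0, 4, 1, 4, 0, 4, 1, 4, 0, 1, 0, 1], [1, 3, 0, 2, 1, 3, 0, 2],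
    [], [0, 3, 2, 3, 2, 5]⟩)]

theorem exists_rungPatch : ∀ j < 12, ∃ q ∈ rungPatches, q.2.FiveOnlyAt 12 j 12 12 ∧ q.1.Valid ∧
    FirstProper q.2.first q.2.cut ∧ RingProper q.1.cutAbove.1 q.2.above q.2.cut ∧
    RingProper q.2.cut q.2.below q.1.cutBelow.1 ∧ LastProper q.2.cut q.2.last := by
  decide +kernel

theorem exists_ringPatch : ∀ j < 8, ∃ q ∈ ringPatches, q.2.FiveOnlyAt 12 12 j 12 ∧ q.1.Valid ∧
    RingProper q.1.cutAbove.1 q.2.above q.2.cut ∧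
    RingProper q.2.cut q.2.below q.1.cutBelow.1 ∧ LastProper q.2.cut q.2.last := by
  decide +kernel

theorem exists_innerPatch : ∀ j < 4, ∃ q ∈ innerPatches, q.2.FiveOnlyAt j 12 12 12 ∧ q.1.Valid ∧
    FirstProper q.2.first q.2.cut ∧ RingProper q.2.cut q.2.below q.1.cutBelow.1 := by
  decide +kernel

theorem exists_outerPatch : ∀ j < 6, 0 < j → ∃ q ∈ outerPatches, q.2.FiveOnlyAt 12 12 12 j ∧
    q.1.Valid ∧ RingProper q.1.cutAbove.1 q.2.above q.2.cut ∧ LastProper q.2.cut q.2.last := by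
  decide +kernel

/-- The labels of the edges of `Tm m`. -/
def InRange (m : ℕ) : TmEdge → Prop
  | inner _ => True
  | straight i _ => i ≤ m - 2
  | diag i _ => i ≤ m - 2
  | ring i _ => i < m - 2
  | outer a => a ≠ 0
  | spoke a => a = 0 ∨ a = 1

theorem Joins.inRange (hm : 4 ≤ m) {v w : TmVertex m} {e : TmEdge} (h : Joins m v w e) :
    InRange m e := by
  rw [joins_iff_mem_star hm] at h
  have h4 : ∀ a : ZMod 4, a ≠ 1 → a - 1 ≠ 0 := by decide
  rcases v with a | ⟨⟨i, hi⟩, b⟩ | a | _ <;>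
    simp only [star, List.mem_cons, List.not_mem_nil, or_false, Prod.mk.injEq] at h
  · rcases h with h | h | h | h | h <;> obtain ⟨-, rfl⟩ := h <;> simp [InRange]
  · rcases h with h | h | h | h | h
    · obtain ⟨-, rfl⟩ := h; exact hi
    · obtain ⟨-, rfl⟩ := h; exact hi
    · obtain ⟨-, rfl⟩ := h; exact hi.le
    · obtain ⟨-, rfl⟩ := h; exact hi
    · split_ifs at h <;> obtain ⟨-, rfl⟩ := Prod.mk.inj h
      exacts [hi, hi.le]
  · rcases h with h | h | h | h | h
    · obtain ⟨-, rfl⟩ := h; exact le_rfl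
    · obtain ⟨-, rfl⟩ := h; exact le_rfl
    · obtain ⟨-, rfl⟩ := h; exact le_rfl
    · split_ifs at h with ha <;> obtain ⟨-, rfl⟩ := Prod.mk.inj h
      exacts [.inl ha, ha]
    · split_ifs at h with ha <;> obtain ⟨-, rfl⟩ := Prod.mk.inj h
      exacts [.inr ha, h4 a ha]
  · rcases h with h | h <;> obtain ⟨-, rfl⟩ := h <;> simp [InRange]

/-- Every edge of `Tm m` is the only edge of the sixth color in some proper coloring. -/
theorem exists_isProper (hm : 4 ≤ m) {e : TmEdge} (he : InRange m e) :
    ∃ κ, IsProper m hm κ ∧ ∀ e', IsFiveOnly e e' (κ e') := by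
  rcases e with a | ⟨i, b⟩ | ⟨i, a⟩ | ⟨i, b⟩ | a | a
  · obtain ⟨⟨F, P⟩, -, h5, hF, hf, hb⟩ := exists_innerPatch a.val (val_lt_four a)
    refine ⟨_, isProper_glue hm (Nat.zero_le _) hF (fun _ => hf) (by omega) (fun _ => hb)
      (by omega), glue_isFiveOnly hF h5 ?_ ?_ ?_ ?_ ?_ ?_⟩
    · exact fun _ a' h => congrArg _ (ZMod.val_injective 4 h)
    · intro b h; have := val_lt_eight b; omega
    · intro a h; have := val_lt_four a; omega
    · omega
    · omega
    · omega
  · obtain ⟨⟨F, P⟩, -, h5, hF, hf, ha, hb, hl⟩ := exists_rungPatch b.val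
      (by have := val_lt_eight b; omega)
    refine ⟨_, isProper_glue hm he hF (fun _ => hf) (fun _ => ha) (fun _ => hb)
      (fun _ => hl), glue_isFiveOnly hF h5 ?_ ?_ ?_ ?_ ?_ ?_⟩
    · intro _ a h; have := val_lt_four a; omega
    · exact fun b' h => congrArg _ (ZMod.val_injective 8 h)
    · intro a h; have := val_lt_eight b; omega
    · intro _ _ b h; have := val_lt_eight b; omega
    · intro _ a h; have := val_lt_four a; omega
    · intro _ a h; have := val_lt_four a; omega
  · obtain ⟨⟨F, P⟩, -, h5, hF, hf, ha, hb, hl⟩ := exists_rungPatch (8 + a.val)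
      (by have := val_lt_four a; omega)
    refine ⟨_, isProper_glue hm he hF (fun _ => hf) (fun _ => ha) (fun _ => hb)
      (fun _ => hl), glue_isFiveOnly hF h5 ?_ ?_ ?_ ?_ ?_ ?_⟩
    · intro _ a h; have := val_lt_four a; omega
    · intro b h; have := val_lt_eight b; omega
    · exact fun a' h => congrArg _ (ZMod.val_injective 4 (by omega))
    · intro _ _ b h; have := val_lt_eight b; omega
    · intro _ a h; have := val_lt_four a; omega
    · intro _ a h; have := val_lt_four a; omega
  · obtain ⟨⟨F, P⟩, -, h5, hF, ha, hb, hl⟩ := exists_ringPatch b.val (val_lt_eight b)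
    refine ⟨_, isProper_glue hm (p := i + 1) he hF (by omega) (fun _ => ha) (fun _ => hb)
      (fun _ => hl), glue_isFiveOnly hF h5 ?_ ?_ ?_ ?_ ?_ ?_⟩
    · omega
    · intro b h; have := val_lt_eight b; omega
    · intro a h; have := val_lt_four a; omega
    · intro i' hi b' h
      rw [Nat.succ.inj hi, ZMod.val_injective 8 h]
    · intro _ a h; have := val_lt_four a; omega
    · intro _ a h; have := val_lt_four a; omega
  · have h0 : 0 < a.val := Nat.pos_of_ne_zero ((ZMod.val_ne_zero a).2 he)
    obtain ⟨⟨F, P⟩, -, h5, hF, ha, hl⟩ := exists_outerPatch a.val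
      (by have := val_lt_four a; omega) h0
    refine ⟨_, isProper_glue hm le_rfl hF (by omega) (fun _ => ha) (by omega)
      (fun _ => hl), glue_isFiveOnly hF h5 ?_ ?_ ?_ ?_ ?_ ?_⟩
    · omega
    · intro b h; have := val_lt_eight b; omega
    · intro a h; have := val_lt_four a; omega
    · intro _ _ b h; have := val_lt_eight b; omega
    · exact fun _ a' h => congrArg _ (ZMod.val_injective 4 h)
    · intro _ a' h; have := val_lt_four a; omega
  · have h2 : a.val < 2 := by rcases he with rfl | rfl <;> decide
    obtain ⟨⟨F, P⟩, -, h5, hF, ha, hl⟩ := exists_outerPatch (4 + a.val) (by omega) (by omega)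
    refine ⟨_, isProper_glue hm le_rfl hF (by omega) (fun _ => ha) (by omega)
      (fun _ => hl), glue_isFiveOnly hF h5 ?_ ?_ ?_ ?_ ?_ ?_⟩
    · omega
    · intro b h; have := val_lt_eight b; omega
    · intro a h; have := val_lt_four a; omega
    · intro _ _ b h; have := val_lt_eight b; omega
    · intro _ a h; have := val_lt_four a; omega
    · exact fun _ a' h => congrArg _ (ZMod.val_injective 4 (by omega))

theorem exists_joins (hm : 4 ≤ m) (v : TmVertex m) : ∃ w e, Joins m v w e := by
  have h : star m hm v ≠ [] := by rcases v with a | ⟨i, b⟩ | a | _ <;> simp [star]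
  obtain ⟨⟨w, e⟩, hp⟩ := List.exists_mem_of_ne_nil _ h
  exact ⟨w, e, (joins_iff_mem_star hm).2 hp⟩

theorem exists_joins_of_ne_top (hm : 4 ≤ m) {H : (Tm m).Subgraph} (hH : H ≠ ⊤) :
    ∃ v w e, Joins m v w e ∧ ¬ H.Adj v w := by
  by_contra! h
  refine hH (eq_top_iff.2 ⟨fun v _ => ?_, fun v w hvw => ?_⟩)
  · obtain ⟨w, e, he⟩ := exists_joins hm v
    exact (h v w e he).fst_mem
  · obtain ⟨e, he⟩ := adj_iff.1 (SimpleGraph.Subgraph.top_adj.1 hvw)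
    exact h v w e he

theorem edgeChromaticNumber_coe_le (hm : 4 ≤ m) {H : (Tm m).Subgraph} (hH : H ≠ ⊤) :
    edgeChromaticNumber H.coe ≤ 5 := by
  obtain ⟨v, w, e, he, hvw⟩ := exists_joins_of_ne_top hm hH
  obtain ⟨κ, hκ, h5⟩ := exists_isProper hm (he.inRange hm)
  refine Nat.sInf_le ⟨fun f => toColoring m κ (f.map Subtype.val), ?_, ?_⟩
  · intro f hf
    induction f with | _ x y
    have hxy : H.Adj x y := hf
    obtain ⟨e', he'⟩ := adj_iff.1 hxy.adj_sub
    have heq : toColoring m κ (s(x, y).map Subtype.val) = κ e' := toColoring_eq κ he'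
    refine heq.trans_lt ?_
    refine lt_of_le_of_ne (h5 e').1 fun h => hvw ?_
    obtain rfl := (h5 e').2 h
    rwa [← SimpleGraph.Subgraph.mem_edgeSet, he.edge_unique he']
  · have hmem : ∀ f ∈ H.coe.edgeSet, f.map Subtype.val ∈ (Tm m).edgeSet := by
      intro f hf
      induction f with | _ x y
      exact H.adj_sub hf
    rintro f hf g hg hne ⟨x, hxf, hxg⟩
    exact hκ.toColoring_ne (hmem f hf) (hmem g hg)
      (fun h => hne (Sym2.map.injective Subtype.val_injective h))
      ⟨x, Sym2.mem_map.2 ⟨x, hxf, rfl⟩, Sym2.mem_map.2 ⟨x, hxg, rfl⟩⟩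

theorem IsProper.lt_edgeChromaticNumber {hm : 4 ≤ m} {κ : TmEdge → ℕ} (hκ : IsProper m hm κ)
    {n : ℕ} (hn : ∀ e, κ e < n) : 5 < edgeChromaticNumber (Tm m) := by
  have hne : {n | ∃ c, IsProperEdgeColoring (Tm m) n c}.Nonempty := by
    refine ⟨n, toColoring m κ, fun f hf => ?_, fun f hf g hg => hκ.toColoring_ne hf hg⟩
    induction f with | _ x y
    obtain ⟨e, he⟩ := adj_iff.1 hf
    rw [toColoring_eq κ he]
    exact hn e
  obtain ⟨c, hc⟩ := Nat.sInf_mem hne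
  exact hκ.not_colorable hc

end TmEdge

/-- For every `m ≥ 4`, the graph `T_m` is 5-critical. -/
theorem Tm_five_critical (m : ℕ) (hm : 4 ≤ m) : IsKCritical (Tm m) 5 := by
  obtain ⟨κ, hκ, h5⟩ := TmEdge.exists_isProper hm (e := .inner 0) trivial
  have hχ := hκ.lt_edgeChromaticNumber fun e => Nat.lt_succ_of_le (h5 e).1
  exact ⟨⟨hκ.maxDeg_eq ▸ hχ.ne', fun H hH =>
    (TmEdge.edgeChromaticNumber_coe_le hm hH).trans_lt hχ⟩, hκ.maxDeg_eq⟩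
end

section
/- Every 3-critical graph G that is not isomorphic to the graph obtained from the Petersen graph by deleting one vertex satisfies |E(G)| ≥ (50/37)·|V(G)|. -/
open SimpleGraph

variable {V : Type*}

/-- The Petersen graph: the Kneser graph on the 2-element subsets of a
5-element set, with two subsets adjacent when they are disjoint. -/
def petersen : SimpleGraph {s : Finset (Fin 5) // s.card = 2} :=
  SimpleGraph.fromRel (fun s t => Disjoint s.val t.val)

/-- `c` restricted to the edges of `G` is a proper edge coloring. -/
def Proper {α : Type*} (G : SimpleGraph V) (c : Sym2 V → α) : Prop :=
  ∀ v x y, G.Adj v x → G.Adj v y → c s(v, x) = c s(v, y) → x = y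

/-- No edge of `G` at `v` has color `k`. -/
def Misses {α : Type*} (G : SimpleGraph V) (c : Sym2 V → α) (v : V) (k : α) : Prop :=
  ∀ x, G.Adj v x → c s(v, x) ≠ k

theorem Proper.ncard_misses [Finite V] {n : ℕ} {G : SimpleGraph V} {c : Sym2 V → Fin n}
    (hc : Proper G c) (v : V) : {k | Misses G c v k}.ncard + deg G v = n := by
  have h : {k | Misses G c v k} = ((fun x => c s(v, x)) '' G.neighborSet v)ᶜ := by
    ext k
    simp [Misses]
  have h' : deg G v = ((fun x => c s(v, x)) '' G.neighborSet v).ncard := by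
    rw [Set.InjOn.ncard_image, deg]
    intro x hx y hy hxy
    exact hc v x y hx hy hxy
  rw [h, h', add_comm, Set.ncard_add_ncard_compl, Nat.card_eq_fintype_card, Fintype.card_fin]

/-- Permuting colors. -/
theorem Proper.perm {G : SimpleGraph V} {c : Sym2 V → Fin 3} (hc : Proper G c)
    (σ : Equiv.Perm (Fin 3)) : Proper G (σ ∘ c) := by
  intro v x y hx hy h
  exact hc v x y hx hy (σ.injective h)

theorem misses_perm {G : SimpleGraph V} {c : Sym2 V → Fin 3} (σ : Equiv.Perm (Fin 3)) (v : V)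
    (k : Fin 3) : Misses G (σ ∘ c) v k ↔ Misses G c v (σ.symm k) := by
  simp [Misses, Equiv.eq_symm_apply]

/-- The subgraph of edges colored `a` or `b`. -/
def twoColor {α : Type*} (G : SimpleGraph V) (c : Sym2 V → α) (a b : α) : SimpleGraph V where
  Adj x y := G.Adj x y ∧ (c s(x, y) = a ∨ c s(x, y) = b)
  symm := ⟨fun x y h => by rw [Sym2.eq_swap]; exact ⟨h.1.symm, h.2⟩⟩
  loopless := ⟨fun x h => G.loopless.irrefl x h.1⟩

theorem Proper.twoColor_degree_le [Finite V] {α : Type*} [Finite α] {G : SimpleGraph V}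
    {c : Sym2 V → α} (hc : Proper G c) {a b : α} {v : V} {T : Set α}
    (hT : ∀ k, k = a ∨ k = b → ¬ Misses G c v k → k ∈ T) :
    ((twoColor G c a b).neighborSet v).ncard ≤ T.ncard := by
  rw [← Set.InjOn.ncard_image (f := fun x => c s(v, x))]
  · apply Set.ncard_le_ncard _ T.toFinite
    rintro _ ⟨x, hx, rfl⟩
    exact hT _ hx.2 fun h => h x hx.1 rfl
  · intro x hx y hy hxy
    exact hc v x y hx.1 hy.1 hxy

/-- A connected component of a graph of maximum degree two has at most two vertices of degree at
most one. -/
theorem degree_one_in_component [Finite V] (K : SimpleGraph V) (u v w : V)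
    (huv : u ≠ v) (huw : u ≠ w) (hvw : v ≠ w) (h2 : ∀ x, (K.neighborSet x).ncard ≤ 2)
    (hu : (K.neighborSet u).ncard ≤ 1) (hv : (K.neighborSet v).ncard ≤ 1)
    (hw : (K.neighborSet w).ncard ≤ 1) (hv' : K.Reachable u v) (hw' : K.Reachable u w) :
    False := by
  classical
  have := Fintype.ofFinite V
  set C := K.connectedComponentMk u with hC
  have hconn : C.toSimpleGraph.Connected := C.connected_toSimpleGraph
  have hle := hconn.card_vert_le_card_edgeSet_add_one
  have hsum := C.toSimpleGraph.sum_degrees_eq_twice_card_edges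
  have hdeg : ∀ x : C, C.toSimpleGraph.degree x ≤ (K.neighborSet (x : V)).ncard := by
    intro x
    rw [← SimpleGraph.card_neighborSet_eq_degree, ← Nat.card_eq_fintype_card,
      Nat.card_coe_set_eq, ← Set.ncard_image_of_injective _ Subtype.val_injective]
    apply Set.ncard_le_ncard _ (Set.toFinite _)
    rintro _ ⟨y, hy, rfl⟩
    exact hy
  have mem : ∀ x, K.Reachable u x → x ∈ C.supp := by
    intro x hx
    simpa [hC] using hx.symm
  let U : C := ⟨u, mem u (Reachable.refl u)⟩
  let A : C := ⟨v, mem v hv'⟩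
  let B : C := ⟨w, mem w hw'⟩
  have hcard : ({U, A, B} : Finset C).card = 3 := by
    rw [Finset.card_eq_three]
    exact ⟨U, A, B, by simpa [U, A] using huv, by simpa [U, B] using huw,
      by simpa [A, B] using hvw, rfl⟩
  have hsum2 : ∑ x : C, (C.toSimpleGraph.degree x + if x ∈ ({U, A, B} : Finset C) then 1 else 0)
      ≤ ∑ x : C, 2 := by
    apply Finset.sum_le_sum
    intro x _
    split_ifs with hx
    · simp only [Finset.mem_insert, Finset.mem_singleton] at hx
      rcases hx with rfl | rfl | rfl
      · exact Nat.succ_le_succ ((hdeg U).trans hu)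
      · exact Nat.succ_le_succ ((hdeg A).trans hv)
      · exact Nat.succ_le_succ ((hdeg B).trans hw)
    · exact (hdeg x).trans (h2 x)
  rw [Finset.sum_add_distrib, Finset.sum_ite_mem, Finset.univ_inter, Finset.sum_const, hcard,
    hsum, Finset.sum_const, Finset.card_univ] at hsum2
  rw [Nat.card_eq_fintype_card, Nat.card_eq_fintype_card, ← SimpleGraph.edgeFinset_card] at hle
  simp only [smul_eq_mul] at hsum2
  omega

/-- Interchanging the colors `a` and `b` along the Kempe chain at `u`, where exactly one of `a` and
`b` is missing: the chain is a path, so it has at most one other end. -/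
theorem Proper.kempe [Finite V] {α : Type*} [Finite α] [DecidableEq α]
    {G : SimpleGraph V} {c : Sym2 V → α} (hc : Proper G c) {a b : α} (u : V)
    (hu : ¬ (Misses G c u a ↔ Misses G c u b)) :
    ∃ c', Proper G c' ∧ (∀ e, c e ≠ a → c e ≠ b → c' e = c e) ∧ ∃ S : Set V, u ∈ S ∧
      (∀ v ∉ S, ∀ k, Misses G c' v k ↔ Misses G c v k) ∧
      (∀ v ∈ S, ∀ k, Misses G c' v k ↔ Misses G c v (Equiv.swap a b k)) ∧
      ∃ w, ∀ v ∈ S, ¬ (Misses G c v a ↔ Misses G c v b) → v = u ∨ v = w := by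
  classical
  set K := twoColor G c a b with hK
  set S : Set V := {v | K.Reachable u v} with hS
  have hab : ∀ k, Equiv.swap a b k ≠ k → k = a ∨ k = b := by
    intro k hk
    by_contra! h
    exact hk (Equiv.swap_apply_of_ne_of_ne h.1 h.2)
  have hstep : ∀ x y, G.Adj x y → (c s(x, y) = a ∨ c s(x, y) = b) → (x ∈ S ↔ y ∈ S) := by
    intro x y hxy hcol
    have h : K.Adj x y := ⟨hxy, hcol⟩
    exact ⟨fun hx => Reachable.trans hx h.reachable, fun hy => Reachable.trans hy h.symm.reachable⟩
  let c' : Sym2 V → α := fun e => if ∃ v ∈ e, v ∈ S then Equiv.swap a b (c e) else c e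
  have hin : ∀ x y, x ∈ S → c' s(x, y) = Equiv.swap a b (c s(x, y)) := by
    intro x y hx
    exact if_pos ⟨x, by simp, hx⟩
  have hout : ∀ x y, G.Adj x y → x ∉ S → c' s(x, y) = c s(x, y) := by
    intro x y hxy hx
    by_cases hy : y ∈ S
    · rw [Sym2.eq_swap, hin y x hy]
      by_contra hne
      have := hstep y x hxy.symm (hab _ hne)
      exact hx (this.1 hy)
    · apply if_neg
      rintro ⟨v, hv, hvS⟩
      simp only [Sym2.mem_iff] at hv
      rcases hv with rfl | rfl
      exacts [hx hvS, hy hvS]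
  refine ⟨c', ?_, ?_, S, Reachable.refl u, ?_, ?_, ?_⟩
  · intro v x y hx hy hxy
    by_cases hv : v ∈ S
    · rw [hin v x hv, hin v y hv] at hxy
      exact hc v x y hx hy ((Equiv.swap a b).injective hxy)
    · rw [hout v x hx hv, hout v y hy hv] at hxy
      exact hc v x y hx hy hxy
  · intro e ha hb
    simp only [c', Equiv.swap_apply_of_ne_of_ne ha hb, ite_self]
  · intro v hv k
    exact forall₂_congr fun x hx => by rw [hout v x hx hv]
  · intro v hv k
    refine forall₂_congr fun x hx => ?_
    rw [hin v x hv, Ne, Ne, Equiv.swap_apply_eq_iff]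
  · have hend : ∀ v, ¬ (Misses G c v a ↔ Misses G c v b) → (K.neighborSet v).ncard ≤ 1 := by
      intro v hv
      by_cases hva : Misses G c v a
      · rw [← Set.ncard_singleton b]
        apply hc.twoColor_degree_le
        rintro k (rfl | rfl) hk
        exacts [absurd hva hk, rfl]
      · rw [← Set.ncard_singleton a]
        apply hc.twoColor_degree_le
        rintro k (rfl | rfl) hk
        · rfl
        · exact absurd (iff_of_false hva hk) hv
    have h2 : ∀ v, (K.neighborSet v).ncard ≤ 2 := by
      intro v
      refine (hc.twoColor_degree_le (T := {a, b}) ?_).trans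
        (Set.ncard_insert_le a {b} |>.trans (by simp))
      rintro k (rfl | rfl) _ <;> simp
    by_contra hcon
    simp only [not_exists, not_forall, not_or] at hcon
    obtain ⟨v, hvS, hv, hvu, -⟩ := hcon u
    obtain ⟨w, hwS, hw, hwu, hwv⟩ := hcon v
    exact degree_one_in_component K u v w (Ne.symm hvu) (Ne.symm hwu) (Ne.symm hwv) h2
      (hend u hu) (hend v hv) (hend w hw) hvS hwS

/-- Evaluation of `f s` that makes the kernel compute `s` first. -/
def forceNat (s : ℕ) (f : ℕ → Bool) : Bool :=
  Nat.rec (f 0) (fun t _ => f (Nat.succ t)) s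

/-- Evaluation of `f l` that makes the kernel compute the entries of `l` first. -/
def forceList : List ℕ → (List ℕ → Bool) → Bool
  | [], f => f []
  | a :: l, f => forceNat a fun b => forceList l fun m => f (b :: m)

/-- The number whose binary digits `1` are in the distinct places `x` and `y`. -/
def twoBits (x y : ℕ) : ℕ := 2 ^ x ^^^ 2 ^ y

/-- The encoding of edges for `extendsTo`. -/
def edgeCodes (es : List (ℕ × ℕ)) : List ℕ := es.map fun e => twoBits (3 * e.1) (3 * e.2)

/-- The encoding of possible ends of chains in the colors `a` and `b` for `chainWin`. -/
def endCodes (a b : ℕ) (idx : List ℕ) : List ℕ := idx.map fun i => twoBits (3 * i + a) (3 * i + b)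

/-- Whether the edges encoded by `ps` can be colored when bit `3 * i + k` of `s` records that the
color `k` is missing at vertex `i`. -/
def extendsTo (ps : List ℕ) : ℕ → Bool :=
  List.rec (fun _ => true)
    (fun p _ ih s =>
      (Nat.beq (Nat.land s p) p && forceNat (Nat.xor s p) ih) ||
      (Nat.beq (Nat.land s (Nat.shiftLeft p 1)) (Nat.shiftLeft p 1) &&
        forceNat (Nat.xor s (Nat.shiftLeft p 1)) ih) ||
      (Nat.beq (Nat.land s (Nat.shiftLeft p 2)) (Nat.shiftLeft p 2) &&
        forceNat (Nat.xor s (Nat.shiftLeft p 2)) ih)) ps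

/-- Whether exactly one of the two colors encoded by `q` is missing. -/
def isEnd (s q : ℕ) : Bool := !(Nat.beq (Nat.land s q) 0 || Nat.beq (Nat.land s q) q)

/-- Whether interchanging two colors along the chain starting at `q` leads to a state satisfying
`W`, wherever the chain ends. -/
def chainWin (W : ℕ → Bool) (qs : List ℕ) (s q : ℕ) : Bool :=
  isEnd s q && forceNat (Nat.xor s q) fun t =>
    W t && qs.all fun r => Nat.beq r q || !isEnd s r || forceNat (Nat.xor t r) W

/-- Whether the edges encoded by `ps` can be colored after a bounded number of interchanges. -/
def winning (ps q₁ q₂ q₃ : List ℕ) : ℕ → ℕ → Bool :=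
  Nat.rec (extendsTo ps) fun _ W s => W s || q₁.any (chainWin W q₁ s) ||
    q₂.any (chainWin W q₂ s) || q₃.any (chainWin W q₃ s)

/-- The possible sets of missing colors, as bit masks, for an entry of the list of `forStates`: the
entries up to `3` give the number of missing colors. -/
def masks : ℕ → List ℕ
  | 0 => [0]
  | 1 => [1, 2, 4]
  | 2 => [3, 5, 6]
  | 3 => [7]
  | 4 => [1]
  | _ => [3]

/-- Whether `P` holds for all states with sets of missing colors as prescribed by the list. -/
def forStates (P : ℕ → Bool) : List ℕ → ℕ → ℕ → Bool
  | [], _, s => P s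
  | k :: ks, i, s => (masks k).all fun m => forceNat (s ||| m <<< (3 * i)) (forStates P ks (i + 1))

theorem forceNat_eq (s : ℕ) (f : ℕ → Bool) : forceNat s f = f s := by
  cases s <;> rfl

theorem forceList_eq (l : List ℕ) (f : List ℕ → Bool) : forceList l f = f l := by
  induction l generalizing f with
  | nil => rfl
  | cons a l ih => simp only [forceList, forceNat_eq, ih]

theorem testBit_twoBits (x y z : ℕ) :
    (twoBits x y).testBit z = (decide (x = z) ^^ decide (y = z)) := by
  simp only [twoBits, Nat.testBit_xor, Nat.testBit_two_pow]

theorem shiftLeft_twoBits (x y l : ℕ) :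
    Nat.shiftLeft (twoBits x y) l = twoBits (x + l) (y + l) := by
  change (2 ^ x ^^^ 2 ^ y) <<< l = _
  rw [Nat.shiftLeft_xor_distrib, Nat.shiftLeft_eq, Nat.shiftLeft_eq, ← pow_add, ← pow_add, twoBits]

theorem testBit_xor_twoBits (s i i' j : ℕ) (k k' l : Fin 3) :
    (Nat.xor s (twoBits (3 * i + k) (3 * i' + k'))).testBit (3 * j + l) =
      (s.testBit (3 * j + l) ^^ decide (i = j ∧ k = l) ^^ decide (i' = j ∧ k' = l)) := by
  have key : ∀ (i : ℕ) (k : Fin 3), 3 * i + (k : ℕ) = 3 * j + l ↔ i = j ∧ k = l := by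
    intro i k
    rw [Fin.ext_iff]
    omega
  change (s ^^^ _).testBit _ = _
  rw [Nat.testBit_xor, testBit_twoBits, Bool.xor_assoc]
  simp only [key]

theorem land_twoBits_eq_self {s x y : ℕ} (h : x ≠ y) :
    Nat.beq (Nat.land s (twoBits x y)) (twoBits x y) = true ↔
      s.testBit x = true ∧ s.testBit y = true := by
  rw [Nat.beq_eq]
  change s &&& _ = _ ↔ _
  constructor
  · intro hs
    have key : ∀ z, (twoBits x y).testBit z = true → s.testBit z = true := by
      intro z hz
      rw [← hs, Nat.testBit_and, Bool.and_eq_true] at hz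
      exact hz.1
    exact ⟨key x (by simp [testBit_twoBits, h.symm]), key y (by simp [testBit_twoBits, h])⟩
  · rintro ⟨hx, hy⟩
    refine Nat.eq_of_testBit_eq fun z => ?_
    rw [Nat.testBit_and, testBit_twoBits]
    by_cases hxz : x = z
    · simp [← hxz, hx]
    · by_cases hyz : y = z
      · simp [← hyz, hy]
      · simp [hxz, hyz]

theorem land_twoBits_eq_zero {s x y : ℕ} (h : x ≠ y) :
    Nat.beq (Nat.land s (twoBits x y)) 0 = true ↔
      s.testBit x = false ∧ s.testBit y = false := by
  rw [Nat.beq_eq]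
  change s &&& _ = _ ↔ _
  constructor
  · intro hs
    have key : ∀ z, (twoBits x y).testBit z = true → s.testBit z = false := by
      intro z hz
      have := congrArg (Nat.testBit · z) hs
      simpa [hz] using this
    exact ⟨key x (by simp [testBit_twoBits, h.symm]), key y (by simp [testBit_twoBits, h])⟩
  · rintro ⟨hx, hy⟩
    refine Nat.eq_of_testBit_eq fun z => ?_
    rw [Nat.testBit_and, testBit_twoBits]
    by_cases hxz : x = z
    · simp [← hxz, hx]
    · by_cases hyz : y = z
      · simp [← hyz, hy]
      · simp [hxz, hyz]

theorem isEnd_twoBits {s x y : ℕ} (h : x ≠ y) :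
    isEnd s (twoBits x y) = (s.testBit x ^^ s.testBit y) := by
  rw [Bool.eq_iff_iff, isEnd, Bool.not_eq_true', ← Bool.not_eq_true, Bool.or_eq_true,
    land_twoBits_eq_self h, land_twoBits_eq_zero h]
  cases s.testBit x <;> cases s.testBit y <;> simp

/-- Every bit of `s` below `3 * n` records which colors are missing at the `f i`, `i < n`. -/
def Records (G : SimpleGraph V) (c : Sym2 V → Fin 3) (f : ℕ → V) (n s : ℕ) : Prop :=
  ∀ i < n, ∀ k : Fin 3, s.testBit (3 * i + k) = true ↔ Misses G c (f i) k

/-- Adding the edges of a list to a graph. -/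
def addEdges (f : ℕ → V) : List (ℕ × ℕ) → SimpleGraph V → SimpleGraph V
  | [], G => G
  | (i, j) :: es, G => addEdges f es (G ⊔ edge (f i) (f j))

theorem Proper.add_edge {α : Type*} {G : SimpleGraph V} {c : Sym2 V → α} (hc : Proper G c)
    {u v : V} {k : α} (hu : Misses G c u k) (hv : Misses G c v k) :
    ∃ c', Proper (G ⊔ edge u v) c' ∧ ∀ w l, Misses G c w l → (l = k → w ≠ u ∧ w ≠ v) →
      Misses (G ⊔ edge u v) c' w l := by
  classical
  refine ⟨Function.update c s(u, v) k, ?_, ?_⟩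
  · have key : ∀ x y, (G ⊔ edge u v).Adj x y → s(x, y) ≠ s(u, v) → G.Adj x y := by
      intro x y h hne
      rcases h with h | h
      · exact h
      · exact absurd ((edge_adj ..).1 h).1 (by simpa using hne)
    have hmiss : ∀ x y z, s(x, y) = s(u, v) → G.Adj x z → c s(x, z) ≠ k := by
      intro x y z hxy hz
      rw [Sym2.eq_iff] at hxy
      rcases hxy with ⟨rfl, rfl⟩ | ⟨rfl, rfl⟩
      exacts [hu z hz, hv z hz]
    intro w x y hx hy hxy
    by_cases h1 : s(w, x) = s(u, v) <;> by_cases h2 : s(w, y) = s(u, v)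
    · exact Sym2.congr_right.1 (h1.trans h2.symm)
    · rw [h1, Function.update_self, Function.update_of_ne h2] at hxy
      exact absurd hxy.symm (hmiss w x y h1 (key w y hy h2))
    · rw [h2, Function.update_self, Function.update_of_ne h1] at hxy
      exact absurd hxy (hmiss w y x h2 (key w x hx h1))
    · rw [Function.update_of_ne h1, Function.update_of_ne h2] at hxy
      exact hc w x y (key w x hx h1) (key w y hy h2) hxy
  · intro w l hl hlk x hx
    by_cases h : s(w, x) = s(u, v)
    · rw [h, Function.update_self]
      rintro rfl
      have := hlk rfl
      rw [Sym2.eq_iff] at h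
      tauto
    · rw [Function.update_of_ne h]
      apply hl
      rcases hx with h' | h'
      · exact h'
      · exact absurd ((edge_adj ..).1 h').1 (by simpa using h)

theorem extendsTo_sound {f : ℕ → V} {n : ℕ} (hf : Set.InjOn f (Set.Iio n))
    (es : List (ℕ × ℕ)) (hes : ∀ e ∈ es, e.1 < n ∧ e.2 < n ∧ e.1 ≠ e.2) {G : SimpleGraph V}
    {c : Sym2 V → Fin 3} (hc : Proper G c) {s : ℕ}
    (hs : ∀ i < n, ∀ k : Fin 3, s.testBit (3 * i + k) = true → Misses G c (f i) k)
    (h : extendsTo (edgeCodes es) s = true) :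
    ∃ c' : Sym2 V → Fin 3, Proper (addEdges f es G) c' := by
  induction es generalizing G c s with
  | nil => exact ⟨c, hc⟩
  | cons e es ih =>
    obtain ⟨i, j⟩ := e
    have hij := hes (i, j) (by simp)
    have key : ∃ k : Fin 3, s.testBit (3 * i + k) = true ∧ s.testBit (3 * j + k) = true ∧
        extendsTo (edgeCodes es) (Nat.xor s (twoBits (3 * i + k) (3 * j + k))) = true := by
      have hne : ∀ k : ℕ, 3 * i + k ≠ 3 * j + k := fun k h => hij.2.2 (by omega)
      change ((_ && forceNat _ (extendsTo (edgeCodes es))) ||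
        (_ && forceNat _ (extendsTo (edgeCodes es))) ||
        (_ && forceNat _ (extendsTo (edgeCodes es)))) = true at h
      simp only [forceNat_eq, Bool.or_eq_true, Bool.and_eq_true, shiftLeft_twoBits] at h
      rw [land_twoBits_eq_self (x := 3 * i) (y := 3 * j) (hne 0),
        land_twoBits_eq_self (hne 1), land_twoBits_eq_self (hne 2)] at h
      rcases h with (h | h) | h
      exacts [⟨0, h.1.1, h.1.2, h.2⟩, ⟨1, h.1.1, h.1.2, h.2⟩, ⟨2, h.1.1, h.1.2, h.2⟩]
    obtain ⟨k, hi, hj, hk⟩ := key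
    obtain ⟨c', hc', hm⟩ := hc.add_edge (hs i hij.1 k hi) (hs j hij.2.1 k hj)
    refine ih (fun e he => hes e (by simp [he])) hc' ?_ hk
    intro i' hi' l hl
    rw [testBit_xor_twoBits] at hl
    have hne : l = k → i' ≠ i ∧ i' ≠ j := by
      rintro rfl
      constructor
      · rintro rfl
        simp [hi, Ne.symm hij.2.2] at hl
      · rintro rfl
        simp [hj, hij.2.2] at hl
    apply hm
    · apply hs i' hi'
      by_cases hlk : k = l
      · have h1 := (hne hlk.symm).1
        have h2 := (hne hlk.symm).2
        simpa [Ne.symm h1, Ne.symm h2] using hl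
      · simpa [hlk] using hl
    · intro hlk
      obtain ⟨h1, h2⟩ := hne hlk
      exact ⟨fun h => h1 (hf hi' hij.1 h), fun h => h2 (hf hi' hij.2.1 h)⟩

theorem winning_sound [Finite V] {f : ℕ → V} {n : ℕ} (hf : Set.InjOn f (Set.Iio n))
    (es : List (ℕ × ℕ)) (hes : ∀ e ∈ es, e.1 < n ∧ e.2 < n ∧ e.1 ≠ e.2) (idx : List ℕ)
    (hidx : ∀ i, i ∈ idx ↔ i < n) {G : SimpleGraph V} (m : ℕ) {c : Sym2 V → Fin 3}
    (hc : Proper G c) {s : ℕ} (hs : Records G c f n s)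
    (h : winning (edgeCodes es) (endCodes 0 1 idx) (endCodes 0 2 idx) (endCodes 1 2 idx) m s = true) :
    ∃ c' : Sym2 V → Fin 3, Proper (addEdges f es G) c' := by
  induction m generalizing c s with
  | zero => exact extendsTo_sound hf es hes hc (fun i hi k => (hs i hi k).1) h
  | succ m ih =>
    set W := winning (edgeCodes es) (endCodes 0 1 idx) (endCodes 0 2 idx) (endCodes 1 2 idx) m
    have key : ∀ a b : Fin 3, a ≠ b →
        (endCodes a b idx).any (chainWin W (endCodes a b idx) s) = true →
        ∃ c' : Sym2 V → Fin 3, Proper (addEdges f es G) c' := by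
      intro a b hab h
      have hpl : ∀ i, 3 * i + (a : ℕ) ≠ 3 * i + b := fun i h => hab (Fin.ext (by omega))
      simp only [endCodes, List.any_map, List.any_eq_true, chainWin, forceNat_eq,
        Bool.and_eq_true, List.all_map, List.all_eq_true, Function.comp_apply, Bool.or_eq_true,
        Nat.beq_eq, Bool.not_eq_true', isEnd_twoBits (hpl _)] at h
      obtain ⟨i, hi, hend, hw1, hw2⟩ := h
      rw [hidx] at hi
      have isEnd_iff : ∀ j < n, (s.testBit (3 * j + a) ^^ s.testBit (3 * j + b)) = true ↔
          ¬ (Misses G c (f j) a ↔ Misses G c (f j) b) := by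
        intro j hj
        rw [← hs j hj, ← hs j hj]
        cases s.testBit (3 * j + a) <;> cases s.testBit (3 * j + b) <;> simp
      have swap_end : ∀ j < n, (s.testBit (3 * j + a) ^^ s.testBit (3 * j + b)) = true →
          ∀ k : Fin 3,
          (s.testBit (3 * j + k) ^^ decide (a = k) ^^ decide (b = k)) = true ↔
            Misses G c (f j) (Equiv.swap a b k) := by
        intro j hj hend k
        rw [← hs j hj]
        have hend' : (s.testBit (3 * j + a) ^^ s.testBit (3 * j + b)) = true := hend
        rcases eq_or_ne a k with rfl | hak
        · rw [Equiv.swap_apply_left]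
          simp only [hab.symm]
          revert hend'
          cases s.testBit (3 * j + a) <;> cases s.testBit (3 * j + b) <;> simp
        · rcases eq_or_ne b k with rfl | hbk
          · rw [Equiv.swap_apply_right]
            simp only [hab]
            revert hend'
            cases s.testBit (3 * j + a) <;> cases s.testBit (3 * j + b) <;> simp
          · rw [Equiv.swap_apply_of_ne_of_ne hak.symm hbk.symm]
            simp [hak, hbk]
      have swap_notEnd : ∀ j < n, ¬ (s.testBit (3 * j + a) ^^ s.testBit (3 * j + b)) = true →
          ∀ k : Fin 3,
          Misses G c (f j) (Equiv.swap a b k) ↔ Misses G c (f j) k := by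
        intro j hj hend k
        rw [isEnd_iff j hj, not_not] at hend
        rcases eq_or_ne k a with rfl | hak
        · rw [Equiv.swap_apply_left, hend]
        · rcases eq_or_ne k b with rfl | hbk
          · rw [Equiv.swap_apply_right, hend]
          · rw [Equiv.swap_apply_of_ne_of_ne hak hbk]
      obtain ⟨c', hc', -, S, hiS, hout, hin, w, hw⟩ := hc.kempe (f i) ((isEnd_iff i hi).1 hend)
      by_cases hj : ∃ j < n, j ≠ i ∧ f j ∈ S ∧
          (s.testBit (3 * j + a) ^^ s.testBit (3 * j + b)) = true
      · obtain ⟨j, hj, hji, hjS, hjend⟩ := hj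
        have hwj : w = f j := by
          rcases hw _ hjS ((isEnd_iff j hj).1 hjend) with h | h
          · exact absurd (hf hj hi h) hji
          · exact h.symm
        subst hwj
        refine ih hc' (s := Nat.xor (Nat.xor s (twoBits (3 * i + a) (3 * i + b)))
          (twoBits (3 * j + a) (3 * j + b))) ?_ ?_
        · intro j' hj' k
          simp only [testBit_xor_twoBits]
          by_cases hj'i : i = j'
          · subst hj'i
            rw [hin _ hiS]
            simpa [hji] using swap_end i hi hend k
          · by_cases hj'j : j = j'
            · subst hj'j
              rw [hin _ hjS]
              simpa [hj'i] using swap_end j hj hjend k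
            · simp only [hj'i, hj'j, false_and, decide_false, Bool.xor_false]
              rw [hs j' hj']
              by_cases hS : f j' ∈ S
              · rw [hin _ hS, swap_notEnd j' hj']
                rw [isEnd_iff j' hj']
                intro h
                rcases hw _ hS h with h | h
                · exact hj'i (hf hi hj' h.symm)
                · exact hj'j (hf hj hj' h.symm)
              · rw [hout _ hS]
        · rcases hw2 j ((hidx j).2 hj) with (h | h) | h
          · refine absurd ?_ hji
            have h' := congrArg (Nat.testBit · (3 * j + a)) h
            simp only [testBit_twoBits, (hpl j).symm, decide_false, decide_true] at h'
            by_contra hne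
            have h2 : 3 * i + (b : ℕ) ≠ 3 * j + a := by omega
            have h3 : i = j := by simpa [h2] using h'
            exact hne h3.symm
          · rw [hjend] at h
            exact absurd h (by simp)
          · exact h
      · refine ih hc' (s := Nat.xor s (twoBits (3 * i + a) (3 * i + b))) ?_ hw1
        intro j' hj' k
        simp only [testBit_xor_twoBits]
        by_cases hj'i : i = j'
        · subst hj'i
          rw [hin _ hiS]
          simpa using swap_end i hi hend k
        · simp only [hj'i, false_and, decide_false, Bool.xor_false]
          rw [hs j' hj']
          by_cases hS : f j' ∈ S
          · rw [hin _ hS, swap_notEnd j' hj']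
            exact fun h => hj ⟨j', hj', Ne.symm hj'i, hS, h⟩
          · rw [hout _ hS]
    change (W s || _ || _ || _) = true at h
    simp only [Bool.or_eq_true] at h
    rcases h with ((h | h) | h) | h
    exacts [ih hc hs h, key 0 1 (by decide) h, key 0 2 (by decide) h, key 1 2 (by decide) h]

/-- One of the masks for the entry `k` describes the set `M`. -/
def MaskFits (k : ℕ) (M : Finset (Fin 3)) : Prop :=
  ∃ m ∈ masks k, m < 8 ∧ ∀ l : Fin 3, m.testBit l = true ↔ l ∈ M

instance (k : ℕ) (M : Finset (Fin 3)) : Decidable (MaskFits k M) := by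
  unfold MaskFits
  infer_instance

theorem forStates_sound (P : ℕ → Bool) (Q : ℕ → Finset (Fin 3)) (ks : List ℕ) (i s : ℕ)
    (h : forStates P ks i s = true) (hQ : ∀ j k, ks[j]? = some k → MaskFits k (Q (i + j)))
    (hs : s < 2 ^ (3 * i)) (hsQ : ∀ j < i, ∀ l : Fin 3, s.testBit (3 * j + l) = true ↔ l ∈ Q j) :
    ∃ s', P s' = true ∧
      ∀ j < i + ks.length, ∀ l : Fin 3, s'.testBit (3 * j + l) = true ↔ l ∈ Q j := by
  induction ks generalizing i s with
  | nil => exact ⟨s, h, by simpa using hsQ⟩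
  | cons k ks ih =>
    simp only [forStates, forceNat_eq, List.all_eq_true] at h
    obtain ⟨m, hm, hm8, hmQ⟩ := hQ 0 k rfl
    have hlen : i + (k :: ks).length = i + 1 + ks.length := by
      simp only [List.length_cons]
      omega
    rw [hlen]
    refine ih (i + 1) _ (h m hm) ?_ ?_ ?_
    · intro j k' hj
      rw [add_assoc, add_comm 1 j]
      exact hQ (j + 1) k' (by simpa using hj)
    · apply Nat.or_lt_two_pow
      · exact hs.trans_le (Nat.pow_le_pow_right (by simp) (by omega))
      · rw [Nat.shiftLeft_eq, show 3 * (i + 1) = 3 * i + 3 by ring, pow_add, mul_comm]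
        exact Nat.mul_lt_mul_of_pos_left hm8 (by positivity)
    · intro j hj l
      rw [Nat.testBit_or, Nat.testBit_shiftLeft]
      rcases Nat.lt_succ_iff_lt_or_eq.1 hj with hj | rfl
      · have : ¬ 3 * j + (l : ℕ) ≥ 3 * i := by omega
        simpa [this] using hsQ j hj l
      · have : s.testBit (3 * j + l) = false :=
          Nat.testBit_lt_two_pow (hs.trans_le (Nat.pow_le_pow_right (by simp) (by omega)))
        rw [this]
        simpa using hmQ l

/-- Up to a permutation of the colors, the first entry `1` or `2` may be given a fixed mask. -/
def canon : List ℕ → List ℕ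
  | [] => []
  | 1 :: ks => 4 :: ks
  | 2 :: ks => 5 :: ks
  | k :: ks => k :: canon ks

theorem canon_length (ks : List ℕ) : (canon ks).length = ks.length := by
  fun_induction canon ks <;> simp_all

theorem maskFits_card : ∀ M : Finset (Fin 3), MaskFits M.card M := by decide

theorem exists_perm_maskFits : ∀ M : Finset (Fin 3),
    (M.card = 1 → ∃ σ : Equiv.Perm (Fin 3), MaskFits 4 (M.map σ.toEmbedding)) ∧
    (M.card = 2 → ∃ σ : Equiv.Perm (Fin 3), MaskFits 5 (M.map σ.toEmbedding)) := by decide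

theorem canon_fits (Q : ℕ → Finset (Fin 3)) (ks : List ℕ)
    (hQ : ∀ j k, ks[j]? = some k → (Q j).card = k) :
    ∃ σ : Equiv.Perm (Fin 3), ∀ j k, (canon ks)[j]? = some k →
      MaskFits k ((Q j).map σ.toEmbedding) := by
  fun_induction canon ks generalizing Q with
  | case1 => exact ⟨1, by simp⟩
  | case2 ks =>
    obtain ⟨σ, hσ⟩ := (exists_perm_maskFits (Q 0)).1 (hQ 0 1 rfl)
    refine ⟨σ, fun j k h => ?_⟩
    cases j with
    | zero =>
      obtain rfl : 4 = k := by simpa using h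
      exact hσ
    | succ j =>
      rw [← hQ (j + 1) k (by simpa using h), ← Finset.card_map σ.toEmbedding]
      exact maskFits_card _
  | case3 ks =>
    obtain ⟨σ, hσ⟩ := (exists_perm_maskFits (Q 0)).2 (hQ 0 2 rfl)
    refine ⟨σ, fun j k h => ?_⟩
    cases j with
    | zero =>
      obtain rfl : 5 = k := by simpa using h
      exact hσ
    | succ j =>
      rw [← hQ (j + 1) k (by simpa using h), ← Finset.card_map σ.toEmbedding]
      exact maskFits_card _
  | case4 k ks _ _ ih =>
    obtain ⟨σ, hσ⟩ := ih (fun j => Q (j + 1)) fun j k h => hQ (j + 1) k (by simpa using h)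
    refine ⟨σ, fun j k' h => ?_⟩
    cases j with
    | zero =>
      obtain rfl : k = k' := by simpa using h
      rw [← hQ 0 k rfl, ← Finset.card_map σ.toEmbedding]
      exact maskFits_card _
    | succ j => exact hσ j k' (by simpa using h)

/-- The neighbors of `i` along the edges in the list. -/
def nbrs (es : List (ℕ × ℕ)) (i : ℕ) : List ℕ :=
  es.filterMap fun e => if e.1 = i then some e.2 else if e.2 = i then some e.1 else none

/-- The configuration with degrees `ds` and edges `es` cannot occur in a 3-critical graph because
every coloring of the rest of the graph can be extended to `es` after at most `m` interchanges. -/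
def reducible (ds : List ℕ) (es : List (ℕ × ℕ)) (idx : List ℕ) (m : ℕ) : Bool :=
  !es.isEmpty && es.all (fun e => e.1 < ds.length && e.2 < ds.length && e.1 != e.2) &&
  (List.range ds.length).all (fun i => decide (nbrs es i).Nodup && idx.contains i) &&
  idx.all (fun i => i < ds.length) &&
  forceList (edgeCodes es) fun ps => forceList (endCodes 0 1 idx) fun q₁ =>
    forceList (endCodes 0 2 idx) fun q₂ => forceList (endCodes 1 2 idx) fun q₃ =>
      forStates (winning ps q₁ q₂ q₃ m)
        (canon (ds.mapIdx fun i d => 3 - (d - (nbrs es i).length))) 0 0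

theorem Proper.mono {α : Type*} {G H : SimpleGraph V} (h : G ≤ H) {c : Sym2 V → α}
    (hc : Proper H c) : Proper G c :=
  fun v x y hx hy => hc v x y (h hx) (h hy)

theorem addEdges_adj (f : ℕ → V) (es : List (ℕ × ℕ)) (G : SimpleGraph V) {x y : V} (hne : x ≠ y)
    (h : G.Adj x y ∨ ∃ e ∈ es, s(x, y) = s(f e.1, f e.2)) : (addEdges f es G).Adj x y := by
  induction es generalizing G with
  | nil => simpa [addEdges] using h
  | cons e es ih =>
    apply ih
    rcases h with h | ⟨e', he', h⟩
    · exact Or.inl (Or.inl h)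
    · rw [List.mem_cons] at he'
      rcases he' with rfl | he'
      · refine Or.inl (Or.inr ?_)
        rw [edge_adj]
        exact ⟨by simpa [eq_comm] using h, hne⟩
      · exact Or.inr ⟨e', he', h⟩

/-- The properties of 3-critical graphs on which the reducibility arguments rest. -/
structure MinimalUncolorable (G : SimpleGraph V) : Prop where
  not_proper : ∀ c : Sym2 V → Fin 3, ¬ Proper G c
  delete : ∀ x y, G.Adj x y → ∃ c : Sym2 V → Fin 3, Proper (G.deleteEdges {s(x, y)}) c
  deg_pos : ∀ v, 0 < deg G v
  deg_le : ∀ v, deg G v ≤ 3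

theorem MinimalUncolorable.reducible_absurd [Finite V] {G : SimpleGraph V}
    (hG : MinimalUncolorable G) (f : ℕ → V) (ds : List ℕ) (es : List (ℕ × ℕ)) (idx : List ℕ)
    (m : ℕ) (hf : Set.InjOn f (Set.Iio ds.length))
    (hds : ∀ i d, ds[i]? = some d → deg G (f i) = d) (hes : ∀ e ∈ es, G.Adj (f e.1) (f e.2))
    (h : reducible ds es idx m = true) : False := by
  classical
  simp only [reducible, forceList_eq, Bool.and_eq_true, List.all_eq_true, decide_eq_true_eq,
    List.mem_range, bne_iff_ne, List.contains_iff_mem, Bool.not_eq_true', List.isEmpty_eq_false_iff] at h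
  obtain ⟨⟨⟨⟨hne, hlt⟩, hi⟩, hidx⟩, hst⟩ := h
  set D : Set (Sym2 V) := {e | ∃ p ∈ es, e = s(f p.1, f p.2)} with hD
  have hprop : ∃ c : Sym2 V → Fin 3, Proper (G.deleteEdges D) c := by
    obtain ⟨e, he⟩ := List.exists_mem_of_ne_nil es hne
    obtain ⟨c, hc⟩ := hG.delete _ _ (hes e he)
    refine ⟨c, hc.mono (deleteEdges_anti ?_)⟩
    rintro _ rfl
    exact ⟨e, he, rfl⟩
  have hnb : ∀ i < ds.length, ∀ j, j ∈ nbrs es i ↔ ∃ p ∈ es, p = (i, j) ∨ p = (j, i) := by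
    intro i _ j
    simp only [nbrs, List.mem_filterMap]
    refine exists_congr fun p => and_congr_right fun hp => ?_
    have := (hlt p hp).2
    obtain ⟨a, b⟩ := p
    simp only [Prod.mk.injEq]
    grind
  have hnlt : ∀ i < ds.length, ∀ j ∈ nbrs es i, j < ds.length := by
    intro i hil j hj
    obtain ⟨p, hp, rfl | rfl⟩ := (hnb i hil j).1 hj
    exacts [(hlt _ hp).1.2, (hlt _ hp).1.1]
  have hdeg : ∀ i < ds.length,
      deg (G.deleteEdges D) (f i) = deg G (f i) - (nbrs es i).length := by
    intro i hil
    have hset : (G.deleteEdges D).neighborSet (f i) =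
        G.neighborSet (f i) \ f '' {j | j ∈ nbrs es i} := by
      ext x
      simp only [mem_neighborSet, deleteEdges_adj, Set.mem_sdiff, Set.mem_image, Set.mem_ofPred_eq,
        hD]
      refine and_congr_right fun hx => not_congr ?_
      constructor
      · rintro ⟨p, hp, hpe⟩
        rw [Sym2.eq_iff] at hpe
        rcases hpe with ⟨h1, h2⟩ | ⟨h1, h2⟩
        · have := hf hil (hlt p hp).1.1 h1
          exact ⟨p.2, (hnb i hil _).2 ⟨p, hp, Or.inl (by rw [this])⟩, h2.symm⟩
        · have := hf hil (hlt p hp).1.2 h1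
          exact ⟨p.1, (hnb i hil _).2 ⟨p, hp, Or.inr (by rw [this])⟩, h2.symm⟩
      · rintro ⟨j, hj, rfl⟩
        obtain ⟨p, hp, rfl | rfl⟩ := (hnb i hil j).1 hj
        exacts [⟨_, hp, rfl⟩, ⟨_, hp, Sym2.eq_swap⟩]
    have hcard : (f '' {j | j ∈ nbrs es i}).ncard = (nbrs es i).length := by
      rw [Set.InjOn.ncard_image]
      · rw [← List.coe_toFinset, Set.ncard_coe_finset, List.toFinset_card_of_nodup (hi i hil).1]
      · intro a ha b hb hab
        exact hf (hnlt i hil a ha) (hnlt i hil b hb) hab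
    rw [deg, hset, Set.ncard_sdiff, hcard, deg]
    rintro _ ⟨j, hj, rfl⟩
    obtain ⟨p, hp, rfl | rfl⟩ := (hnb i hil j).1 hj
    exacts [hes _ hp, (hes _ hp).symm]
  obtain ⟨c, hc⟩ := hprop
  set Q : ℕ → Finset (Fin 3) := fun i => {k | Misses (G.deleteEdges D) c (f i) k} with hQ
  obtain ⟨σ, hσ⟩ := canon_fits Q (ds.mapIdx fun i d => 3 - (d - (nbrs es i).length)) (by
    intro j k hjk
    rw [List.getElem?_mapIdx, Option.map_eq_some_iff] at hjk
    obtain ⟨d, hd, rfl⟩ := hjk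
    have hj : j < ds.length := (List.getElem?_eq_some_iff.1 hd).1
    rw [← hds j d hd, ← hdeg j hj]
    refine Nat.eq_sub_of_add_eq (Eq.trans ?_ (hc.ncard_misses (f j)))
    rw [← Set.ncard_coe_finset]
    congr 2
    ext k
    simp [hQ])
  obtain ⟨s, hs, hsQ⟩ := forStates_sound _ (fun j => (Q j).map σ.toEmbedding) _ 0 0 hst
    (by simpa using hσ) (by simp) (by simp)
  obtain ⟨c', hc'⟩ := winning_sound hf es (fun e he => ⟨(hlt e he).1.1, (hlt e he).1.2,
    (hlt e he).2⟩) idx (fun i => ⟨hidx i, fun h => (hi i h).2⟩) m (hc.perm σ)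
    (by
      intro i hil k
      rw [hsQ i (by simpa [canon_length] using hil) k, misses_perm]
      simp [hQ, Finset.mem_map_equiv]) hs
  refine hG.not_proper c' (hc'.mono ?_)
  intro x y hxy
  apply addEdges_adj f es _ hxy.ne
  by_cases h : s(x, y) ∈ D
  · exact Or.inr h
  · exact Or.inl (deleteEdges_adj.2 ⟨hxy, h⟩)

theorem Proper.recolor [Finite V] {α : Type*} {G : SimpleGraph V} {c : Sym2 V → α}
    (hc : Proper G c) {u w : V} (huw : G.Adj u w) {k : α} (hu : Misses G c u k)
    (hw : Misses G c w k) :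
    ∃ c', Proper G c' ∧ Misses G c' u (c s(u, w)) ∧
      ∀ v l, Misses G c v l → v ≠ u → v ≠ w → Misses G c' v l := by
  set H := G.deleteEdges {s(u, w)} with hH
  have hle : H ≤ G := deleteEdges_le _
  have hadd : H ⊔ edge u w = G := by
    rw [hH, deleteEdges, ← edgeSet_inj]
    ext e
    induction e with | _ x y
    simp only [mem_edgeSet, sup_adj, sdiff_adj, fromEdgeSet_adj, edge_adj]
    grind [Sym2.eq_iff, G.adj_comm, G.ne_of_adj]
  have hcH := hc.mono hle
  have hm : ∀ v l, Misses G c v l → Misses H c v l := fun v l h x hx => h x (hle hx)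
  obtain ⟨c', hc', h⟩ := hcH.add_edge (hm u k hu) (hm w k hw)
  rw [hadd] at hc' h
  refine ⟨c', hc', h _ _ ?_ ?_, fun v l hv h1 h2 => h _ _ (hm v l hv) fun _ => ⟨h1, h2⟩⟩
  · intro x hx hxc
    have := hc u x w (hle hx) huw hxc
    subst this
    simp [hH] at hx
  · rintro rfl
    exact absurd rfl (hu w huw)

/-- Vizing's theorem for maximum degree at most three, in the form needed here: a coloring with at
least four colors extends to a missing edge. -/
theorem exists_proper_of_deleteEdge [Finite V] {G : SimpleGraph V} (hdeg : ∀ v, deg G v ≤ 3)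
    {n : ℕ} (hn : 4 ≤ n) {u v : V} (huv : G.Adj u v) {c : Sym2 V → Fin n}
    (hc : Proper (G.deleteEdges {s(u, v)}) c) : ∃ c' : Sym2 V → Fin n, Proper G c' := by
  set H := G.deleteEdges {s(u, v)} with hH
  have hle : H ≤ G := deleteEdges_le _
  have hadd : G ≤ H ⊔ edge u v := by
    intro x y hxy
    by_cases h : s(x, y) = s(u, v)
    · refine Or.inr ?_
      rw [edge_adj]
      exact ⟨Sym2.eq_iff.1 h, hxy.ne⟩
    · exact Or.inl (deleteEdges_adj.2 ⟨hxy, h⟩)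
  have hnadj : ¬ H.Adj u v := by simp [hH]
  have done : ∀ (d : Sym2 V → Fin n) (k : Fin n), Proper H d → Misses H d u k → Misses H d v k →
      ∃ c' : Sym2 V → Fin n, Proper G c' := by
    intro d k hd hu hv
    obtain ⟨c', hc', -⟩ := hd.add_edge hu hv
    exact ⟨c', hc'.mono hadd⟩
  have hlt : ∀ x y, s(x, y) = s(u, v) → deg H x ≤ 2 := by
    intro x y hxy
    have hxy' : G.Adj x y := by
      rw [← mem_edgeSet, hxy]
      exact huv
    have : deg H x < deg G x := by
      apply Set.ncard_lt_ncard _ (Set.toFinite _)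
      refine ⟨fun z hz => hle hz, fun h => ?_⟩
      have := h (show y ∈ G.neighborSet x from hxy')
      simp only [hH, mem_neighborSet, deleteEdges_adj, Set.mem_singleton_iff, hxy] at this
      exact this.2 trivial
    have := hdeg x
    omega
  have hH3 : ∀ x, deg H x ≤ 3 := fun x => (Set.ncard_le_ncard (fun z hz => hle hz)
    (Set.toFinite _)).trans (hdeg x)
  have hu2 := hlt u v rfl
  have hv2 := hlt v u Sym2.eq_swap
  have hMu := hc.ncard_misses u
  have hMv := hc.ncard_misses v
  by_cases hcom : ∃ k, Misses H c u k ∧ Misses H c v k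
  · obtain ⟨k, h1, h2⟩ := hcom
    exact done c k hc h1 h2
  push Not at hcom
  have hor : ∀ k, Misses H c u k ∨ Misses H c v k := by
    have hdisj : Disjoint {k | Misses H c u k} {k | Misses H c v k} :=
      Set.disjoint_left.2 fun k h1 h2 => hcom k h1 h2
    have huni : {k | Misses H c u k} ∪ {k | Misses H c v k} = Set.univ := by
      apply Set.eq_of_subset_of_ncard_le (Set.subset_univ _) _ (Set.toFinite _)
      rw [Set.ncard_union_eq hdisj (Set.toFinite _) (Set.toFinite _), Set.ncard_univ,
        Nat.card_eq_fintype_card, Fintype.card_fin]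
      omega
    intro k
    have : k ∈ {k | Misses H c u k} ∪ {k | Misses H c v k} := by rw [huni]; trivial
    exact this
  obtain ⟨a, ha⟩ : ∃ a, Misses H c u a :=
    Set.nonempty_of_ncard_ne_zero (s := {k | Misses H c u k}) (by omega)
  obtain ⟨b, hb⟩ : ∃ b, Misses H c v b :=
    Set.nonempty_of_ncard_ne_zero (s := {k | Misses H c v k}) (by omega)
  have hub : ¬ Misses H c u b := fun h => hcom b h hb
  obtain ⟨w, hw, hwb⟩ : ∃ w, H.Adj u w ∧ c s(u, w) = b := by
    simpa [Misses] using hub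
  have hvu : v ≠ u := huv.ne'
  have hvw : v ≠ w := by
    rintro rfl
    exact hnadj hw
  obtain ⟨k, hk⟩ : ∃ k, Misses H c w k := by
    have h1 := hc.ncard_misses w
    have h2 := hH3 w
    exact Set.nonempty_of_ncard_ne_zero (s := {k | Misses H c w k}) (by omega)
  have finish : ∀ (d : Sym2 V → Fin n) (l : Fin n), Proper H d → d s(u, w) = b →
      Misses H d u l → Misses H d w l → Misses H d v b →
      ∃ c' : Sym2 V → Fin n, Proper G c' := by
    intro d l hd hdb h1 h2 h3
    obtain ⟨c', hc', h4, h5⟩ := hd.recolor hw h1 h2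
    rw [hdb] at h4
    exact done c' b hc' h4 (h5 v b h3 hvu hvw)
  by_cases hku : Misses H c u k
  · exact finish c k hc hwb hku hk hb
  have hkv := (hor k).resolve_left hku
  by_cases hwa : Misses H c w a
  · exact finish c a hc hwb ha hwa hb
  have hva : ¬ Misses H c v a := hcom a ha
  obtain ⟨c', hc', hkeep, S, huS, hout, hin, x, hx⟩ := hc.kempe (a := a) (b := k) u (by tauto)
  by_cases hvS : v ∈ S
  · have hxv : v = x := (hx v hvS (by tauto)).resolve_left hvu
    have hwS : w ∉ S := by
      intro hwS
      rcases hx w hwS (by tauto) with h | h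
      · exact hw.ne h.symm
      · exact hvw (hxv.trans h.symm)
    have hba : b ≠ a := by
      rintro rfl
      exact hub ha
    have hbk : b ≠ k := by
      rintro rfl
      exact hk u hw.symm (by rw [Sym2.eq_swap, hwb])
    refine finish c' k hc' ?_ ?_ ((hout w hwS k).2 hk) ?_
    · rw [hkeep _ (hwb ▸ hba) (hwb ▸ hbk), hwb]
    · rw [hin u huS, Equiv.swap_apply_right]
      exact ha
    · rw [hin v hvS, Equiv.swap_apply_of_ne_of_ne hba hbk]
      exact hb
  · refine done c' k hc' ?_ ((hout v hvS k).2 hkv)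
    rw [hin u huS, Equiv.swap_apply_right]
    exact ha

theorem edgeChromaticNumber_le_iff [Finite V] (G : SimpleGraph V) (n : ℕ) :
    edgeChromaticNumber G ≤ n + 1 ↔ ∃ c : Sym2 V → Fin (n + 1), Proper G c := by
  constructor
  · intro h
    have hne : {n | ∃ c, IsProperEdgeColoring G n c}.Nonempty := by
      obtain ⟨m, ⟨e⟩⟩ := Finite.exists_equiv_fin (Sym2 V)
      exact ⟨m, fun x => e x, fun x _ => (e x).2, fun x _ y _ hxy _ h =>
        hxy (e.injective (Fin.ext h))⟩
    obtain ⟨c, hc1, hc2⟩ := Nat.sInf_mem hne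
    have hlt : ∀ e ∈ G.edgeSet, c e < n + 1 := fun e he => (hc1 e he).trans_le h
    refine ⟨fun e => Fin.ofNat (n + 1) (c e), ?_⟩
    intro v x y hx hy hxy
    by_contra hne
    have := congrArg Fin.val hxy
    simp only [Fin.val_ofNat] at this
    rw [Nat.mod_eq_of_lt (hlt s(v, x) hx), Nat.mod_eq_of_lt (hlt s(v, y) hy)] at this
    exact hc2 s(v, x) hx s(v, y) hy (fun h => hne (Sym2.congr_right.1 h)) ⟨v, by simp, by simp⟩ this
  · rintro ⟨c, hc⟩
    apply Nat.sInf_le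
    refine ⟨fun e => c e, fun e _ => (c e).2, ?_⟩
    rintro e he e' he' hne ⟨v, hv, hv'⟩ h
    obtain ⟨x, rfl⟩ := hv
    obtain ⟨y, rfl⟩ := hv'
    exact hne (congrArg _ (hc v x y he he' (Fin.ext h)))

theorem proper_spanningCoe [Finite V] {G : SimpleGraph V} (H : G.Subgraph) {n : ℕ}
    (h : edgeChromaticNumber H.coe ≤ n + 1) :
    ∃ c : Sym2 V → Fin (n + 1), Proper H.spanningCoe c := by
  obtain ⟨c, hc⟩ := (edgeChromaticNumber_le_iff _ _).1 h
  have hinj : Function.Injective (Sym2.map (Subtype.val : H.verts → V)) :=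
    Sym2.map.injective Subtype.val_injective
  have hval : ∀ x y (hxy : H.Adj x y), Function.extend (Sym2.map Subtype.val) c 0 s(x, y) =
      c s(⟨x, hxy.fst_mem⟩, ⟨y, hxy.snd_mem⟩) := by
    intro x y hxy
    exact hinj.extend_apply c 0 s(⟨x, hxy.fst_mem⟩, ⟨y, hxy.snd_mem⟩)
  refine ⟨Function.extend (Sym2.map Subtype.val) c 0, ?_⟩
  intro v x y hx hy hxy
  rw [hval v x hx, hval v y hy] at hxy
  exact congrArg Subtype.val (hc ⟨v, hx.fst_mem⟩ ⟨x, hx.snd_mem⟩ ⟨y, hy.snd_mem⟩ hx hy hxy)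

theorem IsKCritical.deg_le [Finite V] {G : SimpleGraph V} {k : ℕ} (hG : IsKCritical G k) (v : V) :
    deg G v ≤ k := by
  rw [← hG.2]
  refine le_csSup ?_ (show deg G v ∈ {d | ∃ v, deg G v = d} from ⟨v, rfl⟩)
  exact (Set.finite_range (deg G)).bddAbove

theorem IsKCritical.minimalUncolorable [Finite V] {G : SimpleGraph V} (hG : IsKCritical G 3) :
    MinimalUncolorable G := by
  have hdeg := hG.deg_le
  have hmax : ∃ v, deg G v = 3 := by
    have h := hG.2
    have hne : {d | ∃ v, deg G v = d}.Nonempty := by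
      rw [Set.nonempty_iff_ne_empty]
      intro h0
      rw [maxDeg, h0] at h
      simp at h
    have := Nat.sSup_mem hne (Set.finite_range (deg G)).bddAbove
    rwa [← maxDeg, h] at this
  have hgt : 3 < edgeChromaticNumber G := by
    by_contra! hle
    rcases Nat.lt_or_eq_of_le hle with h | h
    · obtain ⟨c, hc⟩ := (edgeChromaticNumber_le_iff G 1).1 (by omega)
      obtain ⟨v, hv⟩ := hmax
      have := hc.ncard_misses v
      omega
    · exact hG.1.1 (h.trans hG.2.symm)
  obtain ⟨n, hn⟩ : ∃ n, edgeChromaticNumber G = n + 2 := ⟨edgeChromaticNumber G - 2, by omega⟩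
  have hsub : ∀ H : G.Subgraph, H ≠ ⊤ →
      ∃ c : Sym2 V → Fin (n + 1), Proper H.spanningCoe c := by
    intro H hH
    have := hG.1.2 H hH
    exact proper_spanningCoe H (by omega)
  have hnot : ∀ c : Sym2 V → Fin (n + 1), ¬ Proper G c := by
    intro c hc
    have := (edgeChromaticNumber_le_iff G n).2 ⟨c, hc⟩
    omega
  have hdel : ∀ x y, G.Adj x y →
      ∃ c : Sym2 V → Fin (n + 1), Proper (G.deleteEdges {s(x, y)}) c := by
    intro x y hxy
    have h : (⊤ : G.Subgraph).deleteEdges {s(x, y)} ≠ ⊤ := by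
      intro h
      have : ((⊤ : G.Subgraph).deleteEdges {s(x, y)}).Adj x y := by
        rw [h]
        exact hxy
      simp at this
    obtain ⟨c, hc⟩ := hsub _ h
    refine ⟨c, hc.mono fun u v huv => ?_⟩
    simpa using huv
  obtain rfl : n = 2 := by
    by_contra hne
    obtain ⟨v, hv⟩ := hmax
    obtain ⟨w, hw⟩ : (G.neighborSet v).Nonempty := by
      apply Set.nonempty_of_ncard_ne_zero
      rw [← deg, hv]
      simp
    obtain ⟨c, hc⟩ := hdel v w hw
    obtain ⟨c', hc'⟩ := exists_proper_of_deleteEdge hdeg (by omega) hw hc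
    exact hnot c' hc'
  refine ⟨hnot, hdel, ?_, hdeg⟩
  intro v
  by_contra! hv
  have hiso : ∀ w, ¬ G.Adj v w := by
    intro w hw
    have := Set.ncard_eq_zero (Set.toFinite (G.neighborSet v)) |>.1 (Nat.le_zero.1 hv)
    exact Set.eq_empty_iff_forall_notMem.1 this w hw
  have h : (⊤ : G.Subgraph).deleteVerts {v} ≠ ⊤ := by
    intro h
    have : v ∈ ((⊤ : G.Subgraph).deleteVerts {v}).verts := by
      rw [h]
      trivial
    simp at this
  obtain ⟨c, hc⟩ := hsub _ h
  refine hnot c (hc.mono fun x y hxy => ?_)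
  have hx : x ≠ v := by
    rintro rfl
    exact hiso y hxy
  have hy : y ≠ v := by
    rintro rfl
    exact hiso x hxy.symm
  simpa [hx, hy] using hxy

theorem reducible_two_two : reducible (List.replicate 0 3 ++ List.replicate 2 2)
    [(0, 1)]
    [0, 1] 3 = true := by decide +kernel

theorem reducible_three_two_two : reducible (List.replicate 1 3 ++ List.replicate 2 2)
    [(0, 1), (0, 2)]
    [1, 2, 0] 3 = true := by decide +kernel

theorem reducible_shared_pendant : reducible (List.replicate 3 3 ++ List.replicate 2 2)
    [(0, 3), (1, 0), (3, 1), (1, 2), (2, 4)]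
    [2, 4, 0, 1, 3] 3 = true := by decide +kernel

theorem reducible_four_cycle : reducible (List.replicate 3 3 ++ List.replicate 2 2)
    [(0, 1), (1, 2), (4, 1), (3, 2), (3, 0)]
    [4, 2, 0, 1, 3] 3 = true := by decide +kernel

theorem reducible_triangle : reducible (List.replicate 3 3 ++ List.replicate 3 2)
    [(1, 2), (5, 2), (2, 0), (0, 1), (4, 1), (3, 0)]
    [4, 3, 5, 0, 1, 2] 3 = true := by decide +kernel

theorem reducible_path_four : reducible (List.replicate 4 3 ++ List.replicate 4 2)
    [(0, 4), (0, 1), (3, 7), (2, 3), (1, 5), (1, 2), (2, 6)]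
    [3, 0, 4, 5, 7, 6, 1, 2] 3 = true := by decide +kernel

theorem reducible_fork_two_a_three_c : reducible (List.replicate 8 3 ++ List.replicate 3 2)
    [(2, 3), (6, 7), (3, 8), (0, 1), (8, 0), (0, 4), (4, 5), (5, 6),
      (9, 5), (9, 1), (1, 2), (10, 2), (10, 6)]
    [4, 3, 7, 0, 1, 2, 5, 6, 8, 9, 10] 3 = true := by decide +kernel

theorem reducible_fork_two_c_three_a : reducible (List.replicate 8 3 ++ List.replicate 3 2)
    [(0, 1), (0, 4), (6, 7), (4, 5), (9, 1), (5, 6), (9, 6), (8, 0),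
      (10, 5), (10, 2), (2, 3), (1, 2), (3, 8)]
    [3, 7, 4, 0, 1, 2, 5, 6, 8, 9, 10] 3 = true := by decide +kernel

theorem reducible_fork_three_a : reducible (List.replicate 8 3 ++ List.replicate 4 2)
    [(6, 7), (9, 1), (0, 1), (1, 2), (2, 3), (3, 8), (8, 0), (0, 4),
      (4, 5), (11, 6), (5, 6), (10, 5), (10, 2)]
    [4, 3, 11, 9, 7, 0, 1, 2, 5, 6, 8, 10] 3 = true := by decide +kernel

theorem reducible_fork_three_c : reducible (List.replicate 8 3 ++ List.replicate 4 2)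
    [(6, 7), (9, 1), (0, 1), (1, 2), (2, 3), (3, 8), (0, 4), (8, 0),
      (4, 5), (5, 6), (11, 5), (10, 6), (10, 2)]
    [7, 3, 4, 9, 11, 0, 1, 2, 5, 6, 8, 10] 3 = true := by decide +kernel

theorem reducible_fork_two_a : reducible (List.replicate 8 3 ++ List.replicate 4 2)
    [(6, 7), (10, 2), (2, 3), (3, 8), (1, 2), (0, 1), (8, 0), (0, 4),
      (4, 5), (11, 6), (5, 6), (9, 1), (9, 5)]
    [3, 10, 4, 11, 7, 0, 1, 2, 5, 6, 8, 9] 3 = true := by decide +kernel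

theorem reducible_fork_two_c : reducible (List.replicate 8 3 ++ List.replicate 4 2)
    [(6, 7), (10, 2), (2, 3), (3, 8), (1, 2), (0, 4), (0, 1), (8, 0),
      (4, 5), (5, 6), (11, 5), (9, 6), (9, 1)]
    [7, 10, 3, 11, 4, 0, 1, 2, 5, 6, 8, 9] 3 = true := by decide +kernel

theorem reducible_fork_three_e : reducible (List.replicate 8 3 ++ List.replicate 5 2)
    [(9, 1), (2, 3), (3, 8), (1, 2), (0, 1), (8, 0), (0, 4), (4, 5),
      (11, 5), (5, 6), (12, 6), (6, 7), (10, 2), (10, 7)]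
    [7, 4, 12, 11, 3, 9, 0, 1, 2, 5, 6, 8, 10] 3 = true := by decide +kernel

theorem reducible_fork_two_e : reducible (List.replicate 8 3 ++ List.replicate 5 2)
    [(10, 2), (2, 3), (1, 2), (3, 8), (8, 0), (0, 1), (0, 4), (4, 5),
      (11, 5), (5, 6), (6, 7), (12, 6), (9, 7), (9, 1)]
    [12, 7, 4, 11, 10, 3, 0, 1, 2, 5, 6, 8, 9] 3 = true := by decide +kernel

theorem reducible_fork : reducible (List.replicate 8 3 ++ List.replicate 6 2)
    [(10, 2), (2, 3), (1, 2), (3, 8), (9, 1), (0, 1), (8, 0), (0, 4),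
      (4, 5), (13, 7), (6, 7), (11, 5), (5, 6), (12, 6)]
    [12, 7, 11, 4, 13, 10, 3, 9, 0, 1, 2, 5, 6, 8] 3 = true := by decide +kernel

theorem reducible_theta_five : reducible (List.replicate 7 3 ++ List.replicate 4 2)
    [(1, 8), (0, 1), (1, 2), (9, 2), (2, 3), (3, 4), (7, 3), (0, 7),
      (0, 5), (5, 4), (8, 4), (5, 6), (10, 6)]
    [9, 6, 10, 0, 1, 2, 3, 4, 5, 7, 8] 3 = true := by decide +kernel

theorem reducible_theta_five_shared : reducible (List.replicate 7 3 ++ List.replicate 3 2)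
    [(0, 1), (3, 4), (9, 2), (5, 6), (5, 4), (0, 5), (9, 6), (0, 7),
      (1, 8), (2, 3), (8, 4), (7, 3), (1, 2)]
    [6, 0, 1, 2, 3, 4, 5, 7, 8, 9] 3 = true := by decide +kernel

theorem reducible_theta_six : reducible (List.replicate 7 3 ++ List.replicate 3 2)
    [(8, 4), (5, 4), (1, 8), (2, 9), (6, 5), (7, 3), (2, 3), (3, 4),
      (1, 2), (0, 6), (0, 1), (0, 7), (9, 5)]
    [6, 0, 1, 2, 3, 4, 5, 7, 8, 9] 3 = true := by decide +kernel

section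

/-- `x` has degree three, and its neighbors are `t`, of degree two, and `a` and `b`, of degree
three. -/
structure Mid (G : SimpleGraph V) (t x a b : V) : Prop where
  deg_x : deg G x = 3
  deg_t : deg G t = 2
  deg_a : deg G a = 3
  deg_b : deg G b = 3
  adj_t : G.Adj x t
  adj_a : G.Adj x a
  adj_b : G.Adj x b
  ne : a ≠ b

variable {G : SimpleGraph V}

theorem Mid.symm {t x a b : V} (h : Mid G t x a b) : Mid G t x b a :=
  ⟨h.deg_x, h.deg_t, h.deg_b, h.deg_a, h.adj_t, h.adj_b, h.adj_a, h.ne.symm⟩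

theorem Mid.info {t x a b : V} (h : Mid G t x a b) :
    (deg G x = 3 ∧ deg G t = 2 ∧ deg G a = 3 ∧ deg G b = 3) ∧
      (G.Adj x t ∧ G.Adj t x ∧ G.Adj x a ∧ G.Adj a x ∧ G.Adj x b ∧ G.Adj b x) ∧
      x ≠ a ∧ a ≠ x ∧ x ≠ b ∧ b ≠ x ∧ a ≠ b ∧ b ≠ a :=
  ⟨⟨h.deg_x, h.deg_t, h.deg_a, h.deg_b⟩,
    ⟨h.adj_t, h.adj_t.symm, h.adj_a, h.adj_a.symm, h.adj_b, h.adj_b.symm⟩,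
    h.adj_a.ne, h.adj_a.ne', h.adj_b.ne, h.adj_b.ne', h.ne, h.ne.symm⟩

variable [Finite V]

theorem eq_of_deg_eq_three {x a b c y : V} (hx : deg G x = 3) (ha : G.Adj x a) (hb : G.Adj x b)
    (hc : G.Adj x c) (hab : a ≠ b) (hac : a ≠ c) (hbc : b ≠ c) (hy : G.Adj x y) :
    y = a ∨ y = b ∨ y = c := by
  have h : {a, b, c} = G.neighborSet x := by
    apply Set.eq_of_subset_of_ncard_le _ _ (Set.toFinite _)
    · rintro z (rfl | rfl | rfl) <;> assumption
    · rw [← deg, hx, Set.ncard_eq_three.2 ⟨a, b, c, hab, hac, hbc, rfl⟩]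
  have hy' : y ∈ G.neighborSet x := hy
  simpa [← h] using hy'

theorem eq_of_deg_eq_two {x a b y : V} (hx : deg G x = 2) (ha : G.Adj x a) (hb : G.Adj x b)
    (hab : a ≠ b) (hy : G.Adj x y) : y = a ∨ y = b := by
  have h : {a, b} = G.neighborSet x := by
    apply Set.eq_of_subset_of_ncard_le _ _ (Set.toFinite _)
    · rintro z (rfl | rfl) <;> assumption
    · rw [← deg, hx, Set.ncard_pair hab]
  have hy' : y ∈ G.neighborSet x := hy
  simpa [← h] using hy'

namespace Mid

variable {t x a b y : V}

theorem eq_or (h : Mid G t x a b) (hy : G.Adj x y) : y = t ∨ y = a ∨ y = b := by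
  apply eq_of_deg_eq_three h.deg_x h.adj_t h.adj_a h.adj_b _ _ h.ne hy
  · rintro rfl
    have := h.deg_t.symm.trans h.deg_a
    omega
  · rintro rfl
    have := h.deg_t.symm.trans h.deg_b
    omega

theorem eq_of_deg_three (h : Mid G t x a b) (hy : G.Adj x y) (hd : deg G y = 3) :
    y = a ∨ y = b := by
  rcases h.eq_or hy with rfl | h | h
  · have := h.deg_t
    omega
  · exact Or.inl h
  · exact Or.inr h

theorem eq_of_deg_two (h : Mid G t x a b) (hy : G.Adj x y) (hd : deg G y = 2) : y = t := by
  rcases h.eq_or hy with h' | rfl | rfl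
  · exact h'
  · have := h.deg_a
    omega
  · have := h.deg_b
    omega

end Mid

namespace MinimalUncolorable

variable (hG : MinimalUncolorable G)
include hG

theorem no_configuration (xs ts : List V) {m n : ℕ} (hm : xs.length = m) (hn : ts.length = n)
    (x₀ : V)
    (hxs : xs.Nodup) (hts : ts.Nodup) (hx : ∀ x ∈ xs, deg G x = 3) (ht : ∀ t ∈ ts, deg G t = 2)
    {es : List (ℕ × ℕ)} {idx : List ℕ} {k : ℕ}
    (hes : ∀ e ∈ es, G.Adj ((xs ++ ts).getD e.1 x₀) ((xs ++ ts).getD e.2 x₀))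
    (h : reducible (List.replicate m 3 ++ List.replicate n 2) es idx k = true) : False := by
  subst hm hn
  have hnd : (xs ++ ts).Nodup := by
    refine List.nodup_append.2 ⟨hxs, hts, ?_⟩
    rintro a ha b hb rfl
    have := (hx a ha).symm.trans (ht a hb)
    omega
  refine hG.reducible_absurd (fun i => (xs ++ ts).getD i x₀) _ es idx k ?_ ?_ hes h
  · intro i hi j hj hij
    have hi' : i < (xs ++ ts).length := by simpa using hi
    have hj' : j < (xs ++ ts).length := by simpa using hj
    simp only [List.getD_eq_getElem _ _ hi', List.getD_eq_getElem _ _ hj'] at hij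
    exact (hnd.getElem_inj_iff).1 hij
  · intro i d hd
    have hi : i < (xs ++ ts).length := by
      have := (List.getElem?_eq_some_iff.1 hd).1
      simpa using this
    simp only [List.getD_eq_getElem _ _ hi]
    rw [List.getElem?_append] at hd
    rw [List.getElem_append]
    by_cases h' : i < xs.length
    · rw [if_pos (by simpa using h'), List.getElem?_replicate, if_pos h'] at hd
      rw [dif_pos h', hx _ (List.getElem_mem _)]
      exact Option.some.inj hd
    · rw [if_neg (by simpa using h'), List.getElem?_replicate, List.length_replicate] at hd
      rw [dif_neg h', ht _ (List.getElem_mem _)]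
      rw [if_pos (by simp only [List.length_append] at hi; omega)] at hd
      exact Option.some.inj hd

theorem two_le_deg (v : V) : 2 ≤ deg G v := by
  by_contra! hlt
  have h1 : deg G v = 1 := by
    have := hG.deg_pos v
    omega
  obtain ⟨w, hw⟩ : (G.neighborSet v).Nonempty := by
    apply Set.nonempty_of_ncard_ne_zero
    rw [← deg, h1]
    simp
  have key : ∀ d, deg G w = d → reducible [1, d] [(0, 1)] [0, 1] 0 = true → False := by
    intro d hd
    refine hG.reducible_absurd (fun i => if i = 0 then v else w) [1, d] [(0, 1)] [0, 1] 0
      ?_ ?_ ?_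
    · intro i hi j hj hij
      have hvw : v ≠ w := G.ne_of_adj hw
      simp only [List.length_cons, List.length_nil, Set.mem_Iio] at hi hj
      dsimp only at hij
      split_ifs at hij
      · omega
      · exact absurd hij hvw
      · exact absurd hij hvw.symm
      · omega
    · intro i d' hi
      match i with
      | 0 => simpa [h1] using hi
      | 1 => simpa [hd] using hi
      | i + 2 => simp at hi
    · simpa using hw
  have := hG.deg_pos w
  have := hG.deg_le w
  obtain h | h | h : deg G w = 1 ∨ deg G w = 2 ∨ deg G w = 3 := by omega
  exacts [key 1 h (by decide), key 2 h (by decide), key 3 h (by decide)]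

theorem deg_eq_two_or_three (v : V) : deg G v = 2 ∨ deg G v = 3 := by
  have := hG.two_le_deg v
  have := hG.deg_le v
  omega

theorem deg_eq_three_of_adj {u v : V} (hu : deg G u = 2) (h : G.Adj u v) : deg G v = 3 := by
  refine (hG.deg_eq_two_or_three v).resolve_left fun hv => ?_
  exact hG.no_configuration [] [u, v] rfl rfl u (by simp) (by simpa using h.ne) (by simp)
    (by simp [*])
    (by simpa using h) reducible_two_two

theorem eq_of_deg_two {x s t : V} (hx : deg G x = 3) (hs : G.Adj x s) (ht : G.Adj x t)
    (hs2 : deg G s = 2) (ht2 : deg G t = 2) : s = t := by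
  by_contra hne
  exact hG.no_configuration [x] [s, t] rfl rfl x (by simp) (by simpa using hne) (by simp [*])
    (by simp [*])
    (by simp [*]) reducible_three_two_two

theorem exists_mid {t x y : V} (hx : deg G x = 3) (ht : G.Adj x t) (ht2 : deg G t = 2)
    (hy : G.Adj x y) (hy3 : deg G y = 3) : ∃ z, Mid G t x y z := by
  obtain ⟨z, hz, hzt⟩ : ∃ z ∈ G.neighborSet x, z ∉ ({t, y} : Set V) := by
    refine Set.exists_mem_notMem_of_ncard_lt_ncard ?_ (Set.toFinite _)
    rw [← deg, hx]
    exact (Set.ncard_insert_le t {y}).trans_lt (by simp)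
  simp only [Set.mem_insert_iff, Set.mem_singleton_iff, not_or] at hzt
  refine ⟨z, hx, ht2, hy3, ?_, ht, hy, hz, Ne.symm hzt.2⟩
  refine (hG.deg_eq_two_or_three z).resolve_left fun hz2 => hzt.1 ?_
  exact hG.eq_of_deg_two hx hz ht hz2 ht2

section Chain

variable {a₀ a₁ a₂ a₃ a₄ a₅ a₆ a₇ a₈ t₁ t₂ t₃ t₄ t₅ t₆ t₇ : V}

theorem pendant_unique {t s x a b c d : V} (h : Mid G t x a b) (h' : Mid G s x c d) : t = s :=
  hG.eq_of_deg_two h.deg_x h.adj_t h'.adj_t h.deg_t h'.deg_t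

section Three

variable (h₁ : Mid G t₁ a₁ a₀ a₂) (h₂ : Mid G t₂ a₂ a₁ a₃) (h₃ : Mid G t₃ a₃ a₂ a₄)
include h₁ h₂ h₃

theorem pendant_ne_next : t₁ ≠ t₂ := by
  rintro rfl
  have h13 : t₁ ≠ t₃ := by
    rintro rfl
    rcases eq_of_deg_eq_two h₁.deg_t h₁.adj_t.symm h₂.adj_t.symm h₂.adj_a.ne' h₃.adj_t.symm
      with h | h
    · exact h₂.ne h.symm
    · exact h₃.adj_a.ne h
  exact hG.no_configuration [a₁, a₂, a₃] [t₁, t₃] rfl rfl a₁ (by simp [h₁.info, h₂.info])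
    (by simp [h13]) (by simp [h₁.info, h₂.info]) (by simp [h₁.info, h₃.info])
    (by simp [h₁.info, h₂.info, h₃.info]) reducible_shared_pendant

theorem pendant_ne_two : t₁ ≠ t₃ := by
  rintro rfl
  have h12 := hG.pendant_ne_next h₁ h₂ h₃
  exact hG.no_configuration [a₁, a₂, a₃] [t₁, t₂] rfl rfl a₁ (by simp [h₁.info, h₂.info])
    (by simp [h12]) (by simp [h₁.info, h₂.info]) (by simp [h₁.info, h₂.info])
    (by simp [h₁.info, h₂.info, h₃.info]) reducible_four_cycle

theorem not_triangle : ¬ G.Adj a₁ a₃ := by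
  intro hadj
  have h12 := hG.pendant_ne_next h₁ h₂ h₃
  have h13 := hG.pendant_ne_two h₁ h₂ h₃
  have h23 := hG.pendant_ne_next h₃.symm h₂.symm h₁.symm
  exact hG.no_configuration [a₁, a₂, a₃] [t₁, t₂, t₃] rfl rfl a₁ (by simp [h₁.info, h₂.info])
    (by simp [h12, h13, h23.symm]) (by simp [h₁.info, h₂.info])
    (by simp [h₁.info, h₂.info, h₃.info])
    (by simp [h₁.info, h₂.info, h₃.info, hadj.symm]) reducible_triangle

variable (h₄ : Mid G t₄ a₄ a₃ a₅)
include h₄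

theorem ne_three : a₁ ≠ a₄ := by
  rintro rfl
  exact hG.not_triangle h₁ h₂ h₃ h₄.adj_a

theorem pendant_eq_three : t₁ = t₄ := by
  by_contra h14
  have h12 := hG.pendant_ne_next h₁ h₂ h₃
  have h13 := hG.pendant_ne_two h₁ h₂ h₃
  have h23 := hG.pendant_ne_next h₂ h₃ h₄
  have h24 := hG.pendant_ne_two h₂ h₃ h₄
  have h34 := hG.pendant_ne_next h₄.symm h₃.symm h₂.symm
  exact hG.no_configuration [a₁, a₂, a₃, a₄] [t₁, t₂, t₃, t₄] rfl rfl a₁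
    (by simp [h₁.info, h₂.info, h₃.info, hG.ne_three h₁ h₂ h₃ h₄])
    (by simp [h12, h13, h23, h14, h24, h34.symm])
    (by simp [h₁.info, h₂.info, h₃.info])
    (by simp [h₁.info, h₂.info, h₃.info, h₄.info])
    (by simp [h₁.info, h₂.info, h₃.info, h₄.info]) reducible_path_four

variable (h₅ : Mid G t₅ a₅ a₄ a₆)
include h₅

theorem ne_four : a₁ ≠ a₅ := by
  rintro rfl
  have h45 := hG.pendant_ne_next h₅.symm h₄.symm h₃.symm
  rw [← hG.pendant_eq_three h₁ h₂ h₃ h₄] at h45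
  exact h45 (hG.pendant_unique h₅ h₁)

variable (h₆ : Mid G t₆ a₆ a₅ a₇)
include h₆

theorem ne_five : a₁ ≠ a₆ := by
  rintro rfl
  have h46 := hG.pendant_ne_two h₄ h₅ h₆
  rw [← hG.pendant_eq_three h₁ h₂ h₃ h₄] at h46
  exact h46 (hG.pendant_unique h₁ h₆)

variable (h₇ : Mid G t₇ a₇ a₆ a₈)
include h₇

theorem eq_six : a₇ = a₁ ∧ a₆ = a₀ := by
  have h14 := hG.pendant_eq_three h₁ h₂ h₃ h₄
  have h47 := hG.pendant_eq_three h₄ h₅ h₆ h₇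
  subst h14 h47
  have h71 : a₇ = a₁ := by
    refine (eq_of_deg_eq_two h₁.deg_t h₁.adj_t.symm h₄.adj_t.symm
      (hG.ne_three h₁ h₂ h₃ h₄) h₇.adj_t.symm).resolve_right fun h => ?_
    exact hG.ne_three h₄ h₅ h₆ h₇ h.symm
  subst h71
  refine ⟨rfl, (h₁.eq_of_deg_three h₇.adj_a h₆.deg_x).resolve_right fun h => ?_⟩
  exact hG.ne_four h₂ h₃ h₄ h₅ h₆ h.symm

end Three

end Chain

end MinimalUncolorable

end

section

/-- In a minimal uncolorable graph, a nonempty set of vertices that is closed under adjacency is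
everything. -/
theorem MinimalUncolorable.eq_univ_of_closed {G : SimpleGraph V} (hG : MinimalUncolorable G)
    {S : Set V} (hne : S.Nonempty) (hS : ∀ x ∈ S, ∀ y, G.Adj x y → y ∈ S) : S = Set.univ := by
  classical
  by_contra hS'
  obtain ⟨u, hu⟩ := hne
  obtain ⟨v, hv⟩ := (Set.ne_univ_iff_exists_notMem S).1 hS'
  have hnbr : ∀ x, ∃ y, G.Adj x y := fun x =>
    Set.nonempty_of_ncard_ne_zero (hG.deg_pos x).ne'
  have hS2 : ∀ x ∉ S, ∀ y, G.Adj x y → y ∉ S := fun x hx y hxy hy => hx (hS y hy x hxy.symm)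
  obtain ⟨u', huu⟩ := hnbr u
  obtain ⟨v', hvv⟩ := hnbr v
  obtain ⟨c₁, h₁⟩ := hG.delete v v' hvv
  obtain ⟨c₂, h₂⟩ := hG.delete u u' huu
  have del : ∀ {x y a b : V}, G.Adj x y → x ≠ a → x ≠ b →
      (G.deleteEdges {s(a, b)}).Adj x y := by
    intro x y a b hxy ha hb
    rw [deleteEdges_adj]
    refine ⟨hxy, ?_⟩
    simp only [Set.mem_singleton_iff, Sym2.eq_iff, not_or, not_and]
    exact ⟨fun h => absurd h ha, fun h => absurd h hb⟩
  refine hG.not_proper (fun e => if ∃ x ∈ e, x ∈ S then c₁ e else c₂ e) ?_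
  intro x y z hxy hxz heq
  by_cases hx : x ∈ S
  · have hxv : x ≠ v := fun h => hv (h ▸ hx)
    have hxv' : x ≠ v' := fun h => hS2 v hv v' hvv (h ▸ hx)
    have ey : ∃ w ∈ s(x, y), w ∈ S := ⟨x, Sym2.mem_mk_left _ _, hx⟩
    have ez : ∃ w ∈ s(x, z), w ∈ S := ⟨x, Sym2.mem_mk_left _ _, hx⟩
    simp only [if_pos ey, if_pos ez] at heq
    exact h₁ x y z (del hxy hxv hxv') (del hxz hxv hxv') heq
  · have hxu : x ≠ u := fun h => hx (h ▸ hu)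
    have hxu' : x ≠ u' := fun h => hx (h ▸ hS u hu u' huu)
    have e : ∀ w, G.Adj x w → ¬ ∃ w' ∈ s(x, w), w' ∈ S := by
      rintro w hw ⟨w', hm, hw'⟩
      rcases Sym2.mem_iff.1 hm with rfl | rfl
      · exact hx hw'
      · exact hS2 x hx _ hw hw'
    simp only [if_neg (e y hxy), if_neg (e z hxz)] at heq
    exact h₂ x y z (del hxy hxu hxu') (del hxz hxu hxu') heq

/-- The neighbors of the vertices of the Petersen graph minus a vertex: the vertices `0, …, 5` form
a six-cycle and `6`, `7` and `8` join antipodal pairs on it. -/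
def petersenNbrs : Fin 9 → List (Fin 9) :=
  ![[6, 5, 1], [7, 0, 2], [8, 1, 3], [6, 2, 4], [7, 3, 5], [8, 4, 0], [0, 3], [1, 4], [2, 5]]

def petersenVertex : Fin 9 → {s : Finset (Fin 5) // s.card = 2} :=
  ![⟨{0, 3}, rfl⟩, ⟨{1, 4}, rfl⟩, ⟨{2, 3}, rfl⟩, ⟨{0, 4}, rfl⟩, ⟨{1, 3}, rfl⟩, ⟨{2, 4}, rfl⟩,
    ⟨{1, 2}, rfl⟩, ⟨{0, 2}, rfl⟩, ⟨{0, 1}, rfl⟩]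

theorem petersenVertex_injective : Function.Injective petersenVertex := by decide

theorem petersenVertex_ne (i : Fin 9) : petersenVertex i ≠ ⟨{3, 4}, rfl⟩ := by
  revert i
  decide

theorem exists_petersenVertex {v : {s : Finset (Fin 5) // s.card = 2}} (hv : v ≠ ⟨{3, 4}, rfl⟩) :
    ∃ i, petersenVertex i = v := by
  revert v
  decide +kernel

theorem petersen_adj_petersenVertex (i j : Fin 9) :
    petersen.Adj (petersenVertex i) (petersenVertex j) ↔ j ∈ petersenNbrs i := by
  simp only [petersen, fromRel_adj]
  revert i j
  decide +kernel

theorem MinimalUncolorable.exists_iso_petersen {G : SimpleGraph V} (hG : MinimalUncolorable G)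
    (f : Fin 9 → V) (hf : Function.Injective f)
    (h : ∀ i y, G.Adj (f i) y ↔ ∃ j ∈ petersenNbrs i, f j = y) :
    ∃ v, Nonempty (G ≃g petersen.induce {w | w ≠ v}) := by
  have hsurj : Set.range f = Set.univ := by
    apply hG.eq_univ_of_closed (Set.range_nonempty f)
    rintro _ ⟨i, rfl⟩ y hy
    obtain ⟨j, -, rfl⟩ := (h i y).1 hy
    exact ⟨j, rfl⟩
  let e₁ : Fin 9 ≃ V := Equiv.ofBijective f ⟨hf, Set.range_eq_univ.1 hsurj⟩
  let e₂ : Fin 9 ≃ {w : {s : Finset (Fin 5) // s.card = 2} | w ≠ ⟨{3, 4}, rfl⟩} :=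
    Equiv.ofBijective (fun i => ⟨petersenVertex i, petersenVertex_ne i⟩) <| by
      refine ⟨fun i j hij => petersenVertex_injective (congrArg Subtype.val hij), ?_⟩
      rintro ⟨w, hw⟩
      obtain ⟨i, rfl⟩ := exists_petersenVertex hw
      exact ⟨i, rfl⟩
  refine ⟨⟨{3, 4}, rfl⟩, ⟨⟨e₁.symm.trans e₂, ?_⟩⟩⟩
  intro x y
  obtain ⟨i, rfl⟩ := e₁.surjective x
  obtain ⟨j, rfl⟩ := e₁.surjective y
  simp only [Equiv.trans_apply, Equiv.symm_apply_apply]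
  change petersen.Adj (petersenVertex i) (petersenVertex j) ↔ G.Adj (f i) (f j)
  rw [petersen_adj_petersenVertex, h]
  simp [hf.eq_iff]

variable [Finite V] {G : SimpleGraph V}

namespace Mid

variable {t x a b : V}

theorem adj_iff (h : Mid G t x a b) (y : V) : G.Adj x y ↔ t = y ∨ a = y ∨ b = y := by
  constructor
  · intro hy
    rcases h.eq_or hy with h | h | h <;> simp [h]
  · rintro (rfl | rfl | rfl)
    exacts [h.adj_t, h.adj_a, h.adj_b]

theorem adj_pendant_iff {c d x' : V} (h : Mid G t x a b) (h' : Mid G t x' c d) (hne : x ≠ x')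
    (y : V) : G.Adj t y ↔ x = y ∨ x' = y := by
  constructor
  · intro hy
    rcases eq_of_deg_eq_two h.deg_t h.adj_t.symm h'.adj_t.symm hne hy with h | h <;> simp [h]
  · rintro (rfl | rfl)
    exacts [h.adj_t.symm, h'.adj_t.symm]

end Mid

theorem MinimalUncolorable.exists_iso_petersen_of_chain (hG : MinimalUncolorable G)
    {a₀ a₁ a₂ a₃ a₄ a₅ a₆ a₇ a₈ t₁ t₂ t₃ t₄ t₅ t₆ t₇ : V}
    (h₁ : Mid G t₁ a₁ a₀ a₂) (h₂ : Mid G t₂ a₂ a₁ a₃) (h₃ : Mid G t₃ a₃ a₂ a₄)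
    (h₄ : Mid G t₄ a₄ a₃ a₅) (h₅ : Mid G t₅ a₅ a₄ a₆) (h₆ : Mid G t₆ a₆ a₅ a₇)
    (h₇ : Mid G t₇ a₇ a₆ a₈) : ∃ v, Nonempty (G ≃g petersen.induce {w | w ≠ v}) := by
  obtain ⟨rfl, rfl⟩ := hG.eq_six h₁ h₂ h₃ h₄ h₅ h₆ h₇
  obtain rfl := hG.pendant_eq_three h₁ h₂ h₃ h₄
  obtain rfl := hG.pendant_eq_three h₂ h₃ h₄ h₅
  obtain rfl := hG.pendant_eq_three h₃ h₄ h₅ h₆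
  have h14 := hG.ne_three h₁ h₂ h₃ h₄
  have h25 := hG.ne_three h₂ h₃ h₄ h₅
  have h36 := hG.ne_three h₃ h₄ h₅ h₆
  have h15 := hG.ne_four h₁ h₂ h₃ h₄ h₅
  have t12 := hG.pendant_ne_next h₁ h₂ h₃
  have t23 := hG.pendant_ne_next h₂ h₃ h₄
  have t13 := hG.pendant_ne_two h₁ h₂ h₃
  have ht : ∀ {x t : V}, deg G x = 3 → deg G t = 2 → x ≠ t := by
    rintro x t hx ht rfl
    omega
  refine hG.exists_iso_petersen ![a₇, a₂, a₃, a₄, a₅, a₆, t₁, t₂, t₃] ?_ ?_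
  · rw [← List.nodup_ofFn]
    have key : ∀ x ∈ [a₇, a₂, a₃, a₄, a₅, a₆], ∀ t ∈ [t₁, t₂, t₃], x ≠ t := by
      intro x hx t ht'
      refine ht ?_ ?_
      · revert x
        simp [h₁.info, h₂.info, h₃.info, h₄.info]
      · revert t
        simp [h₁.info, h₂.info, h₃.info]
    have := List.nodup_append.2 ⟨(?_ : [a₇, a₂, a₃, a₄, a₅, a₆].Nodup),
      (?_ : [t₁, t₂, t₃].Nodup), key⟩
    · simpa using this
    · simp [h₁.info, h₂.info, h₃.info, h₄.info, h₅.info, h14, h25, h36, h15]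
    · simp [t12, t23, t13]
  · intro i y
    fin_cases i
    · simpa [petersenNbrs] using h₁.adj_iff y
    · simpa [petersenNbrs] using h₂.adj_iff y
    · simpa [petersenNbrs] using h₃.adj_iff y
    · simpa [petersenNbrs] using h₄.adj_iff y
    · simpa [petersenNbrs] using h₅.adj_iff y
    · simpa [petersenNbrs] using h₆.adj_iff y
    · simpa [petersenNbrs] using h₁.adj_pendant_iff h₄ h14 y
    · simpa [petersenNbrs] using h₂.adj_pendant_iff h₅ h25 y
    · simpa [petersenNbrs] using h₃.adj_pendant_iff h₆ h36 y

end

section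

/-- `x` has degree three and so do all its neighbors. -/
def IsFree (G : SimpleGraph V) (x : V) : Prop :=
  deg G x = 3 ∧ ∀ y, G.Adj x y → deg G y = 3

/-- `x` has degree three and has a neighbor of degree two. -/
def HasPendant (G : SimpleGraph V) (x : V) : Prop :=
  deg G x = 3 ∧ ∃ t, G.Adj x t ∧ deg G t = 2

variable {G : SimpleGraph V}

theorem IsFree.ne_of_hasPendant {p x : V} (hp : IsFree G p) (hx : HasPendant G x) : p ≠ x := by
  rintro rfl
  obtain ⟨-, t, ht, ht2⟩ := hx
  have := hp.2 t ht
  omega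

theorem Mid.hasPendant {t x a b : V} (h : Mid G t x a b) : HasPendant G x :=
  ⟨h.deg_x, t, h.adj_t, h.deg_t⟩

theorem IsFree.ne {p t x a b : V} (hp : IsFree G p) (h : Mid G t x a b) : p ≠ x :=
  hp.ne_of_hasPendant h.hasPendant

variable [Finite V]

namespace MinimalUncolorable

variable (hG : MinimalUncolorable G)
include hG

theorem isFree_or_hasPendant {x : V} (hx : deg G x = 3) : IsFree G x ∨ HasPendant G x := by
  by_cases h : ∃ t, G.Adj x t ∧ deg G t = 2
  · exact Or.inr ⟨hx, h⟩
  · push Not at h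
    exact Or.inl ⟨hx, fun y hy => (hG.deg_eq_two_or_three y).resolve_left (h y hy)⟩

section Fork

variable {p x₁ x₂ x₃ x₄ x₅ a c e f t₁ t₂ t₃ t₄ s₁ s₂ s₃ : V}
  (hp : IsFree G p) (h₁ : Mid G t₁ x₁ p x₂) (h₂ : Mid G t₂ x₂ x₁ x₃) (h₃ : Mid G t₃ x₃ x₂ x₄)
  (h₄ : Mid G t₄ x₄ x₃ x₅) (k₁ : Mid G s₁ a p c) (k₂ : Mid G s₂ c a e) (k₃ : Mid G s₃ e c f)
include hp h₁ h₂ h₃ h₄ k₁ k₂ k₃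

theorem fork_not_disjoint (hd : ∀ x ∈ [x₁, x₂, x₃, x₄], ∀ y ∈ [a, c, e], x ≠ y) : False := by
  obtain rfl := hG.pendant_eq_three h₁ h₂ h₃ h₄
  have hx14 := hG.ne_three h₁ h₂ h₃ h₄
  have t12 := hG.pendant_ne_next h₁ h₂ h₃
  have t13 := hG.pendant_ne_two h₁ h₂ h₃
  have t23 := hG.pendant_ne_next h₂ h₃ h₄
  have s12 := hG.pendant_ne_next k₁ k₂ k₃
  have s13 := hG.pendant_ne_two k₁ k₂ k₃
  have s23 := hG.pendant_ne_next k₃.symm k₂.symm k₁.symm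
  have hs : ∀ {s y u v : V}, y ∈ [a, c, e] → Mid G s y u v → t₁ ≠ s := by
    rintro s y u v hy h rfl
    rcases eq_of_deg_eq_two h₁.deg_t h₁.adj_t.symm h₄.adj_t.symm hx14 h.adj_t.symm with rfl | rfl
    · exact hd y (by simp) y hy rfl
    · exact hd y (by simp) y hy rfl
  have r1 := hs (by simp) k₁
  have r2 := hs (by simp) k₂
  have r3 := hs (by simp) k₃
  have hx : [x₁, x₂, x₃, x₄, p, a, c, e].Nodup := by
    have hd' := hd
    simp only [List.mem_cons, List.not_mem_nil, or_false, forall_eq_or_imp, forall_eq] at hd'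
    simp [hd', h₁.info, h₂.info, h₃.info, k₁.info, k₂.info, hx14, (hp.ne h₃).symm,
       (hp.ne h₄).symm, hp.ne k₃]
  have hx3 : ∀ x ∈ [x₁, x₂, x₃, x₄, p, a, c, e], deg G x = 3 := by
    simp [h₁.info, h₂.info, h₃.info, k₁.info, k₂.info]
  by_cases h31 : t₃ = s₁
  · subst h31
    by_cases h22 : t₂ = s₂
    · subst h22
      exact hG.no_configuration _ [t₁, t₂, t₃] rfl rfl p hx (by simp [*]) hx3
        (by simp [h₁.info, h₂.info, h₃.info])
        (by simp [h₁.info, h₂.info, h₃.info, h₄.info, k₁.info, k₂.info])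
        reducible_fork_two_c_three_a
    · exact hG.no_configuration _ [t₁, t₂, t₃, s₂] rfl rfl p hx (by simp [*]) hx3
        (by simp [h₁.info, h₂.info, h₃.info, k₂.info])
        (by simp [h₁.info, h₂.info, h₃.info, h₄.info, k₁.info, k₂.info]) reducible_fork_three_a
  by_cases h32 : t₃ = s₂
  · subst h32
    by_cases h21 : t₂ = s₁
    · subst h21
      exact hG.no_configuration _ [t₁, t₂, t₃] rfl rfl p hx (by simp [*]) hx3
        (by simp [h₁.info, h₂.info, h₃.info])
        (by simp [h₁.info, h₂.info, h₃.info, h₄.info, k₁.info, k₂.info])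
        reducible_fork_two_a_three_c
    · exact hG.no_configuration _ [t₁, t₂, t₃, s₁] rfl rfl p hx (by simp [*]) hx3
        (by simp [h₁.info, h₂.info, h₃.info, k₁.info])
        (by simp [h₁.info, h₂.info, h₃.info, h₄.info, k₁.info, k₂.info]) reducible_fork_three_c
  by_cases h21 : t₂ = s₁
  · subst h21
    exact hG.no_configuration _ [t₁, t₂, t₃, s₂] rfl rfl p hx (by simp [*]) hx3
      (by simp [h₁.info, h₂.info, h₃.info, k₂.info])
      (by simp [h₁.info, h₂.info, h₃.info, h₄.info, k₁.info, k₂.info]) reducible_fork_two_a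
  by_cases h22 : t₂ = s₂
  · subst h22
    exact hG.no_configuration _ [t₁, t₂, t₃, s₁] rfl rfl p hx (by simp [*]) hx3
      (by simp [h₁.info, h₂.info, h₃.info, k₁.info])
      (by simp [h₁.info, h₂.info, h₃.info, h₄.info, k₁.info, k₂.info]) reducible_fork_two_c
  by_cases h33 : t₃ = s₃
  · subst h33
    exact hG.no_configuration _ [t₁, t₂, t₃, s₁, s₂] rfl rfl p hx (by simp [*]) hx3
      (by simp [h₁.info, h₂.info, h₃.info, k₁.info, k₂.info])
      (by simp [h₁.info, h₂.info, h₃.info, h₄.info, k₁.info, k₂.info, k₃.info])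
      reducible_fork_three_e
  by_cases h23 : t₂ = s₃
  · subst h23
    exact hG.no_configuration _ [t₁, t₂, t₃, s₁, s₂] rfl rfl p hx (by simp [*]) hx3
      (by simp [h₁.info, h₂.info, h₃.info, k₁.info, k₂.info])
      (by simp [h₁.info, h₂.info, h₃.info, h₄.info, k₁.info, k₂.info, k₃.info]) reducible_fork_two_e
  exact hG.no_configuration _ [t₁, t₂, t₃, s₁, s₂, s₃] rfl rfl p hx (by simp [*, s23.symm]) hx3
    (by simp [h₁.info, h₂.info, h₃.info, k₁.info, k₂.info, k₃.info])
    (by simp [h₁.info, h₂.info, h₃.info, h₄.info, k₁.info, k₂.info, k₃.info]) reducible_fork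

theorem fork_closes (hne : x₁ ≠ a) : a = x₄ ∧ x₅ = p ∨ a = x₅ ∧ c = x₄ ∨ c = x₅ ∧ e = x₄ := by
  have key : ¬ ∀ x ∈ [x₁, x₂, x₃, x₄], ∀ y ∈ [a, c, e], x ≠ y :=
    hG.fork_not_disjoint hp h₁ h₂ h₃ h₄ k₁ k₂ k₃
  have ha2 : a ≠ x₂ := by
    rintro rfl
    exact (h₂.eq_of_deg_three k₁.adj_a hp.1).elim (hp.ne h₁) (hp.ne h₃)
  have ha3 : a ≠ x₃ := by
    rintro rfl
    exact (h₃.eq_of_deg_three k₁.adj_a hp.1).elim (hp.ne h₂) (hp.ne h₄)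
  have ha4 : a = x₄ → x₅ = p := by
    rintro rfl
    exact ((h₄.eq_of_deg_three k₁.adj_a hp.1).resolve_left (hp.ne h₃)).symm
  have hc1 : c ≠ x₁ := by
    rintro rfl
    exact (h₁.eq_of_deg_three k₂.adj_a k₁.deg_x).elim (fun h => hp.ne k₁ h.symm) ha2
  have hc2 : c ≠ x₂ := by
    rintro rfl
    exact (h₂.eq_of_deg_three k₂.adj_a k₁.deg_x).elim (fun h => hne h.symm) ha3
  have hc3 : c = x₃ → a = x₄ := by
    rintro rfl
    exact (h₃.eq_of_deg_three k₂.adj_a k₁.deg_x).resolve_left ha2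
  have hc4 : c = x₄ → a = x₅ := by
    rintro rfl
    exact (h₄.eq_of_deg_three k₂.adj_a k₁.deg_x).resolve_left ha3
  have he1 : e ≠ x₁ := by
    rintro rfl
    exact (h₁.eq_of_deg_three k₃.adj_a k₂.deg_x).elim (fun h => hp.ne k₂ h.symm) hc2
  have he2 : e = x₂ → c = x₃ := by
    rintro rfl
    exact (h₂.eq_of_deg_three k₃.adj_a k₂.deg_x).resolve_left hc1
  have he3 : e = x₃ → c = x₄ := by
    rintro rfl
    exact (h₃.eq_of_deg_three k₃.adj_a k₂.deg_x).resolve_left hc2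
  have he4 : e = x₄ → c = x₃ ∨ c = x₅ := by
    rintro rfl
    exact h₄.eq_of_deg_three k₃.adj_a k₂.deg_x
  simp only [List.mem_cons, List.not_mem_nil, or_false, forall_eq_or_imp, forall_eq] at key
  grind

end Fork

section Theta

variable {p x₁ x₂ x₃ x₄ x₅ x₆ a z t₁ t₂ t₃ t₄ t₅ t₆ s : V}

theorem no_theta_five (hp : IsFree G p) (h₁ : Mid G t₁ x₁ p x₂) (h₂ : Mid G t₂ x₂ x₁ x₃)
    (h₃ : Mid G t₃ x₃ x₂ x₄) (h₄ : Mid G t₄ x₄ x₃ x₅) (h₅ : Mid G t₅ x₅ x₄ p)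
    (k : Mid G s a p z) (ha1 : a ≠ x₁) (ha5 : a ≠ x₅) : False := by
  obtain rfl := hG.pendant_eq_three h₁ h₂ h₃ h₄
  obtain rfl := hG.pendant_eq_three h₂ h₃ h₄ h₅
  have hx14 := hG.ne_three h₁ h₂ h₃ h₄
  have hx25 := hG.ne_three h₂ h₃ h₄ h₅
  have hx15 := hG.ne_four h₁ h₂ h₃ h₄ h₅
  have t12 := hG.pendant_ne_next h₁ h₂ h₃
  have t13 := hG.pendant_ne_two h₁ h₂ h₃
  have t23 := hG.pendant_ne_next h₂ h₃ h₄
  have ha2 : a ≠ x₂ := by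
    rintro rfl
    exact (h₂.eq_of_deg_three k.adj_a hp.1).elim (hp.ne h₁) (hp.ne h₃)
  have ha3 : a ≠ x₃ := by
    rintro rfl
    exact (h₃.eq_of_deg_three k.adj_a hp.1).elim (hp.ne h₂) (hp.ne h₄)
  have ha4 : a ≠ x₄ := by
    rintro rfl
    exact (h₄.eq_of_deg_three k.adj_a hp.1).elim (hp.ne h₃) (hp.ne h₅)
  have s1 : t₁ ≠ s := by
    rintro rfl
    exact (eq_of_deg_eq_two h₁.deg_t h₁.adj_t.symm h₄.adj_t.symm hx14 k.adj_t.symm).elim ha1 ha4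
  have s2 : t₂ ≠ s := by
    rintro rfl
    exact (eq_of_deg_eq_two h₂.deg_t h₂.adj_t.symm h₅.adj_t.symm hx25 k.adj_t.symm).elim ha2 ha5
  have hx : [x₁, x₂, x₃, x₄, x₅, p, a].Nodup := by
    simp [h₁.info, h₂.info, h₃.info, h₄.info, h₅.info, k.info, hx14, hx25, hx15,
      (hp.ne h₃).symm, ha1.symm, ha2.symm, ha3.symm, ha4.symm, ha5.symm]
  have hx3 : ∀ x ∈ [x₁, x₂, x₃, x₄, x₅, p, a], deg G x = 3 := by
    simp [h₁.info, h₂.info, h₃.info, h₄.info, k.info]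
  by_cases hs : t₃ = s
  · subst hs
    exact hG.no_configuration _ [t₁, t₂, t₃] rfl rfl p hx (by simp [*]) hx3
      (by simp [h₁.info, h₂.info, h₃.info])
      (by simp [h₁.info, h₂.info, h₃.info, h₄.info, h₅.info, k.info]) reducible_theta_five_shared
  · exact hG.no_configuration _ [t₁, t₂, t₃, s] rfl rfl p hx (by simp [*]) hx3
      (by simp [h₁.info, h₂.info, h₃.info, k.info])
      (by simp [h₁.info, h₂.info, h₃.info, h₄.info, h₅.info, k.info]) reducible_theta_five

theorem no_theta_six (hp : IsFree G p) (h₁ : Mid G t₁ x₁ p x₂) (h₂ : Mid G t₂ x₂ x₁ x₃)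
    (h₃ : Mid G t₃ x₃ x₂ x₄) (h₄ : Mid G t₄ x₄ x₃ x₅) (h₅ : Mid G t₅ x₅ x₄ x₆)
    (h₆ : Mid G t₆ x₆ x₅ p) : False := by
  obtain rfl := hG.pendant_eq_three h₁ h₂ h₃ h₄
  obtain rfl := hG.pendant_eq_three h₂ h₃ h₄ h₅
  obtain rfl := hG.pendant_eq_three h₃ h₄ h₅ h₆
  have hx : [x₁, x₂, x₃, x₄, x₅, x₆, p].Nodup := by
    simp [h₁.info, h₂.info, h₃.info, h₄.info, h₅.info, h₆.info, hG.ne_three h₁ h₂ h₃ h₄,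
      hG.ne_three h₂ h₃ h₄ h₅, hG.ne_three h₃ h₄ h₅ h₆, hG.ne_four h₁ h₂ h₃ h₄ h₅,
      hG.ne_four h₂ h₃ h₄ h₅ h₆, hG.ne_five h₁ h₂ h₃ h₄ h₅ h₆,
      (hp.ne h₃).symm, (hp.ne h₄).symm]
  exact hG.no_configuration _ [t₁, t₂, t₃] rfl rfl p hx
    (by simp [hG.pendant_ne_next h₁ h₂ h₃, hG.pendant_ne_two h₁ h₂ h₃,
      hG.pendant_ne_next h₂ h₃ h₄])
    (by simp [h₁.info, h₂.info, h₃.info, h₄.info, h₅.info])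
    (by simp [h₁.info, h₂.info, h₃.info])
    (by simp [h₁.info, h₂.info, h₃.info, h₄.info, h₅.info, h₆.info]) reducible_theta_six

end Theta

end MinimalUncolorable

end

section

open Classical in
/-- The vertex `z` such that the neighbors of `x` are a vertex of degree two, `y` and `z`. -/
noncomputable def other (G : SimpleGraph V) (x y : V) : V :=
  if h : ∃ z t, Mid G t x y z then h.choose else x

/-- The walk starting with `p` and `y` that avoids the vertices of degree two and does not turn
back. -/
noncomputable def ahead (G : SimpleGraph V) (p y : V) : ℕ → V
  | 0 => p
  | 1 => y
  | k + 2 => other G (ahead G p y (k + 1)) (ahead G p y k)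

/-- The vertices numbered `1, …, m + 1` on the walk starting with `p` and `y` all have a neighbor of
degree two. -/
def Runs (G : SimpleGraph V) (p y : V) (m : ℕ) : Prop :=
  ∀ i ≤ m, HasPendant G (ahead G p y (i + 1))

variable {G : SimpleGraph V}

theorem Runs.of_le {p y : V} {m n : ℕ} (h : Runs G p y n) (hmn : m ≤ n) : Runs G p y m :=
  fun i hi => h i (hi.trans hmn)

theorem Runs.succ {p y : V} {m : ℕ} (h : Runs G p y m)
    (h' : HasPendant G (ahead G p y (m + 2))) : Runs G p y (m + 1) := by
  intro i hi
  rcases Nat.le_succ_iff.1 hi with hi | rfl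
  · exact h i hi
  · exact h'

variable [Finite V]

theorem Mid.unique {t s x a b c : V} (h : Mid G t x a b) (h' : Mid G s x a c) : b = c :=
  (h'.eq_of_deg_three h.adj_b h.deg_b).resolve_left h.ne.symm

theorem Mid.other_eq {t x a b : V} (h : Mid G t x a b) : other G x a = b := by
  have h' : ∃ z t, Mid G t x a z := ⟨b, t, h⟩
  rw [other, dif_pos h']
  obtain ⟨s, hs⟩ := h'.choose_spec
  exact hs.unique h

namespace MinimalUncolorable

variable (hG : MinimalUncolorable G) {p y y₁ y₂ y₃ : V} {m : ℕ}
include hG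

theorem mid_other {x y : V} (hx : HasPendant G x) (hxy : G.Adj x y) (hy : deg G y = 3) :
    ∃ t, Mid G t x y (other G x y) := by
  obtain ⟨hx3, t, ht, ht2⟩ := hx
  obtain ⟨z, hz⟩ := hG.exists_mid hx3 ht ht2 hxy hy
  rw [hz.other_eq]
  exact ⟨t, hz⟩

theorem mid_ahead (hp : deg G p = 3) (hpy : G.Adj p y) (h : Runs G p y m) {i : ℕ} (hi : i ≤ m) :
    ∃ t, Mid G t (ahead G p y (i + 1)) (ahead G p y i) (ahead G p y (i + 2)) := by
  induction i with
  | zero => exact hG.mid_other (h 0 hi) hpy.symm hp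
  | succ i ih =>
    obtain ⟨t, ht⟩ := ih (by omega)
    exact hG.mid_other (h _ hi) ht.adj_b.symm ht.deg_x

theorem not_runs_six (hP : ¬ ∃ v, Nonempty (G ≃g petersen.induce {w | w ≠ v})) (hp : deg G p = 3)
    (hpy : G.Adj p y) : ¬ Runs G p y 6 := by
  intro h
  obtain ⟨t₁, h₁⟩ := hG.mid_ahead hp hpy h (i := 0) (by omega)
  obtain ⟨t₂, h₂⟩ := hG.mid_ahead hp hpy h (i := 1) (by omega)
  obtain ⟨t₃, h₃⟩ := hG.mid_ahead hp hpy h (i := 2) (by omega)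
  obtain ⟨t₄, h₄⟩ := hG.mid_ahead hp hpy h (i := 3) (by omega)
  obtain ⟨t₅, h₅⟩ := hG.mid_ahead hp hpy h (i := 4) (by omega)
  obtain ⟨t₆, h₆⟩ := hG.mid_ahead hp hpy h (i := 5) (by omega)
  obtain ⟨t₇, h₇⟩ := hG.mid_ahead hp hpy h (i := 6) (by omega)
  exact hP (hG.exists_iso_petersen_of_chain h₁ h₂ h₃ h₄ h₅ h₆ h₇)

theorem ahead_returns (hp : IsFree G p) (hp₁ : G.Adj p y₁) (hp₂ : G.Adj p y₂) (hne : y₁ ≠ y₂)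
    (r₁ : Runs G p y₁ 3) (r₂ : Runs G p y₂ 2) :
    ∃ k, k ∈ [4, 5, 6] ∧ ahead G p y₁ k = y₂ ∧ ahead G p y₁ (k + 1) = p ∧
      Runs G p y₁ (k - 1) := by
  obtain ⟨t₁, h₁⟩ := hG.mid_ahead hp.1 hp₁ r₁ (i := 0) (by omega)
  obtain ⟨t₂, h₂⟩ := hG.mid_ahead hp.1 hp₁ r₁ (i := 1) (by omega)
  obtain ⟨t₃, h₃⟩ := hG.mid_ahead hp.1 hp₁ r₁ (i := 2) (by omega)
  obtain ⟨t₄, h₄⟩ := hG.mid_ahead hp.1 hp₁ r₁ (i := 3) (by omega)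
  obtain ⟨s₁, k₁⟩ := hG.mid_ahead hp.1 hp₂ r₂ (i := 0) (by omega)
  obtain ⟨s₂, k₂⟩ := hG.mid_ahead hp.1 hp₂ r₂ (i := 1) (by omega)
  obtain ⟨s₃, k₃⟩ := hG.mid_ahead hp.1 hp₂ r₂ (i := 2) (by omega)
  rcases hG.fork_closes hp h₁ h₂ h₃ h₄ k₁ k₂ k₃ hne with ⟨h, h'⟩ | ⟨h, h'⟩ | ⟨h, h'⟩
  · exact ⟨4, by simp, h.symm, h', r₁⟩
  · have r : Runs G p y₁ 4 := r₁.succ (h ▸ k₁.hasPendant)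
    obtain ⟨t₅, h₅⟩ := hG.mid_ahead hp.1 hp₁ r (i := 4) (by omega)
    rw [h, h'] at k₁
    exact ⟨5, by simp, h.symm, h₅.unique k₁.symm, r⟩
  · have r : Runs G p y₁ 4 := r₁.succ (h ▸ k₂.hasPendant)
    obtain ⟨t₅, h₅⟩ := hG.mid_ahead hp.1 hp₁ r (i := 4) (by omega)
    rw [h, h'] at k₂
    have h6 := h₅.unique k₂.symm
    have r' : Runs G p y₁ 5 := r.succ (h6 ▸ k₁.hasPendant)
    obtain ⟨t₆, h₆⟩ := hG.mid_ahead hp.1 hp₁ r' (i := 5) (by omega)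
    rw [h, ← h6] at k₁
    exact ⟨6, by simp, h6, h₆.unique k₁.symm, r'⟩

theorem runs_bounds (hp : IsFree G p) (hp₁ : G.Adj p y₁) (hp₂ : G.Adj p y₂) (hp₃ : G.Adj p y₃)
    (h12 : y₁ ≠ y₂) (h13 : y₁ ≠ y₃) (h23 : y₂ ≠ y₃) (r₁ : Runs G p y₁ 3) (r₂ : Runs G p y₂ 2) :
    ¬ Runs G p y₃ 2 ∧ ¬ Runs G p y₁ 5 ∧ ¬ (Runs G p y₁ 4 ∧ Runs G p y₃ 0) := by
  obtain ⟨k, hk, hk2, hkp, hr⟩ := hG.ahead_returns hp hp₁ hp₂ h12 r₁ r₂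
  have absurd_of_ahead_eq : ∀ {j n}, ahead G p y₁ (j + 1) = p → j ≤ n → ¬ Runs G p y₁ n :=
      fun hj hn h =>
    hp.ne_of_hasPendant (h _ hn) hj.symm
  have hk' : k = 4 ∨ k = 5 ∨ k = 6 := by simpa using hk
  have six : ¬ Runs G p y₁ 5 := by
    intro r
    by_cases hk6 : k = 6
    · subst hk6
      obtain ⟨t₁, h₁⟩ := hG.mid_ahead hp.1 hp₁ r (i := 0) (by omega)
      obtain ⟨t₂, h₂⟩ := hG.mid_ahead hp.1 hp₁ r (i := 1) (by omega)
      obtain ⟨t₃, h₃⟩ := hG.mid_ahead hp.1 hp₁ r (i := 2) (by omega)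
      obtain ⟨t₄, h₄⟩ := hG.mid_ahead hp.1 hp₁ r (i := 3) (by omega)
      obtain ⟨t₅, h₅⟩ := hG.mid_ahead hp.1 hp₁ r (i := 4) (by omega)
      obtain ⟨t₆, h₆⟩ := hG.mid_ahead hp.1 hp₁ r (i := 5) (by omega)
      rw [hkp] at h₆
      exact hG.no_theta_six hp h₁ h₂ h₃ h₄ h₅ h₆
    · exact absurd_of_ahead_eq hkp (by omega) r
  refine ⟨fun r₃ => ?_, six, fun ⟨r, r₃⟩ => ?_⟩
  · obtain ⟨l, hl, hl3, hlp, hr'⟩ := hG.ahead_returns hp hp₁ hp₃ h13 r₁ r₃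
    have hl' : l = 4 ∨ l = 5 ∨ l = 6 := by simpa using hl
    rcases lt_trichotomy k l with h | rfl | h
    · exact absurd_of_ahead_eq hkp (by omega) hr'
    · exact h23 (hk2.symm.trans hl3)
    · exact absurd_of_ahead_eq hlp (by omega) hr
  · obtain rfl | rfl | rfl := hk'
    · exact absurd_of_ahead_eq hkp (by omega) r
    · obtain ⟨t₁, h₁⟩ := hG.mid_ahead hp.1 hp₁ r (i := 0) (by omega)
      obtain ⟨t₂, h₂⟩ := hG.mid_ahead hp.1 hp₁ r (i := 1) (by omega)
      obtain ⟨t₃, h₃⟩ := hG.mid_ahead hp.1 hp₁ r (i := 2) (by omega)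
      obtain ⟨t₄, h₄⟩ := hG.mid_ahead hp.1 hp₁ r (i := 3) (by omega)
      obtain ⟨t₅, h₅⟩ := hG.mid_ahead hp.1 hp₁ r (i := 4) (by omega)
      obtain ⟨s, h⟩ := hG.mid_ahead hp.1 hp₃ r₃ (i := 0) (by omega)
      rw [hkp] at h₅
      exact hG.no_theta_five hp h₁ h₂ h₃ h₄ h₅ h h13.symm fun h => h23 (hk2.symm.trans h.symm)
    · exact six hr

/-- Every vertex with a neighbor of degree two is reached, along either of its other two edges, from
a free vertex. -/
theorem exists_runs (hP : ¬ ∃ v, Nonempty (G ≃g petersen.induce {w | w ≠ v})) {x z : V}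
    (hx : HasPendant G x) (hxz : G.Adj x z) (hz : deg G z = 3) :
    ∃ p y k, IsFree G p ∧ G.Adj p y ∧ k < 6 ∧ Runs G p y k ∧ ahead G p y (k + 1) = x ∧
      ahead G p y k = z := by
  obtain ⟨t, ht⟩ := hG.mid_other hx hxz hz
  set w := other G x z
  have hwx : G.Adj w x := ht.adj_b.symm
  have h2 : ahead G w x 2 = z := ht.symm.other_eq
  have hex : ∃ j, ¬ HasPendant G (ahead G w x (j + 1)) := by
    by_contra! h
    exact hG.not_runs_six hP ht.deg_b hwx fun i _ => h i
  classical
  obtain ⟨j, hj⟩ : ∃ j, Nat.find hex = j + 1 := by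
    refine Nat.exists_eq_succ_of_ne_zero fun h => ?_
    have := Nat.find_spec hex
    rw [h] at this
    exact this hx
  have hend : ¬ HasPendant G (ahead G w x (j + 2)) := by
    have := Nat.find_spec hex
    rwa [hj] at this
  have hr : Runs G w x j := fun i hi => by
    have := Nat.find_min hex (m := i) (by omega)
    exact not_not.1 this
  have hj6 : j < 6 := by
    by_contra! h
    exact hG.not_runs_six hP ht.deg_b hwx (hr.of_le h)
  obtain ⟨s, hs⟩ := hG.mid_ahead ht.deg_b hwx hr le_rfl
  have hrev : ∀ i, i ≤ j + 1 →
      ahead G (ahead G w x (j + 2)) (ahead G w x (j + 1)) i = ahead G w x (j + 2 - i) ∧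
      ahead G (ahead G w x (j + 2)) (ahead G w x (j + 1)) (i + 1) = ahead G w x (j + 1 - i) := by
    intro i hi
    induction i with
    | zero => exact ⟨rfl, rfl⟩
    | succ i ih =>
      obtain ⟨h1, h2⟩ := ih (by omega)
      refine ⟨by rw [h2]; congr 1; omega, ?_⟩
      obtain ⟨s, hs⟩ := hG.mid_ahead ht.deg_b hwx hr (i := j - i) (by omega)
      rw [ahead, h1, h2, show j + 1 - i = j - i + 1 by omega, show j + 2 - i = j - i + 2 by omega,
        hs.symm.other_eq]
      congr 1
      omega
  refine ⟨ahead G w x (j + 2), ahead G w x (j + 1), j, ?_, hs.adj_b.symm, hj6, ?_, ?_, ?_⟩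
  · exact (hG.isFree_or_hasPendant hs.deg_b).resolve_right hend
  · intro i hi
    rw [(hrev i (by omega)).2, show j + 1 - i = j - i + 1 by omega]
    exact hr _ (by omega)
  · rw [(hrev j (by omega)).2]
    simp [ahead]
  · rw [(hrev j (by omega)).1]
    simpa using h2

end MinimalUncolorable

end

section

variable {G : SimpleGraph V}

theorem sum_deg [Fintype V] : ∑ v, deg G v = 2 * G.edgeSet.ncard := by
  classical
  rw [← coe_edgeFinset, Set.ncard_coe_finset, ← sum_degrees_eq_twice_card_edges]
  refine Finset.sum_congr rfl fun v _ => ?_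
  rw [deg, ← Nat.card_coe_set_eq, Nat.card_eq_fintype_card, card_neighborSet_eq_degree]

open Classical in
theorem card_runs_le {p y : V} {m : ℕ} (h : ¬ Runs G p y m) :
    ((Finset.range 6).filter (Runs G p y)).card ≤ m := by
  calc _ ≤ (Finset.range m).card := Finset.card_le_card fun k hk => by
        rw [Finset.mem_range]
        by_contra! hmk
        exact h ((Finset.mem_filter.1 hk).2.of_le hmk)
    _ = m := Finset.card_range m

namespace MinimalUncolorable

variable [Fintype V] (hG : MinimalUncolorable G)
include hG

open Classical in
theorem card_filter_runs_le {p : V} (hp : IsFree G p) :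
    ((Finset.univ ×ˢ Finset.range 6).filter
      fun q : V × ℕ => G.Adj p q.1 ∧ Runs G p q.1 q.2).card ≤ 11 := by
  obtain ⟨y₁, y₂, y₃, h12, h13, h23, hN⟩ := Set.ncard_eq_three.1 hp.1
  have hadj : ∀ y, G.Adj p y ↔ y = y₁ ∨ y = y₂ ∨ y = y₃ := fun y => by
    rw [← mem_neighborSet, hN]
    simp
  have h1 := (hadj y₁).2 (by simp)
  have h2 := (hadj y₂).2 (by simp)
  have h3 := (hadj y₃).2 (by simp)
  set r : V → Finset ℕ := fun y => (Finset.range 6).filter (Runs G p y) with hr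
  have hle : ((Finset.univ ×ˢ Finset.range 6).filter
      fun q : V × ℕ => G.Adj p q.1 ∧ Runs G p q.1 q.2).card ≤
      (r y₁).card + (r y₂).card + (r y₃).card := by
    calc _ ≤ ({y₁} ×ˢ r y₁ ∪ {y₂} ×ˢ r y₂ ∪ {y₃} ×ˢ r y₃).card := by
          refine Finset.card_le_card ?_
          rintro ⟨y, k⟩ hq
          simp only [Finset.mem_filter, Finset.mem_product, Finset.mem_univ, true_and, hadj] at hq
          obtain ⟨hk, rfl | rfl | rfl, hR⟩ := hq <;>
            simp [hr, hR, Finset.mem_range.1 hk]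
      _ ≤ _ := (Finset.card_union_le _ _).trans (Nat.add_le_add_right (Finset.card_union_le _ _) _)
      _ = _ := by simp
  have hb : ∀ y m, Runs G p y m ∨ (r y).card ≤ m := fun y m =>
    or_iff_not_imp_left.2 card_runs_le
  have h6 : ∀ y, (r y).card ≤ 6 := fun y =>
    (Finset.card_filter_le _ _).trans (Finset.card_range 6).le
  have key : ∀ {a b c}, G.Adj p a → G.Adj p b → G.Adj p c → a ≠ b → a ≠ c → b ≠ c →
      (r a).card ≤ 3 ∨ (r b).card ≤ 2 ∨ (r c).card ≤ 2 ∧ (r a).card ≤ 5 ∧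
        ((r a).card ≤ 4 ∨ (r c).card ≤ 0) := by
    intro a b c ha hb' hc hab hac hbc
    rcases hb a 3 with ra | h
    · rcases hb b 2 with rb | h
      · obtain ⟨k1, k2, k3⟩ := hG.runs_bounds hp ha hb' hc hab hac hbc ra rb
        refine Or.inr (Or.inr ⟨card_runs_le k1, card_runs_le k2, ?_⟩)
        rcases not_and_or.1 k3 with k | k
        · exact Or.inl (card_runs_le k)
        · exact Or.inr (card_runs_le k)
      · exact Or.inr (Or.inl h)
    · exact Or.inl h
  have := h6 y₁
  have := h6 y₂
  have := h6 y₃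
  have := key h1 h2 h3 h12 h13 h23
  have := key h1 h3 h2 h13 h12 h23.symm
  have := key h2 h1 h3 h12.symm h23 h13
  have := key h2 h3 h1 h23 h12.symm h13.symm
  have := key h3 h1 h2 h13.symm h23.symm h12
  have := key h3 h2 h1 h23.symm h13.symm h12.symm
  omega

open Classical in
theorem two_mul_card_hasPendant_le
    (hP : ¬ ∃ v, Nonempty (G ≃g petersen.induce {w | w ≠ v})) :
    2 * (Finset.univ.filter (HasPendant G)).card ≤
      11 * (Finset.univ.filter (IsFree G)).card := by
  set T : V → Finset (V × ℕ) := fun p => (Finset.univ ×ˢ Finset.range 6).filter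
      fun q : V × ℕ => G.Adj p q.1 ∧ Runs G p q.1 q.2 with hT
  set D : Finset (Σ _ : V, V) := (Finset.univ.filter (HasPendant G)).sigma
    fun x => Finset.univ.filter fun z => G.Adj x z ∧ deg G z = 3 with hD
  have hlow : 2 * (Finset.univ.filter (HasPendant G)).card ≤ D.card := by
    rw [hD, Finset.card_sigma, mul_comm, ← smul_eq_mul]
    refine Finset.card_nsmul_le_sum _ _ _ fun x hx => ?_
    obtain ⟨hx3, t, ht, ht2⟩ := (Finset.mem_filter.1 hx).2
    obtain ⟨y, hy, hyt⟩ := Set.exists_ne_of_one_lt_ncard (s := G.neighborSet x)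
      (by rw [← deg, hx3]; omega) t
    have hy3 : deg G y = 3 := (hG.deg_eq_two_or_three y).resolve_left fun h =>
      hyt (hG.eq_of_deg_two hx3 hy ht h ht2)
    obtain ⟨z, hz⟩ := hG.exists_mid hx3 ht ht2 hy hy3
    rw [← Finset.card_pair hz.ne]
    refine Finset.card_le_card ?_
    intro w hw
    rcases Finset.mem_insert.1 hw with rfl | hw
    · simp [hz.info]
    · rw [Finset.mem_singleton.1 hw]
      simp [hz.info]
  have hup : D ⊆ (Finset.univ.filter (IsFree G)).biUnion fun p =>
      (T p).image fun q => ⟨ahead G p q.1 (q.2 + 1), ahead G p q.1 q.2⟩ := by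
    rintro ⟨x, z⟩ hxz
    simp only [hD, Finset.mem_sigma, Finset.mem_filter, Finset.mem_univ, true_and] at hxz
    obtain ⟨hx, hadj, hz⟩ := hxz
    obtain ⟨p, y, k, hp, hpy, hk, hr, rfl, rfl⟩ := hG.exists_runs hP hx hadj hz
    simp only [Finset.mem_biUnion, Finset.mem_filter, Finset.mem_univ, true_and, Finset.mem_image]
    refine ⟨p, hp, (y, k), ?_, rfl⟩
    simp [hT, hk, hpy, hr]
  calc _ ≤ D.card := hlow
    _ ≤ _ := Finset.card_le_card hup
    _ ≤ (Finset.univ.filter (IsFree G)).card * 11 := Finset.card_biUnion_le_card_mul _ _ _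
        fun p hp => Finset.card_image_le.trans
          (hG.card_filter_runs_le (Finset.mem_filter.1 hp).2)
    _ = _ := mul_comm _ _

open Classical in
theorem two_mul_card_deg_two_le :
    2 * (Finset.univ.filter fun v => deg G v = 2).card ≤
      (Finset.univ.filter (HasPendant G)).card := by
  set P : Finset (Σ _ : V, V) := (Finset.univ.filter fun v => deg G v = 2).sigma
    fun t => Finset.univ.filter fun x => G.Adj t x with hP
  have hlow : 2 * (Finset.univ.filter fun v => deg G v = 2).card = P.card := by
    rw [hP, Finset.card_sigma, mul_comm, ← smul_eq_mul]
    refine (Finset.sum_const_nat fun t ht => ?_).symm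
    rw [← (Finset.mem_filter.1 ht).2, deg, ← Set.ncard_coe_finset]
    congr 1
    ext
    simp
  rw [hlow]
  have hmem : ∀ q ∈ P, deg G q.1 = 2 ∧ G.Adj q.1 q.2 := by
    rintro ⟨t, x⟩ h
    simpa [hP] using h
  refine Finset.card_le_card_of_injOn Sigma.snd ?_ ?_
  · intro q hq
    obtain ⟨h1, h2⟩ := hmem q hq
    exact Finset.mem_filter.2 ⟨Finset.mem_univ _, hG.deg_eq_three_of_adj h1 h2, q.1, h2.symm, h1⟩
  · rintro ⟨t, x⟩ hq ⟨s, y⟩ hq' (rfl : x = y)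
    obtain ⟨h1, h2⟩ := hmem _ hq
    obtain ⟨k1, k2⟩ := hmem _ hq'
    obtain rfl := hG.eq_of_deg_two (hG.deg_eq_three_of_adj h1 h2) h2.symm k2.symm h1 k1
    rfl

theorem edge_bound (hP : ¬ ∃ v, Nonempty (G ≃g petersen.induce {w | w ≠ v})) :
    50 * Fintype.card V ≤ 37 * G.edgeSet.ncard := by
  classical
  have h1 := hG.two_mul_card_hasPendant_le hP
  have h2 := hG.two_mul_card_deg_two_le
  have hsum : ∑ v, deg G v = 2 * (Finset.univ.filter fun v => deg G v = 2).card +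
      3 * (Finset.univ.filter fun v => ¬ deg G v = 2).card := by
    rw [← Finset.sum_filter_add_sum_filter_not Finset.univ fun v => deg G v = 2]
    congr 1
    · rw [mul_comm]
      exact Finset.sum_const_nat fun v hv => (Finset.mem_filter.1 hv).2
    · rw [mul_comm]
      exact Finset.sum_const_nat fun v hv =>
        (hG.deg_eq_two_or_three v).resolve_left (Finset.mem_filter.1 hv).2
  have hcard := Finset.card_filter_add_card_filter_not (s := (Finset.univ : Finset V))
    fun v => deg G v = 2
  have hthree : (Finset.univ.filter (HasPendant G)).card + (Finset.univ.filter (IsFree G)).card ≤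
      (Finset.univ.filter fun v => ¬ deg G v = 2).card := by
    rw [← Finset.card_union_of_disjoint]
    · refine Finset.card_le_card fun x hx => ?_
      simp only [Finset.mem_union, Finset.mem_filter, Finset.mem_univ, true_and] at hx ⊢
      rcases hx with hx | hx <;> simp [hx.1]
    · refine Finset.disjoint_left.2 fun x hx hx' => ?_
      exact (Finset.mem_filter.1 hx').2.ne_of_hasPendant (Finset.mem_filter.1 hx).2 rfl
  rw [Finset.card_univ] at hcard
  rw [sum_deg] at hsum
  omega

end MinimalUncolorable

end

/-- Every 3-critical graph `G` that is not isomorphic to the graph obtained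
from the Petersen graph by deleting one vertex satisfies
`|E(G)| ≥ (50/37)·|V(G)|`. -/
theorem edge_bound_3critical_not_petersen_minus_vertex [Fintype V]
    (G : SimpleGraph V) (hG : IsKCritical G 3)
    (hpet : ∀ v : {s : Finset (Fin 5) // s.card = 2},
      ¬ Nonempty (G ≃g petersen.induce {w | w ≠ v})) :
    (50 : ℚ) / 37 * Fintype.card V ≤ G.edgeSet.ncard := by
  have h := hG.minimalUncolorable.edge_bound (not_exists.2 hpet)
  have h' : (50 : ℚ) * Fintype.card V ≤ 37 * G.edgeSet.ncard := by exact_mod_cast h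
  linarith
end
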